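/- arXiv:1802.02863 — 2 statements merged into one kernel-verified Lean document; each statement's English description precedes it below -/
import Mathlib

section
/- Fix q ∈ ℂ with q ≠ 0, q ≠ ±1, and integers m, n ≥ 1. There exists a (unique) ℂ-algebra homomorphism ρ from U_q(𝔩) to End_ℂ(ℂ[x]) such that: ρ(e_i) = − Σ_{k=1}^m (∏_{t=k}^m γ_{t,i}γ_{t,i+1}^{-1}) X_{k,i+1} ∂_{k,i}, ρ(f_i) = − Σ_{k=1}^m X_{k,i} ∂_{k,i+1} ∏_{t=1}^k γ_{t,i}^{-1}γ_{t,i+1}, and ρ(k_i) = ∏_{t=1}^m γ_{t,i}^{-1}γ_{t,i+1} for i = 1,…,n−1; ρ(k_n) = ∏_{t=1}^n γ_{1,t}^{-1} · ∏_{s=1}^m γ_{s,n}^{-1}; and ρ(e_{n+i}) = Σ_{k=1}^n X_{i,k} ∂_{i+1,k} ∏_{t=k+1}^n γ_{i,t}γ_{i+1,t}^{-1}, ρ(f_{n+i}) = Σ_{k=1}^n (∏_{t=1}^{k−1} γ_{i,t}^{-1}γ_{i+1,t}) X_{i+1,k} ∂_{i,k}, ρ(k_{n+i}) = ∏_{t=1}^n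 γ_{i,t}γ_{i+1,t}^{-1} for i = 1,…,m−1 (with ρ(k_j^{-1}) = ρ(k_j)^{-1} throughout). -/
noncomputable section

open MvPolynomial
open scoped TensorProduct

/-- The `q`-number `[s]_q = (q^s - q^{-s})/(q - q^{-1})`. -/
def qnum (q : ℂ) (s : ℕ) : ℂ := (q ^ s - q⁻¹ ^ s) / (q - q⁻¹)

/-- The Cartan matrix of `sl_N`: `a_{ii} = 2`, `a_{ij} = -1` if `|i-j| = 1`, else `0`. -/
def cartan (i j : ℕ) : ℤ := if i = j then 2 else if i + 1 = j ∨ j + 1 = i then -1 else 0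

/-- Abstract generators `e_i`, `f_i`, `k_i`, `k_i⁻¹` for quantum groups of type `A`
and their parabolic/Levi subalgebras. -/
inductive QGen : Type
  | e : ℕ → QGen
  | f : ℕ → QGen
  | k : ℕ → QGen
  | kinv : ℕ → QGen

/-- The free `ℂ`-algebra on the generators. -/
abbrev FA : Type := FreeAlgebra ℂ QGen

def ge (i : ℕ) : FA := FreeAlgebra.ι ℂ (QGen.e i)
def gf (i : ℕ) : FA := FreeAlgebra.ι ℂ (QGen.f i)
def gk (i : ℕ) : FA := FreeAlgebra.ι ℂ (QGen.k i)
def gkinv (i : ℕ) : FA := FreeAlgebra.ι ℂ (QGen.kinv i)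

/-- Validity of the index of a Cartan generator `k_i`, `1 ≤ i ≤ N-1`. -/
def kOK (N i : ℕ) : Prop := 1 ≤ i ∧ i ≤ N - 1

/-- The defining relations of `U_q(sl_N(ℂ))` among the generators `e_i` (for valid
indices `i` with `eok i`), `f_i` (for valid indices `i` with `fok i`) and `k_i^{±1}`
(for `1 ≤ i ≤ N-1`).  Generators with invalid indices are set to `0`, so that the
quotient is exactly the algebra presented by the valid generators and the defining
relations of `U_q(sl_N(ℂ))` involving only those generators.  Taking
`eok = fok = ⊤` gives `U_q(sl_N)`; `eok = ⊤`, `fok i = (i ≠ n)` gives the parabolic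
subalgebra `U_q(𝔭)`; `eok i = fok i = (i ≠ n)` gives the Levi subalgebra `U_q(𝔩)`. -/
inductive QRel (q : ℂ) (N : ℕ) (eok fok : ℕ → Prop) : FA → FA → Prop
  | e_junk (i : ℕ) (h : ¬(kOK N i ∧ eok i)) : QRel q N eok fok (ge i) 0
  | f_junk (i : ℕ) (h : ¬(kOK N i ∧ fok i)) : QRel q N eok fok (gf i) 0
  | k_junk (i : ℕ) (h : ¬ kOK N i) : QRel q N eok fok (gk i) 0
  | kinv_junk (i : ℕ) (h : ¬ kOK N i) : QRel q N eok fok (gkinv i) 0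
  | k_kinv (i : ℕ) (h : kOK N i) : QRel q N eok fok (gk i * gkinv i) 1
  | kinv_k (i : ℕ) (h : kOK N i) : QRel q N eok fok (gkinv i * gk i) 1
  | k_comm (i j : ℕ) (hi : kOK N i) (hj : kOK N j) :
      QRel q N eok fok (gk i * gk j) (gk j * gk i)
  | k_e (i j : ℕ) (hi : kOK N i) (hj : kOK N j ∧ eok j) :
      QRel q N eok fok (gk i * ge j * gkinv i) ((q ^ cartan i j) • ge j)
  | k_f (i j : ℕ) (hi : kOK N i) (hj : kOK N j ∧ fok j) :
      QRel q N eok fok (gk i * gf j * gkinv i) ((q ^ (-cartan i j)) • gf j)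
  | e_f (i j : ℕ) (hi : kOK N i ∧ eok i) (hj : kOK N j ∧ fok j) :
      QRel q N eok fok (ge i * gf j - gf j * ge i)
        (if i = j then (q - q⁻¹)⁻¹ • (gk i - gkinv i) else 0)
  | serre_e (i j : ℕ) (hi : kOK N i ∧ eok i) (hj : kOK N j ∧ eok j)
      (hadj : i + 1 = j ∨ j + 1 = i) :
      QRel q N eok fok
        (ge i ^ 2 * ge j - (q + q⁻¹) • (ge i * ge j * ge i) + ge j * ge i ^ 2) 0
  | serre_f (i j : ℕ) (hi : kOK N i ∧ fok i) (hj : kOK N j ∧ fok j)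
      (hadj : i + 1 = j ∨ j + 1 = i) :
      QRel q N eok fok
        (gf i ^ 2 * gf j - (q + q⁻¹) • (gf i * gf j * gf i) + gf j * gf i ^ 2) 0
  | e_e (i j : ℕ) (hi : kOK N i ∧ eok i) (hj : kOK N j ∧ eok j)
      (hfar : i + 1 < j ∨ j + 1 < i) :
      QRel q N eok fok (ge i * ge j) (ge j * ge i)
  | f_f (i j : ℕ) (hi : kOK N i ∧ fok i) (hj : kOK N j ∧ fok j)
      (hfar : i + 1 < j ∨ j + 1 < i) :
      QRel q N eok fok (gf i * gf j) (gf j * gf i)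

/-- The Levi quantum subgroup `U_q(𝔩)` of `U_q(sl_{n+m}(ℂ))`: generators `e_i, f_i`
for `i ∈ {1,…,n+m−1} \ {n}` and `k_i^{±1}` for `1 ≤ i ≤ n+m−1`. -/
abbrev UqL (q : ℂ) (n m : ℕ) : Type := RingQuot (QRel q (n + m) (fun i => i ≠ n) (fun i => i ≠ n))

/-- The images of the generators in `U_q(𝔩)`. -/
def lE (q : ℂ) (n m : ℕ) (i : ℕ) : UqL q n m :=
  RingQuot.mkAlgHom ℂ (QRel q (n + m) (fun i => i ≠ n) (fun i => i ≠ n)) (ge i)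
def lF (q : ℂ) (n m : ℕ) (i : ℕ) : UqL q n m :=
  RingQuot.mkAlgHom ℂ (QRel q (n + m) (fun i => i ≠ n) (fun i => i ≠ n)) (gf i)
def lK (q : ℂ) (n m : ℕ) (i : ℕ) : UqL q n m :=
  RingQuot.mkAlgHom ℂ (QRel q (n + m) (fun i => i ≠ n) (fun i => i ≠ n)) (gk i)
def lKinv (q : ℂ) (n m : ℕ) (i : ℕ) : UqL q n m :=
  RingQuot.mkAlgHom ℂ (QRel q (n + m) (fun i => i ≠ n) (fun i => i ≠ n)) (gkinv i)

/-- The polynomial algebra `ℂ[x_{j,k} ; 1 ≤ j ≤ m, 1 ≤ k ≤ n]` of functions on `ū*`;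
the variable `x_{j,k}` is `X (⟨j-1,_⟩, ⟨k-1,_⟩)`. -/
abbrev Pmn (m n : ℕ) : Type := MvPolynomial (Fin m × Fin n) ℂ

/-- The multiplication operator by `x_{a,b}` (1-based indices) on `ℂ[x]`. -/
def Xop (m n : ℕ) (a b : ℕ) : Module.End ℂ (Pmn m n) :=
  if h : a - 1 < m ∧ b - 1 < n then
    LinearMap.mulLeft ℂ (X (⟨a - 1, h.1⟩, ⟨b - 1, h.2⟩)) else 0

/-- The algebra automorphism `γ_{a,b}` (1-based indices) of `ℂ[x]`, sending `x_{a,b}`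
to `q·x_{a,b}` and fixing the other variables, as a linear endomorphism.  Its inverse
is `Gam q⁻¹ m n a b`. -/
def Gam (q : ℂ) (m n : ℕ) (a b : ℕ) : Module.End ℂ (Pmn m n) :=
  if h : a - 1 < m ∧ b - 1 < n then
    (aeval (R := ℂ) (fun p : Fin m × Fin n =>
      if p = ((⟨a - 1, h.1⟩ : Fin m), (⟨b - 1, h.2⟩ : Fin n)) then C q * X p else X p)).toLinearMap
  else 1

/-- The `q`-partial derivative `∂_{a,b}` (1-based indices): the `ℂ`-linear endomorphism
of `ℂ[x]` sending the monomial `x^r` to `[r_{a,b}]_q · x^{r − 1_{a,b}}` (which is `0`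
when `r_{a,b} = 0`, since `[0]_q = 0`). -/
def Pd (q : ℂ) (m n : ℕ) (a b : ℕ) : Module.End ℂ (Pmn m n) :=
  if h : a - 1 < m ∧ b - 1 < n then
    (basisMonomials (Fin m × Fin n) ℂ).constr ℂ (fun r =>
      qnum q (r (⟨a - 1, h.1⟩, ⟨b - 1, h.2⟩)) •
        monomial (r - Finsupp.single (⟨a - 1, h.1⟩, ⟨b - 1, h.2⟩) 1) (1 : ℂ))
  else 0

/-- Ordered product `∏_{t=a}^{b} g t` (the empty product `1` when `b < a`). -/
def oprod {M : Type*} [Monoid M] (a b : ℕ) (g : ℕ → M) : M :=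
  ((List.range' a (b + 1 - a)).map g).prod

namespace St17

section Abstract
variable {A : Type*} [Ring A] [Algebra ℂ A]

/-- The quantum group relations, for all natural indices. -/
structure QR (q : ℂ) (e f k k' : ℕ → A) : Prop where
  kk : ∀ i, k i * k' i = 1
  k'k : ∀ i, k' i * k i = 1
  kc : ∀ i j, Commute (k i) (k j)
  ke : ∀ i j, k i * e j = (q ^ cartan i j) • (e j * k i)
  kf : ∀ i j, k i * f j = (q ^ (-cartan i j)) • (f j * k i)
  ef : ∀ i j, e i * f j - f j * e i = if i = j then (q - q⁻¹)⁻¹ • (k i - k' i) else 0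
  se : ∀ i j, (i + 1 = j ∨ j + 1 = i) →
    e i ^ 2 * e j - (q + q⁻¹) • (e i * e j * e i) + e j * e i ^ 2 = 0
  sf : ∀ i j, (i + 1 = j ∨ j + 1 = i) →
    f i ^ 2 * f j - (q + q⁻¹) • (f i * f j * f i) + f j * f i ^ 2 = 0
  ee : ∀ i j, (i + 1 < j ∨ j + 1 < i) → e i * e j = e j * e i
  ff : ∀ i j, (i + 1 < j ∨ j + 1 < i) → f i * f j = f j * f i

theorem cartan_symm (i j : ℕ) : cartan i j = cartan j i := by
  unfold cartan
  by_cases h : i = j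
  · simp [h]
  · simp only [if_neg h, if_neg (Ne.symm h), or_comm]

theorem cartan_adj {i j : ℕ} (h : i + 1 = j ∨ j + 1 = i) : cartan i j = -1 := by
  unfold cartan
  rw [if_neg (by omega), if_pos h]

theorem cartan_far {i j : ℕ} (h : i + 1 < j ∨ j + 1 < i) : cartan i j = 0 := by
  unfold cartan
  rw [if_neg (by omega), if_neg (by omega)]

theorem cartan_self (i : ℕ) : cartan i i = 2 := by simp [cartan]

/-- moving an inverse past: `k x = c x k` gives `k' x = c⁻¹ x k'`. -/
theorem inv_move {k k' x : A} (h1 : k * k' = 1) (h2 : k' * k = 1) {c : ℂ} (hc : c ≠ 0)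
    (h : k * x = c • (x * k)) : k' * x = c⁻¹ • (x * k') := by
  have : k' * (k * x) * k' = c • (k' * x * (k * k')) := by
    rw [h]; simp [mul_assoc]
  rw [← mul_assoc, h2, h1, one_mul, mul_one] at this
  rw [this, smul_smul, inv_mul_cancel₀ hc, one_smul]

theorem move_symm {k x : A} {c : ℂ} (hc : c ≠ 0)
    (h : k * x = c • (x * k)) : x * k = c⁻¹ • (k * x) := by
  rw [h, smul_smul, inv_mul_cancel₀ hc, one_smul]

theorem serre_add {q : ℂ} (hq : q ≠ 0) {a a' b b' : A}
    (h1 : b * a = (q ^ 2) • (a * b)) (h2 : b * a' = q⁻¹ • (a' * b))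
    (h3 : b' * a = q⁻¹ • (a * b'))
    (ha : a ^ 2 * a' - (q + q⁻¹) • (a * a' * a) + a' * a ^ 2 = 0)
    (hb : b ^ 2 * b' - (q + q⁻¹) • (b * b' * b) + b' * b ^ 2 = 0) :
    (a + b) ^ 2 * (a' + b') - (q + q⁻¹) • ((a + b) * (a' + b') * (a + b))
      + (a' + b') * (a + b) ^ 2 = 0 := by
  have h1' : ∀ z, b * (a * z) = (q ^ 2) • (a * (b * z)) := fun z => by
    rw [← mul_assoc, h1, smul_mul_assoc, mul_assoc]
  have h2' : ∀ z, b * (a' * z) = q⁻¹ • (a' * (b * z)) := fun z => by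
    rw [← mul_assoc, h2, smul_mul_assoc, mul_assoc]
  have h3' : ∀ z, b' * (a * z) = q⁻¹ • (a * (b' * z)) := fun z => by
    rw [← mul_assoc, h3, smul_mul_assoc, mul_assoc]
  have key : (a + b) ^ 2 * (a' + b') - (q + q⁻¹) • ((a + b) * (a' + b') * (a + b))
      + (a' + b') * (a + b) ^ 2 =
      (a ^ 2 * a' - (q + q⁻¹) • (a * a' * a) + a' * a ^ 2) +
      (b ^ 2 * b' - (q + q⁻¹) • (b * b' * b) + b' * b ^ 2) := by
    simp only [pow_two, mul_add, add_mul, mul_assoc, h1, h2, h3, h1', h2', h3', mul_smul_comm,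
      smul_mul_assoc, smul_add, smul_smul]
    match_scalars <;> field_simp <;> ring
  rw [key, ha, hb, add_zero]

theorem QR.trivial (q : ℂ) : QR q (fun _ => (0 : A)) (fun _ => 0) (fun _ => 1) (fun _ => 1) := by
  constructor <;> simp

theorem QR.swap {q : ℂ} {e f k k' : ℕ → A} (h : QR q e f k k') : QR q⁻¹ f e k k' where
  kk := h.kk
  k'k := h.k'k
  kc := h.kc
  ke i j := by rw [h.kf]; simp
  kf i j := by rw [h.ke]; simp
  ef i j := by
    rw [← neg_sub, h.ef]
    by_cases hij : i = j
    · subst hij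
      rw [if_pos rfl, if_pos rfl, inv_inv, ← neg_sub q q⁻¹, inv_neg, neg_smul]
    · rw [if_neg hij, if_neg (Ne.symm hij), neg_zero]
  se i j hij := by rw [inv_inv, add_comm q⁻¹]; exact h.sf i j hij
  sf i j hij := by rw [inv_inv, add_comm q⁻¹]; exact h.se i j hij
  ee := h.ff
  ff := h.ee

theorem QR.k'e {q : ℂ} (hq : q ≠ 0) {e f k k' : ℕ → A} (h : QR q e f k k') (i j : ℕ) :
    k' i * e j = (q ^ (-cartan i j)) • (e j * k' i) := by
  rw [zpow_neg]
  exact inv_move (h.kk i) (h.k'k i) (zpow_ne_zero _ hq) (h.ke i j)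

theorem QR.k'f {q : ℂ} (hq : q ≠ 0) {e f k k' : ℕ → A} (h : QR q e f k k') (i j : ℕ) :
    k' i * f j = (q ^ (cartan i j)) • (f j * k' i) := by
  have := inv_move (h.kk i) (h.k'k i) (zpow_ne_zero _ hq) (h.kf i j)
  rwa [zpow_neg, inv_inv] at this

theorem QR.k'c {q : ℂ} {e f k k' : ℕ → A} (h : QR q e f k k') (i j : ℕ) :
    Commute (k' i) (k' j) := by
  let u : ℕ → Aˣ := fun i => ⟨k i, k' i, h.kk i, h.k'k i⟩
  have : Commute ((u i : Aˣ) : A) (u j) := h.kc i j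
  exact (Commute.units_inv_left (Commute.units_inv_right this) :
    Commute (((u i)⁻¹ : Aˣ) : A) ((u j)⁻¹ : Aˣ))

theorem QR.kk'c {q : ℂ} {e f k k' : ℕ → A} (h : QR q e f k k') (i j : ℕ) :
    Commute (k i) (k' j) := by
  let u : ℕ → Aˣ := fun i => ⟨k i, k' i, h.kk i, h.k'k i⟩
  have : Commute ((u i : Aˣ) : A) (u j) := h.kc i j
  exact (Commute.units_inv_right this : Commute ((u i : Aˣ) : A) ((u j)⁻¹ : Aˣ))

/-- the Chevalley involution -/
theorem QR.omega {q : ℂ} (hq : q ≠ 0) {e f k k' : ℕ → A} (h : QR q e f k k') :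
    QR q f e k' k where
  kk := h.k'k
  k'k := h.kk
  kc := h.k'c
  ke := h.k'f hq
  kf := h.k'e hq
  ef i j := by
    rw [← neg_sub, h.ef]
    by_cases hij : i = j
    · subst hij
      rw [if_pos rfl, if_pos rfl, ← smul_neg, neg_sub]
    · rw [if_neg hij, if_neg (Ne.symm hij), neg_zero]
  se := h.sf
  sf := h.se
  ee := h.ff
  ff := h.ee

theorem comm_assoc {x y : A} (h : Commute x y) (z : A) : x * (y * z) = y * (x * z) := by
  rw [← mul_assoc, h.eq, mul_assoc]

/-- Serre relation after left multiplication by commuting elements with twisting. -/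
theorem serre_twist {q : ℂ} {c c' a a' : A} {u : ℂ}
    (hcc : Commute c c')
    (h1 : a * c = (u ^ 2) • (c * a)) (h2 : a * c' = u⁻¹ • (c' * a))
    (h3 : a' * c = u⁻¹ • (c * a')) (hu : u ≠ 0)
    (ha : a ^ 2 * a' - (q + q⁻¹) • (a * a' * a) + a' * a ^ 2 = 0) :
    (c * a) ^ 2 * (c' * a') - (q + q⁻¹) • ((c * a) * (c' * a') * (c * a))
      + (c' * a') * (c * a) ^ 2 = 0 := by
  have h1' : ∀ z, a * (c * z) = (u ^ 2) • (c * (a * z)) := fun z => by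
    rw [← mul_assoc, h1, smul_mul_assoc, mul_assoc]
  have h2' : ∀ z, a * (c' * z) = u⁻¹ • (c' * (a * z)) := fun z => by
    rw [← mul_assoc, h2, smul_mul_assoc, mul_assoc]
  have h3' : ∀ z, a' * (c * z) = u⁻¹ • (c * (a' * z)) := fun z => by
    rw [← mul_assoc, h3, smul_mul_assoc, mul_assoc]
  have hcc' : ∀ z, c' * (c * z) = c * (c' * z) := fun z => comm_assoc hcc.symm z
  have key : (c * a) ^ 2 * (c' * a') - (q + q⁻¹) • ((c * a) * (c' * a') * (c * a))
      + (c' * a') * (c * a) ^ 2 =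
      c * c * c' * (a ^ 2 * a' - (q + q⁻¹) • (a * a' * a) + a' * a ^ 2) := by
    simp only [pow_two, mul_add, mul_sub, mul_assoc, h1, h2, h3, h1', h2', h3', hcc', mul_smul_comm,
      smul_mul_assoc, smul_smul]
    match_scalars <;> field_simp
  rw [key, ha, mul_zero]

theorem serre_smul {q : ℂ} {a a' : A} (s : ℂ)
    (ha : a ^ 2 * a' - (q + q⁻¹) • (a * a' * a) + a' * a ^ 2 = 0) :
    (s • a) ^ 2 * (s • a') - (q + q⁻¹) • ((s • a) * (s • a') * (s • a))
      + (s • a') * (s • a) ^ 2 = 0 := by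
  have key : (s • a) ^ 2 * (s • a') - (q + q⁻¹) • ((s • a) * (s • a') * (s • a))
      + (s • a') * (s • a) ^ 2
    = (s ^ 3) • (a ^ 2 * a' - (q + q⁻¹) • (a * a' * a) + a' * a ^ 2) := by
    simp only [pow_two, smul_mul_assoc, mul_smul_comm, smul_smul, smul_add, smul_sub]
    match_scalars <;> ring
  rw [key, ha, smul_zero]

theorem cross_comm {c c' a a' : A} {u : ℂ} (hcc : Commute c c') (haa : a * a' = a' * a)
    (h2 : a * c' = u • (c' * a)) (h3 : a' * c = u • (c * a')) :
    (c * a) * (c' * a') = (c' * a') * (c * a) := by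
  calc (c * a) * (c' * a') = c * (a * c') * a' := by simp only [mul_assoc]
    _ = u • (c * c' * (a * a')) := by rw [h2]; simp [mul_assoc]
    _ = u • (c' * c * (a' * a)) := by rw [hcc.eq, haa]
    _ = c' * (a' * c) * a := by rw [h3]; simp [mul_assoc]
    _ = _ := by simp only [mul_assoc]

theorem QR.ek' {q : ℂ} (hq : q ≠ 0) {e f k k' : ℕ → A} (h : QR q e f k k') (i j : ℕ) :
    e j * k' i = (q ^ (cartan i j)) • (k' i * e j) := by
  have := move_symm (zpow_ne_zero _ hq) (h.k'e hq i j)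
  rwa [zpow_neg, inv_inv] at this

theorem QR.tw_se {q : ℂ} (hq : q ≠ 0) {e f k k' : ℕ → A} (h : QR q e f k k') (i j : ℕ)
    (hij : i + 1 = j ∨ j + 1 = i) :
    (k' i * e i) ^ 2 * (k' j * e j) - (q + q⁻¹) • ((k' i * e i) * (k' j * e j) * (k' i * e i))
      + (k' j * e j) * (k' i * e i) ^ 2 = 0 := by
  refine serre_twist (u := q) (h.k'c i j) ?_ ?_ ?_ hq (h.se i j hij)
  · rw [h.ek' hq, cartan_self]; rfl
  · rw [h.ek' hq, cartan_adj hij.symm, zpow_neg_one]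
  · rw [h.ek' hq, cartan_adj hij, zpow_neg_one]

theorem QR.tw_ee {q : ℂ} (hq : q ≠ 0) {e f k k' : ℕ → A} (h : QR q e f k k') (i j : ℕ)
    (hij : i + 1 < j ∨ j + 1 < i) :
    (k' i * e i) * (k' j * e j) = (k' j * e j) * (k' i * e i) := by
  refine cross_comm (u := 1) (h.k'c i j) (h.ee i j hij) ?_ ?_
  · rw [h.ek' hq, cartan_far hij.symm, zpow_zero]
  · rw [h.ek' hq, cartan_far hij, zpow_zero]

theorem QR.fk {q : ℂ} (hq : q ≠ 0) {e f k k' : ℕ → A} (h : QR q e f k k') (i : ℕ) :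
    -(f i * k i) = (-q ^ 2) • (k i * f i) := by
  have := move_symm (zpow_ne_zero _ hq) (h.kf i i)
  rw [this, cartan_self, zpow_neg, inv_inv, neg_smul]; rfl

/-- twisting by the Cartan elements -/
theorem QR.twist {q : ℂ} (hq : q ≠ 0) {e f k k' : ℕ → A} (h : QR q e f k k') :
    QR q (fun i => -(k' i * e i)) (fun i => -(f i * k i)) k k' where
  kk := h.kk
  k'k := h.k'k
  kc := h.kc
  ke i j := by
    rw [mul_neg, comm_assoc (h.kk'c i j), h.ke, neg_mul, smul_neg, mul_smul_comm, mul_assoc]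
  kf i j := by
    rw [mul_neg, ← mul_assoc, h.kf, neg_mul, smul_neg, smul_mul_assoc, mul_assoc, mul_assoc,
      (h.kc i j).eq]
  ef i j := by
    rw [← h.ef i j]
    simp only [neg_mul_neg]
    have h1 : f j * k j * (k' i * e i) =
        (q ^ (-cartan i i) * q ^ (cartan i j)) • (f j * e i * (k' i * k j)) := by
      calc f j * k j * (k' i * e i) = f j * (k j * (k' i * e i)) := by rw [mul_assoc]
        _ = f j * (k' i * (k j * e i)) := by rw [comm_assoc (h.kk'c j i)]
        _ = _ := by
          rw [h.ke, mul_smul_comm, ← mul_assoc (k' i), h.k'e hq, smul_mul_assoc, smul_smul,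
            cartan_symm j i, mul_smul_comm, mul_comm (q ^ cartan i j)]
          simp only [mul_assoc]
    have h2 : k' i * e i * (f j * k j) =
        (q ^ (-cartan i i) * q ^ (cartan i j)) • (e i * f j * (k' i * k j)) := by
      rw [h.k'e hq]
      calc (q ^ (-cartan i i)) • (e i * k' i) * (f j * k j)
          = (q ^ (-cartan i i)) • (e i * (k' i * f j) * k j) := by
            simp only [mul_assoc, smul_mul_assoc]
        _ = _ := by
          rw [h.k'f hq]; simp only [mul_assoc, smul_smul, smul_mul_assoc, mul_smul_comm]
    rw [h1, h2, ← smul_sub, ← sub_mul, h.ef]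
    by_cases hij : i = j
    · subst hij
      rw [h.k'k, mul_one, ← zpow_add₀ hq, neg_add_cancel, zpow_zero, one_smul]
    · rw [if_neg hij, zero_mul, smul_zero]
  se i j hij := by
    have := serre_smul (-1) (h.tw_se hq i j hij)
    simpa only [neg_smul, one_smul] using this
  sf i j hij := by
    simp only [h.fk hq]
    exact serre_smul _ ((h.omega hq).tw_se hq i j hij)
  ee i j hij := by
    simp only [neg_mul_neg]
    exact h.tw_ee hq i j hij
  ff i j hij := by
    simp only [h.fk hq, smul_mul_assoc, mul_smul_comm]
    rw [(h.omega hq).tw_ee hq i j hij]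

/-- the tensor product of two mutually commuting representations -/
theorem QR.tensor {q : ℂ} (hq : q ≠ 0) {e f k k' e₂ f₂ k₂ k₂' : ℕ → A} (h : QR q e f k k')
    (h₂ : QR q e₂ f₂ k₂ k₂') (B₁ B₂ : Set A) (hB : ∀ x ∈ B₁, ∀ y ∈ B₂, Commute x y)
    (he : ∀ i, e i ∈ B₁) (hf : ∀ i, f i ∈ B₁) (hk : ∀ i, k i ∈ B₁) (hk' : ∀ i, k' i ∈ B₁)
    (he₂ : ∀ i, e₂ i ∈ B₂) (hf₂ : ∀ i, f₂ i ∈ B₂) (hk₂ : ∀ i, k₂ i ∈ B₂)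
    (hk₂' : ∀ i, k₂' i ∈ B₂) :
    QR q (fun i => k₂' i * e i + e₂ i) (fun i => f i + k i * f₂ i)
      (fun i => k i * k₂ i) (fun i => k' i * k₂' i) where
  kk i := by
    rw [mul_assoc, comm_assoc (hB _ (hk' i) _ (hk₂ i)).symm, h₂.kk, mul_one, h.kk]
  k'k i := by
    rw [mul_assoc, comm_assoc (hB _ (hk i) _ (hk₂' i)).symm, h₂.k'k, mul_one, h.k'k]
  kc i j := by
    have c1 := h.kc i j
    have c2 := h₂.kc i j
    have c3 := hB _ (hk i) _ (hk₂ j)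
    have c4 := hB _ (hk j) _ (hk₂ i)
    exact (c1.mul_right c3).mul_left (c4.symm.mul_right c2)
  ke i j := by
    have c1 := hB _ (hk i) _ (hk₂' j)
    have c2 := h₂.kk'c i j
    have c3 := hB _ (hk i) _ (he₂ j)
    have c4 := hB _ (he j) _ (hk₂ i)
    have c5 := hB _ (hk i) _ (hk₂ i)
    have e1 : k i * k₂ i * (k₂' j * e j) = (q ^ cartan i j) • (k₂' j * e j * (k i * k₂ i)) := by
      calc k i * k₂ i * (k₂' j * e j) = k₂' j * (k i * e j) * k₂ i := by
            simp only [mul_assoc]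
            rw [comm_assoc c2, ← c4.eq, comm_assoc c1]
        _ = _ := by rw [h.ke]; simp only [mul_assoc, smul_mul_assoc, mul_smul_comm]
    have e2 : k i * k₂ i * e₂ j = (q ^ cartan i j) • (e₂ j * (k i * k₂ i)) := by
      rw [mul_assoc, h₂.ke, mul_smul_comm, comm_assoc c3]
    rw [mul_add, add_mul, smul_add, e1, e2]
  kf i j := by
    have c1 := hB _ (hk i) _ (hf₂ j)
    have c3 := hB _ (hk j) _ (hk₂ i)
    have c4 := hB _ (hf j) _ (hk₂ i)
    have c5 := h.kc i j
    have e1 : k i * k₂ i * f j = (q ^ (-cartan i j)) • (f j * (k i * k₂ i)) := by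
      rw [mul_assoc, ← c4.eq, ← mul_assoc, h.kf, smul_mul_assoc, mul_assoc]
    have e2 : k i * k₂ i * (k j * f₂ j) = (q ^ (-cartan i j)) • (k j * f₂ j * (k i * k₂ i)) := by
      rw [mul_assoc, comm_assoc c3.symm, h₂.kf, mul_smul_comm, mul_smul_comm, comm_assoc c5,
        comm_assoc c1, mul_assoc]
    rw [mul_add, add_mul, smul_add, e1, e2]
  ef i j := by
    have c1 := hB _ (he i) _ (hf₂ j)
    have c2 := hB _ (hf j) _ (hk₂' i)
    have c3 := hB _ (hf j) _ (he₂ i)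
    have c4 := hB _ (hk j) _ (he₂ i)
    have c5 := hB _ (hk j) _ (hk₂' i)
    have c6 := hB _ (hk' i) _ (hk₂' i)
    have m1 : k₂' i * e i * (k j * f₂ j) = k j * f₂ j * (k₂' i * e i) := by
      calc k₂' i * e i * (k j * f₂ j) = k₂' i * (e i * k j) * f₂ j := by simp only [mul_assoc]
        _ = (q ^ cartan j i)⁻¹ • (k j * (k₂' i * f₂ j) * e i) := by
          rw [move_symm (zpow_ne_zero _ hq) (h.ke j i)]
          simp only [mul_assoc, smul_mul_assoc, mul_smul_comm]
          rw [c1.eq, comm_assoc c5]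
        _ = _ := by
          rw [h₂.k'f hq]
          simp only [mul_assoc, smul_mul_assoc, mul_smul_comm, smul_smul]
          rw [cartan_symm, inv_mul_cancel₀ (zpow_ne_zero _ hq), one_smul]
    have key : (k₂' i * e i + e₂ i) * (f j + k j * f₂ j) - (f j + k j * f₂ j) * (k₂' i * e i + e₂ i)
        = k₂' i * (e i * f j - f j * e i) + k j * (e₂ i * f₂ j - f₂ j * e₂ i) := by
      have m2 : f j * (k₂' i * e i) = k₂' i * (f j * e i) := comm_assoc c2 _
      have m3 : e₂ i * (k j * f₂ j) = k j * (e₂ i * f₂ j) := comm_assoc c4.symm _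
      simp only [mul_add, add_mul, mul_sub, m1, m2, m3, c3.eq]
      simp only [mul_assoc]
      abel
    rw [key, h.ef, h₂.ef]
    by_cases hij : i = j
    · subst hij
      simp only [if_true, mul_smul_comm, ← smul_add, mul_sub]
      rw [c5.eq, c6.eq]
      congr 1
      abel
    · simp [hij]
  se i j hij := by
    have ca := cartan_adj hij
    have ca' := cartan_adj hij.symm
    have g : ∀ i j, e₂ i * (k₂' j * e j) = (q ^ cartan j i) • (k₂' j * e j * e₂ i) := fun i j => by
      rw [← mul_assoc, h₂.ek' hq, smul_mul_assoc, mul_assoc, mul_assoc, (hB _ (he j) _ (he₂ i)).eq]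
    refine serre_add hq ?_ ?_ ?_ ?_ (h₂.se i j hij)
    · rw [g, cartan_self]; rfl
    · rw [g, ca', zpow_neg_one]
    · rw [g, ca, zpow_neg_one]
    · refine serre_twist (u := 1) (h₂.k'c i j) ?_ ?_ ?_ one_ne_zero (h.se i j hij)
      · rw [(hB _ (he i) _ (hk₂' i)).eq]; simp
      · rw [(hB _ (he i) _ (hk₂' j)).eq]; simp
      · rw [(hB _ (he j) _ (hk₂' i)).eq]; simp
  sf i j hij := by
    have ca := cartan_adj hij
    have ca' := cartan_adj hij.symm
    have g : ∀ i j, k i * f₂ i * f j = (q ^ (-cartan i j)) • (f j * (k i * f₂ i)) := fun i j => by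
      rw [mul_assoc, ← (hB _ (hf j) _ (hf₂ i)).eq, ← mul_assoc, h.kf, smul_mul_assoc, mul_assoc]
    have := serre_add (q := q⁻¹) (a := f i) (a' := f j) (b := k i * f₂ i) (b' := k j * f₂ j)
      (inv_ne_zero hq) ?_ ?_ ?_ ?_ ?_
    · rwa [inv_inv, add_comm q⁻¹] at this
    · rw [g, cartan_self, zpow_neg, inv_pow]; rfl
    · rw [g, ca, inv_inv, neg_neg, zpow_one]
    · rw [g, ca', inv_inv, neg_neg, zpow_one]
    · rw [inv_inv, add_comm q⁻¹]; exact h.sf i j hij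
    · rw [inv_inv, add_comm q⁻¹]
      refine serre_twist (u := 1) (h.kc i j) ?_ ?_ ?_ one_ne_zero (h₂.sf i j hij)
      · rw [(hB _ (hk i) _ (hf₂ i)).eq]; simp
      · rw [(hB _ (hk j) _ (hf₂ i)).eq]; simp
      · rw [(hB _ (hk i) _ (hf₂ j)).eq]; simp
  ee i j hij := by
    have ca := cartan_far hij
    have ca' := cartan_far hij.symm
    have g : ∀ i j, cartan j i = 0 → e₂ i * (k₂' j * e j) = k₂' j * e j * e₂ i := fun i j hc => by
      rw [← mul_assoc, h₂.ek' hq, hc, zpow_zero, one_smul, mul_assoc, mul_assoc,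
        (hB _ (he j) _ (he₂ i)).eq]
    have g2 := cross_comm (u := 1) (h₂.k'c i j) (h.ee i j hij)
      (by rw [(hB _ (he i) _ (hk₂' j)).eq]; simp) (by rw [(hB _ (he j) _ (hk₂' i)).eq]; simp)
    rw [mul_add, add_mul, add_mul, mul_add, add_mul, add_mul, g2, g i j ca', g j i ca,
      h₂.ee i j hij]
    abel
  ff i j hij := by
    have ca := cartan_far hij
    have ca' := cartan_far hij.symm
    have g : ∀ i j, cartan i j = 0 → k i * f₂ i * f j = f j * (k i * f₂ i) := fun i j hc => by
      rw [mul_assoc, ← (hB _ (hf j) _ (hf₂ i)).eq, ← mul_assoc, h.kf, hc, neg_zero, zpow_zero,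
        one_smul, mul_assoc]
    have g2 := cross_comm (u := 1) (h.kc i j) (h₂.ff i j hij)
      (by rw [(hB _ (hk j) _ (hf₂ i)).eq]; simp) (by rw [(hB _ (hk i) _ (hf₂ j)).eq]; simp)
    rw [mul_add, add_mul, add_mul, mul_add, add_mul, add_mul, g2, g i j ca, g j i ca',
      h.ff i j hij]
    abel

end Abstract
end St17
namespace St17

/-! ### Laurent model -/

/-- exponent vectors -/
abbrev V : Type := ℕ × ℕ → ℤ
/-- the Laurent polynomial space -/
def L : Type := V →₀ ℂ

instance : AddCommGroup L := inferInstanceAs (AddCommGroup (V →₀ ℂ))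
instance : Module ℂ L := inferInstanceAs (Module ℂ (V →₀ ℂ))

/-- basis of Laurent monomials -/
def bv : Module.Basis V ℂ L :=
  (Finsupp.basisSingleOne : Module.Basis V ℂ (V →₀ ℂ))

/-- weighted shift -/
def W (c : V → ℂ) (d : V) : Module.End ℂ L :=
  bv.constr ℂ (fun r => c r • bv (r + d))

theorem W_bv (c : V → ℂ) (d r : V) : W c d (bv r) = c r • bv (r + d) := by
  simp [W, Module.Basis.constr_basis]

theorem L_ext {T U : Module.End ℂ L} (h : ∀ r, T (bv r) = U (bv r)) : T = U :=
  bv.ext h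

theorem W_mul (c c' : V → ℂ) (d d' : V) :
    W c d * W c' d' = W (fun r => c (r + d') * c' r) (d + d') := by
  refine L_ext fun r => ?_
  simp only [Module.End.mul_apply, W_bv, map_smul, smul_smul]
  rw [mul_comm, add_assoc, add_comm d']

theorem W_congr {c c' : V → ℂ} {d d' : V} (hd : d = d') (hc : ∀ r, c r = c' r) :
    W c d = W c' d' := by
  subst hd; congr 1; funext r; exact hc r

theorem W_add (c c' : V → ℂ) (d : V) : W c d + W c' d = W (fun r => c r + c' r) d := by
  refine L_ext fun r => ?_
  simp only [LinearMap.add_apply, W_bv, add_smul]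

theorem W_smul (z : ℂ) (c : V → ℂ) (d : V) : z • W c d = W (fun r => z * c r) d := by
  refine L_ext fun r => ?_
  simp only [LinearMap.smul_apply, W_bv, smul_smul]

theorem W_neg (c : V → ℂ) (d : V) : - W c d = W (fun r => - c r) d := by
  refine L_ext fun r => ?_
  simp only [LinearMap.neg_apply, W_bv, neg_smul]

theorem W_sub (c c' : V → ℂ) (d : V) : W c d - W c' d = W (fun r => c r - c' r) d := by
  refine L_ext fun r => ?_
  simp only [LinearMap.sub_apply, W_bv, sub_smul]

theorem W_one : W (fun _ => 1) 0 = 1 := by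
  refine L_ext fun r => ?_
  simp [W_bv]

theorem W_zero (d : V) : W (fun _ => 0) d = 0 := by
  refine L_ext fun r => ?_
  simp [W_bv]

theorem W_comm {c c' : V → ℂ} {d d' : V} (h : ∀ r, c (r + d') * c' r = c' (r + d) * c r) :
    Commute (W c d) (W c' d') := by
  unfold Commute SemiconjBy
  rw [W_mul, W_mul]
  exact W_congr (add_comm _ _) h

theorem W_comm0 (c c' : V → ℂ) : Commute (W c 0) (W c' 0) :=
  W_comm fun r => by rw [add_zero, mul_comm]

theorem W_serre {t : ℂ} {c c' : V → ℂ} {d d' : V}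
    (h : ∀ r, c (r + d' + d) * c (r + d') * c' r - t * (c (r + d + d') * c' (r + d) * c r) +
      c' (r + d + d) * c (r + d) * c r = 0) :
    W c d ^ 2 * W c' d' - t • (W c d * W c' d' * W c d) + W c' d' * W c d ^ 2 = 0 := by
  refine L_ext fun r => ?_
  simp only [pow_two, LinearMap.add_apply, LinearMap.sub_apply, LinearMap.smul_apply,
    Module.End.mul_apply, W_bv, LinearMap.zero_apply, map_smul, smul_smul]
  have e1 : r + d + d' + d = r + d' + d + d := by abel
  have e2 : r + d + d + d' = r + d' + d + d := by abel
  rw [e1, e2, ← sub_smul, ← add_smul, ← zero_smul ℂ (bv (r + d' + d + d))]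
  congr 1
  rw [← h r]
  ring

/-- q-number of an integer -/
def qz (q : ℂ) (r : ℤ) : ℂ := (q ^ r - q ^ (-r)) / (q - q⁻¹)

/-- multiplication by a variable -/
def Xl (s : ℕ × ℕ) : Module.End ℂ L := W (fun _ => 1) (Pi.single s 1)
/-- q-derivative -/
def Dl (q : ℂ) (s : ℕ × ℕ) : Module.End ℂ L := W (fun r => qz q (r s)) (-Pi.single s 1)
/-- scaling automorphism -/
def Gl (q : ℂ) (s : ℕ × ℕ) : Module.End ℂ L := W (fun r => q ^ (r s)) 0

theorem XD (q : ℂ) (s s' : ℕ × ℕ) :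
    Xl s * Dl q s' = W (fun r => qz q (r s')) (Pi.single s 1 - Pi.single s' 1) := by
  rw [Xl, Dl, W_mul]
  exact W_congr (sub_eq_add_neg _ _).symm fun r => by rw [one_mul]

theorem GG' {q : ℂ} (hq : q ≠ 0) (s s' : ℕ × ℕ) :
    Gl q s * Gl q⁻¹ s' = W (fun r => q ^ (r s - r s')) 0 := by
  rw [Gl, Gl, W_mul]
  refine W_congr (add_zero _) fun r => ?_
  rw [add_zero, inv_zpow', ← zpow_add₀ hq, sub_eq_add_neg]

theorem G'G {q : ℂ} (hq : q ≠ 0) (s s' : ℕ × ℕ) :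
    Gl q⁻¹ s * Gl q s' = W (fun r => q ^ (r s' - r s)) 0 := by
  rw [← GG' hq]; exact W_comm0 _ _

/-- single-strand representation -/
theorem base {q : ℂ} (hq : q ≠ 0) (hq2 : q - q⁻¹ ≠ 0) (s : ℕ → ℕ × ℕ)
    (hs : Function.Injective s) :
    QR q (fun i => Xl (s i) * Dl q (s (i + 1))) (fun i => Xl (s (i + 1)) * Dl q (s i))
      (fun i => Gl q (s i) * Gl q⁻¹ (s (i + 1))) (fun i => Gl q⁻¹ (s i) * Gl q (s (i + 1))) := by
  have hq3 : q ^ 2 - 1 ≠ 0 := by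
    intro h; apply hq2; field_simp; rw [h, mul_zero]
  simp only [XD, GG' hq, G'G hq]
  constructor
  · intro i
    rw [W_mul, ← W_one]
    refine W_congr (add_zero _) fun r => ?_
    rw [add_zero, ← zpow_add₀ hq]; simp
  · intro i
    rw [W_mul, ← W_one]
    refine W_congr (add_zero _) fun r => ?_
    rw [add_zero, ← zpow_add₀ hq]; simp
  · intro i j; exact W_comm0 _ _
  · intro i j
    rw [W_mul, W_mul, W_smul]
    refine W_congr (add_comm _ _) fun r => ?_
    have : cartan i j = (Pi.single (s j) 1 - Pi.single (s (j + 1)) 1 : V) (s i) -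
      (Pi.single (s j) 1 - Pi.single (s (j + 1)) 1 : V) (s (i + 1)) := by
      simp only [cartan, Pi.sub_apply, Pi.single_apply, hs.eq_iff]
      split_ifs <;> omega
    rw [this, add_zero, mul_comm (qz _ _), ← mul_assoc, ← zpow_add₀ hq]
    congr 2
    simp only [Pi.add_apply]; ring
  · intro i j
    rw [W_mul, W_mul, W_smul]
    refine W_congr (add_comm _ _) fun r => ?_
    have : -cartan i j = (Pi.single (s (j + 1)) 1 - Pi.single (s j) 1 : V) (s i) -
      (Pi.single (s (j + 1)) 1 - Pi.single (s j) 1 : V) (s (i + 1)) := by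
      simp only [cartan, Pi.sub_apply, Pi.single_apply, hs.eq_iff]
      split_ifs <;> omega
    rw [this, add_zero, mul_comm (qz _ _), ← mul_assoc, ← zpow_add₀ hq]
    congr 2
    simp only [Pi.add_apply]; ring
  · intro i j
    by_cases hij : i = j
    · subst hij
      rw [if_pos rfl, W_mul, W_mul, W_sub, W_smul, add_comm (Pi.single (s (i + 1)) 1 - _), W_sub]
      refine W_congr (by abel) fun r => ?_
      simp [hs.eq_iff]
      simp only [qz, zpow_add₀ hq, zpow_sub₀ hq, neg_add, neg_sub, zpow_neg, zpow_one]
      have h1 : q ^ r (s i) ≠ 0 := zpow_ne_zero _ hq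
      have h2 : q ^ r (s (i + 1)) ≠ 0 := zpow_ne_zero _ hq
      generalize q ^ r (s i) = u at *
      generalize q ^ r (s (i + 1)) = w at *
      field_simp
      ring
    · rw [if_neg hij, sub_eq_zero]
      refine W_comm fun r => ?_
      by_cases h1 : j = i + 1
      · subst h1
        simp [hs.eq_iff, Pi.single_apply, mul_comm]
      have h1' := Ne.symm h1
      simp [hs.eq_iff, hij, h1, h1', Ne.symm hij, Pi.single_apply, mul_comm]
  · intro i j hij
    refine W_serre fun r => ?_
    rcases hij with rfl | rfl
    · have n1 : i + 1 + 1 ≠ i := by omega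
      have n2 : i ≠ i + 1 + 1 := by omega
      simp [hs.eq_iff, Pi.single_apply, n1, n2]
      simp only [qz, zpow_add₀ hq, zpow_sub₀ hq, neg_add, neg_sub, zpow_neg, zpow_one, inv_inv]
      have h1 : q ^ r (s (i + 1)) ≠ 0 := zpow_ne_zero _ hq
      have h2 : q ^ r (s (i + 1 + 1)) ≠ 0 := zpow_ne_zero _ hq
      generalize q ^ r (s (i + 1)) = u at *
      generalize q ^ r (s (i + 1 + 1)) = w at *
      field_simp
      ring
    · have n1 : j + 1 + 1 ≠ j := by omega
      have n2 : j ≠ j + 1 + 1 := by omega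
      simp [hs.eq_iff, Pi.single_apply, n1, n2]
      simp only [qz, zpow_add₀ hq, zpow_sub₀ hq, neg_add, neg_sub, zpow_neg, zpow_one, inv_inv]
      have h1 : q ^ r (s (j + 1)) ≠ 0 := zpow_ne_zero _ hq
      have h2 : q ^ r (s (j + 1 + 1)) ≠ 0 := zpow_ne_zero _ hq
      generalize q ^ r (s (j + 1)) = u at *
      generalize q ^ r (s (j + 1 + 1)) = w at *
      field_simp
      ring
  · intro i j hij
    refine W_serre fun r => ?_
    rcases hij with rfl | rfl
    · have n1 : i + 1 + 1 ≠ i := by omega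
      have n2 : i ≠ i + 1 + 1 := by omega
      simp [hs.eq_iff, Pi.single_apply, n1, n2]
      simp only [qz, zpow_add₀ hq, zpow_sub₀ hq, neg_add, neg_sub, zpow_neg, zpow_one, inv_inv]
      have h1 : q ^ r (s i) ≠ 0 := zpow_ne_zero _ hq
      have h2 : q ^ r (s (i + 1)) ≠ 0 := zpow_ne_zero _ hq
      generalize q ^ r (s i) = u at *
      generalize q ^ r (s (i + 1)) = w at *
      field_simp
      ring
    · have n1 : j + 1 + 1 ≠ j := by omega
      have n2 : j ≠ j + 1 + 1 := by omega
      simp [hs.eq_iff, Pi.single_apply, n1, n2]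
      simp only [qz, zpow_add₀ hq, zpow_sub₀ hq, neg_add, neg_sub, zpow_neg, zpow_one, inv_inv]
      have h1 : q ^ r (s j) ≠ 0 := zpow_ne_zero _ hq
      have h2 : q ^ r (s (j + 1)) ≠ 0 := zpow_ne_zero _ hq
      generalize q ^ r (s j) = u at *
      generalize q ^ r (s (j + 1)) = w at *
      field_simp
      ring
  · intro i j hij
    refine W_comm fun r => ?_
    have : j ≠ i := by omega
    have : i + 1 ≠ j := by omega
    have : j + 1 ≠ i := by omega
    have : i ≠ j + 1 := by omega
    have : j ≠ i + 1 := by omega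
    simp [hs.eq_iff, Pi.single_apply, mul_comm, *]
  · intro i j hij
    refine W_comm fun r => ?_
    have : i ≠ j := by omega
    have : i + 1 ≠ j := by omega
    have : j + 1 ≠ i := by omega
    have : i ≠ j + 1 := by omega
    have : j ≠ i + 1 := by omega
    simp [hs.eq_iff, Pi.single_apply, mul_comm, *]

end St17
namespace St17

/-- operators living on a set of sites -/
def Loc (S : Set (ℕ × ℕ)) : Subalgebra ℂ (Module.End ℂ L) :=
  Algebra.adjoin ℂ {T | ∃ c d, T = W c d ∧ (∀ s, s ∉ S → d s = 0) ∧
    (∀ r r' : V, (∀ s ∈ S, r s = r' s) → c r = c r')}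

theorem Loc_W {S : Set (ℕ × ℕ)} {c : V → ℂ} {d : V} (hd : ∀ s, s ∉ S → d s = 0)
    (hc : ∀ r r' : V, (∀ s ∈ S, r s = r' s) → c r = c r') : W c d ∈ Loc S :=
  Algebra.subset_adjoin ⟨c, d, rfl, hd, hc⟩

theorem Loc_X {S : Set (ℕ × ℕ)} {s : ℕ × ℕ} (h : s ∈ S) : Xl s ∈ Loc S :=
  Loc_W (fun t ht => by
    have : t ≠ s := fun h' => ht (h' ▸ h)
    simp [this]) (fun _ _ _ => rfl)

theorem Loc_D (q : ℂ) {S : Set (ℕ × ℕ)} {s : ℕ × ℕ} (h : s ∈ S) : Dl q s ∈ Loc S :=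
  Loc_W (fun t ht => by
    have : t ≠ s := fun h' => ht (h' ▸ h)
    simp [this]) (fun _ _ hr => by rw [hr s h])

theorem Loc_G (q : ℂ) {S : Set (ℕ × ℕ)} {s : ℕ × ℕ} (h : s ∈ S) : Gl q s ∈ Loc S :=
  Loc_W (fun t ht => rfl) (fun _ _ hr => by rw [hr s h])

theorem Loc_comm {S S' : Set (ℕ × ℕ)} (h : Disjoint S S') :
    ∀ x ∈ (Loc S : Set (Module.End ℂ L)), ∀ y ∈ (Loc S' : Set (Module.End ℂ L)), Commute x y := by
  intro x hx y hy
  have h0 : ∀ a ∈ {T | ∃ c d, T = W c d ∧ (∀ s, s ∉ S → d s = 0) ∧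
    (∀ r r' : V, (∀ s ∈ S, r s = r' s) → c r = c r')},
    ∀ b ∈ {T | ∃ c d, T = W c d ∧ (∀ s, s ∉ S' → d s = 0) ∧
    (∀ r r' : V, (∀ s ∈ S', r s = r' s) → c r = c r')}, Commute a b := by
    rintro _ ⟨c, d, rfl, hd, hc⟩ _ ⟨c', d', rfl, hd', hc'⟩
    refine W_comm fun r => ?_
    rw [hc (r + d') r, hc' (r + d) r, mul_comm]
    · intro s hs
      simp [hd s (Set.disjoint_right.1 h hs)]
    · intro s hs
      simp [hd' s (Set.disjoint_left.1 h hs)]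
  refine Algebra.adjoin_induction (p := fun x _ => Commute x y) ?_ ?_ ?_ ?_ hx
  · intro a ha
    refine Algebra.adjoin_induction (p := fun y _ => Commute a y) ?_ ?_ ?_ ?_ hy
    · intro b hb; exact h0 a ha b hb
    · intro z; exact (Algebra.commutes z a).symm
    · intro _ _ _ _ h1 h2; exact h1.add_right h2
    · intro _ _ _ _ h1 h2; exact h1.mul_right h2
  · intro z; exact Algebra.commutes z y
  · intro _ _ _ _ h1 h2; exact h1.add_left h2
  · intro _ _ _ _ h1 h2; exact h1.mul_left h2

theorem oprod_empty {M : Type*} [Monoid M] {a b : ℕ} (h : b < a) (g : ℕ → M) :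
    oprod a b g = 1 := by
  have : b + 1 - a = 0 := by omega
  simp [oprod, this]

theorem oprod_succ {M : Type*} [Monoid M] {a b : ℕ} (h : a ≤ b + 1) (g : ℕ → M) :
    oprod a (b + 1) g = oprod a b g * g (b + 1) := by
  have h1 : b + 1 + 1 - a = (b + 1 - a) + 1 := by omega
  have h2 : a + (b + 1 - a) = b + 1 := by omega
  rw [oprod, oprod, h1, List.range'_1_concat, h2]
  simp

theorem oprod_mem {S : Set (ℕ × ℕ)} {a b : ℕ} {g : ℕ → Module.End ℂ L}
    (h : ∀ t, a ≤ t → t ≤ b → g t ∈ Loc S) : oprod a b g ∈ Loc S := by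
  refine Subalgebra.list_prod_mem _ fun x hx => ?_
  obtain ⟨t, ht, rfl⟩ := List.mem_map.1 hx
  rw [List.mem_range'_1] at ht
  exact h t (by omega) (by omega)

theorem oprod_W {q : ℂ} (hq : q ≠ 0) (a b : ℕ) (p : ℕ → V → ℤ) :
    oprod a b (fun t => W (fun r => q ^ (p t r)) 0) =
      W (fun r => q ^ (∑ t ∈ Finset.Icc a b, p t r)) 0 := by
  induction b with
  | zero =>
    rcases Nat.eq_zero_or_pos a with rfl | ha
    · simp [oprod]
    · rw [oprod_empty ha, ← W_one]
      refine W_congr rfl fun r => ?_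
      rw [Finset.Icc_eq_empty (by omega)]; simp
  | succ b ih =>
    by_cases h : a ≤ b + 1
    · rw [oprod_succ h, ih, W_mul]
      refine W_congr (add_zero _) fun r => ?_
      rw [Finset.sum_Icc_succ_top h, zpow_add₀ hq, add_zero]
    · rw [oprod_empty (by omega), ← W_one]
      refine W_congr rfl fun r => ?_
      rw [Finset.Icc_eq_empty (by omega)]; simp

/-- row operators -/
def rowE (q : ℂ) (m i : ℕ) : Module.End ℂ L := -(∑ k ∈ Finset.Icc 1 m,
  oprod k m (fun t => Gl q (t, i) * Gl q⁻¹ (t, i + 1)) * Xl (k, i + 1) * Dl q (k, i))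
/-- row operators -/
def rowF (q : ℂ) (m i : ℕ) : Module.End ℂ L := -(∑ k ∈ Finset.Icc 1 m,
  Xl (k, i) * Dl q (k, i + 1) * oprod 1 k (fun t => Gl q⁻¹ (t, i) * Gl q (t, i + 1)))
/-- row operators -/
def rowK (q : ℂ) (m i : ℕ) : Module.End ℂ L :=
  oprod 1 m (fun t => Gl q⁻¹ (t, i) * Gl q (t, i + 1))
/-- row operators -/
def rowK' (q : ℂ) (m i : ℕ) : Module.End ℂ L :=
  oprod 1 m (fun t => Gl q (t, i) * Gl q⁻¹ (t, i + 1))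
/-- column operators -/
def colE (q : ℂ) (n i : ℕ) : Module.End ℂ L := ∑ k ∈ Finset.Icc 1 n,
  Xl (i, k) * Dl q (i + 1, k) * oprod (k + 1) n (fun t => Gl q (i, t) * Gl q⁻¹ (i + 1, t))
/-- column operators -/
def colF (q : ℂ) (n i : ℕ) : Module.End ℂ L := ∑ k ∈ Finset.Icc 1 n,
  oprod 1 (k - 1) (fun t => Gl q⁻¹ (i, t) * Gl q (i + 1, t)) * Xl (i + 1, k) * Dl q (i, k)
/-- column operators -/
def colK (q : ℂ) (n i : ℕ) : Module.End ℂ L :=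
  oprod 1 n (fun t => Gl q (i, t) * Gl q⁻¹ (i + 1, t))
/-- column operators -/
def colK' (q : ℂ) (n i : ℕ) : Module.End ℂ L :=
  oprod 1 n (fun t => Gl q⁻¹ (i, t) * Gl q (i + 1, t))

theorem row_QR {q : ℂ} (hq : q ≠ 0) (hq2 : q - q⁻¹ ≠ 0) (m : ℕ) :
    QR q (rowE q m) (rowF q m) (rowK q m) (rowK' q m) := by
  induction m with
  | zero =>
    convert QR.trivial (A := Module.End ℂ L) q using 1 <;> funext i <;>
      simp [rowE, rowF, rowK, rowK', oprod]
  | succ p ih =>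
    have hb := ((base hq hq2 (fun i => (p + 1, i)) (fun a b h => by simpa using h)).omega hq).twist
      hq
    let S : Set (ℕ × ℕ) := {s | s.1 ≤ p}
    let S' : Set (ℕ × ℕ) := {s | s.1 = p + 1}
    have hS : Disjoint S S' := Set.disjoint_left.2 fun s (h1 : s.1 ≤ p) (h2 : s.1 = p + 1) => by
      omega
    have m1 : ∀ t i, t ≤ p → ((t, i) : ℕ × ℕ) ∈ S := fun t i h => h
    have m2 : ∀ i, ((p + 1, i) : ℕ × ℕ) ∈ S' := fun i => rfl
    have hKK : ∀ i, rowK q p i ∈ Loc S := fun i => oprod_mem fun t _ ht =>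
      mul_mem (Loc_G _ (m1 _ _ ht)) (Loc_G _ (m1 _ _ ht))
    have hKK' : ∀ i, rowK' q p i ∈ Loc S := fun i => oprod_mem fun t _ ht =>
      mul_mem (Loc_G _ (m1 _ _ ht)) (Loc_G _ (m1 _ _ ht))
    have := QR.tensor hq ih hb (Loc S) (Loc S') (Loc_comm hS)
      (fun i => neg_mem <| sum_mem fun k hk => mul_mem (mul_mem (oprod_mem fun t _ ht =>
        mul_mem (Loc_G _ (m1 _ _ ht)) (Loc_G _ (m1 _ _ ht)))
          (Loc_X (m1 _ _ (Finset.mem_Icc.1 hk).2))) (Loc_D _ (m1 _ _ (Finset.mem_Icc.1 hk).2)))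
      (fun i => neg_mem <| sum_mem fun k hk => mul_mem (mul_mem
          (Loc_X (m1 _ _ (Finset.mem_Icc.1 hk).2)) (Loc_D _ (m1 _ _ (Finset.mem_Icc.1 hk).2)))
          (oprod_mem fun t _ ht =>
        mul_mem (Loc_G _ (m1 _ _ (ht.trans (Finset.mem_Icc.1 hk).2)))
          (Loc_G _ (m1 _ _ (ht.trans (Finset.mem_Icc.1 hk).2)))))
      hKK hKK'
      (fun i => neg_mem <| mul_mem (mul_mem (Loc_G _ (m2 _)) (Loc_G _ (m2 _)))
        (mul_mem (Loc_X (m2 _)) (Loc_D _ (m2 _))))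
      (fun i => neg_mem <| mul_mem (mul_mem (Loc_X (m2 _)) (Loc_D _ (m2 _)))
        (mul_mem (Loc_G _ (m2 _)) (Loc_G _ (m2 _))))
      (fun i => mul_mem (Loc_G _ (m2 _)) (Loc_G _ (m2 _)))
      (fun i => mul_mem (Loc_G _ (m2 _)) (Loc_G _ (m2 _)))
    convert this using 1
    · funext i
      rw [rowE, rowE, Finset.sum_Icc_succ_top (by omega), mul_neg, ← neg_add, Finset.mul_sum]
      congr 2
      · refine Finset.sum_congr rfl fun k hk => ?_
        have hk := Finset.mem_Icc.1 hk
        rw [oprod_succ (by omega)]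
        have : Commute (oprod k p fun t => Gl q (t, i) * Gl q⁻¹ (t, i + 1))
          (Gl q (p + 1, i) * Gl q⁻¹ (p + 1, i + 1)) := by
          simp only [GG' hq, oprod_W hq]; exact W_comm0 _ _
        rw [this.eq]
        simp only [mul_assoc]
      · rw [oprod_succ (by omega), oprod_empty (by omega), one_mul, mul_assoc]
    · funext i
      rw [rowF, rowF, Finset.sum_Icc_succ_top (by omega), mul_neg, ← neg_add]
      congr 2
      have : Commute (rowK q p i) (Xl (p + 1, i) * Dl q (p + 1, i + 1)) :=
        Loc_comm hS _ (hKK i) _ (mul_mem (Loc_X (m2 _)) (Loc_D _ (m2 _)))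
      rw [oprod_succ (by omega), ← mul_assoc, ← mul_assoc (rowK q p i), this.eq]; rfl
    · funext i
      rw [rowK, rowK, oprod_succ (by omega)]
    · funext i
      rw [rowK', rowK', oprod_succ (by omega)]

theorem col_QR {q : ℂ} (hq : q ≠ 0) (hq2 : q - q⁻¹ ≠ 0) (n : ℕ) :
    QR q (colE q n) (colF q n) (colK q n) (colK' q n) := by
  induction n with
  | zero =>
    convert QR.trivial (A := Module.End ℂ L) q using 1 <;> funext i <;>
      simp [colE, colF, colK, colK', oprod]
  | succ p ih =>
    have hb := (base hq hq2 (fun i => (i, p + 1)) (fun a b h => by simpa using h)).swap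
    let S : Set (ℕ × ℕ) := {s | s.2 ≤ p}
    let S' : Set (ℕ × ℕ) := {s | s.2 = p + 1}
    have hS : Disjoint S' S := Set.disjoint_left.2 fun s (h2 : s.2 = p + 1) (h1 : s.2 ≤ p) => by
      omega
    have m1 : ∀ t i, t ≤ p → ((i, t) : ℕ × ℕ) ∈ S := fun t i h => h
    have m2 : ∀ i, ((i, p + 1) : ℕ × ℕ) ∈ S' := fun i => rfl
    have hKK : ∀ i, colK q p i ∈ Loc S := fun i => oprod_mem fun t _ ht =>
      mul_mem (Loc_G _ (m1 _ _ ht)) (Loc_G _ (m1 _ _ ht))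
    have hKK' : ∀ i, colK' q p i ∈ Loc S := fun i => oprod_mem fun t _ ht =>
      mul_mem (Loc_G _ (m1 _ _ ht)) (Loc_G _ (m1 _ _ ht))
    have hE : ∀ i, colE q p i ∈ Loc S := fun i => sum_mem fun k hk => mul_mem (mul_mem
          (Loc_X (m1 _ _ (Finset.mem_Icc.1 hk).2)) (Loc_D _ (m1 _ _ (Finset.mem_Icc.1 hk).2)))
          (oprod_mem fun t _ ht =>
        mul_mem (Loc_G _ (m1 _ _ ht)) (Loc_G _ (m1 _ _ ht)))
    have hg : ∀ i, Gl q (i, p + 1) * Gl q⁻¹ (i + 1, p + 1) ∈ Loc S' := fun i =>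
      mul_mem (Loc_G _ (m2 _)) (Loc_G _ (m2 _))
    have hg' : ∀ i, Gl q⁻¹ (i, p + 1) * Gl q (i + 1, p + 1) ∈ Loc S' := fun i =>
      mul_mem (Loc_G _ (m2 _)) (Loc_G _ (m2 _))
    have := (QR.tensor (inv_ne_zero hq) hb ih.swap (Loc S') (Loc S) (Loc_comm hS)
      (fun i => mul_mem (Loc_X (m2 _)) (Loc_D _ (m2 _)))
      (fun i => mul_mem (Loc_X (m2 _)) (Loc_D _ (m2 _)))
      hg hg'
      (fun i => sum_mem fun k hk => mul_mem (mul_mem (oprod_mem fun t _ ht => by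
        have hk := Finset.mem_Icc.1 hk
        exact mul_mem (Loc_G _ (m1 _ _ (by omega))) (Loc_G _ (m1 _ _ (by omega))))
          (Loc_X (m1 _ _ (Finset.mem_Icc.1 hk).2))) (Loc_D _ (m1 _ _ (Finset.mem_Icc.1 hk).2)))
      hE hKK hKK').swap
    rw [inv_inv] at this
    convert this using 1
    · funext i
      rw [colE, Finset.sum_Icc_succ_top (by omega), oprod_empty (by omega), mul_one, add_comm]
      congr 1
      rw [(Loc_comm hS _ (hg i) _ (hE i)).eq, colE, Finset.sum_mul]
      refine Finset.sum_congr rfl fun k hk => ?_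
      have hk := Finset.mem_Icc.1 hk
      rw [oprod_succ (by omega)]
      simp only [mul_assoc]
    · funext i
      rw [colF, Finset.sum_Icc_succ_top (by omega), add_comm, Nat.add_sub_cancel, mul_assoc]
      rfl
    · funext i
      rw [(Loc_comm hS _ (hg i) _ (hKK i)).eq, colK, colK, oprod_succ (by omega)]
    · funext i
      rw [(Loc_comm hS _ (hg' i) _ (hKK' i)).eq, colK', colK', oprod_succ (by omega)]

end St17
namespace St17

/-- vertical exponent sum -/
def sgR (a b c : ℕ) : V →+ ℤ where
  toFun r := ∑ t ∈ Finset.Icc a b, (r (t, c) - r (t, c + 1))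
  map_zero' := by simp
  map_add' r r' := by
    rw [← Finset.sum_add_distrib]
    refine Finset.sum_congr rfl fun t _ => ?_
    simp only [Pi.add_apply]; ring

/-- horizontal exponent sum -/
def sgC (a b c : ℕ) : V →+ ℤ where
  toFun r := ∑ t ∈ Finset.Icc a b, (r (c, t) - r (c + 1, t))
  map_zero' := by simp
  map_add' r r' := by
    rw [← Finset.sum_add_distrib]
    refine Finset.sum_congr rfl fun t _ => ?_
    simp only [Pi.add_apply]; ring

theorem sgR_apply (a b c : ℕ) (r : V) :
    sgR a b c r = ∑ t ∈ Finset.Icc a b, (r (t, c) - r (t, c + 1)) := rfl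
theorem sgC_apply (a b c : ℕ) (r : V) :
    sgC a b c r = ∑ t ∈ Finset.Icc a b, (r (c, t) - r (c + 1, t)) := rfl

theorem sgR_single (a b c x y : ℕ) : sgR a b c (Pi.single (x, y) 1) =
    if a ≤ x ∧ x ≤ b then (if y = c then 1 else if y = c + 1 then -1 else 0) else 0 := by
  rw [sgR_apply]
  by_cases h : a ≤ x ∧ x ≤ b
  · rw [if_pos h, Finset.sum_eq_single x]
    · simp only [Pi.single_apply, Prod.mk.injEq, true_and]
      split_ifs <;> omega
    · intro t _ ht; simp [ht]
    · intro hx; exact absurd (Finset.mem_Icc.2 h) hx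
  · rw [if_neg h]
    refine Finset.sum_eq_zero fun t ht => ?_
    have : t ≠ x := by rintro rfl; exact h (Finset.mem_Icc.1 ht)
    simp [this]

theorem sgC_single (a b c x y : ℕ) : sgC a b c (Pi.single (x, y) 1) =
    if a ≤ y ∧ y ≤ b then (if x = c then 1 else if x = c + 1 then -1 else 0) else 0 := by
  rw [sgC_apply]
  by_cases h : a ≤ y ∧ y ≤ b
  · rw [if_pos h, Finset.sum_eq_single y]
    · simp only [Pi.single_apply, Prod.mk.injEq, and_true]
      split_ifs <;> omega
    · intro t _ ht; simp [ht]
    · intro hx; exact absurd (Finset.mem_Icc.2 h) hx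
  · rw [if_neg h]
    refine Finset.sum_eq_zero fun t ht => ?_
    have : t ≠ y := by rintro rfl; exact h (Finset.mem_Icc.1 ht)
    simp [this]

theorem sgR_bot {a b : ℕ} (c : ℕ) (h : a ≤ b) (r : V) :
    sgR a b c r = (r (a, c) - r (a, c + 1)) + sgR (a + 1) b c r := by
  rw [sgR_apply, sgR_apply, ← Finset.insert_Icc_add_one_left_eq_Icc h,
    Finset.sum_insert (by simp)]
theorem sgC_bot {a b : ℕ} (c : ℕ) (h : a ≤ b) (r : V) :
    sgC a b c r = (r (c, a) - r (c + 1, a)) + sgC (a + 1) b c r := by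
  rw [sgC_apply, sgC_apply, ← Finset.insert_Icc_add_one_left_eq_Icc h,
    Finset.sum_insert (by simp)]
theorem sgR_top {a b : ℕ} (c : ℕ) (h : a ≤ b + 1) (r : V) :
    sgR a (b + 1) c r = sgR a b c r + (r (b + 1, c) - r (b + 1, c + 1)) := by
  rw [sgR_apply, sgR_apply, Finset.sum_Icc_succ_top h]
theorem sgC_top {a b : ℕ} (c : ℕ) (h : a ≤ b + 1) (r : V) :
    sgC a (b + 1) c r = sgC a b c r + (r (c, b + 1) - r (c + 1, b + 1)) := by
  rw [sgC_apply, sgC_apply, Finset.sum_Icc_succ_top h]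

/-- a general term -/
def T (q : ℂ) (p : V →+ ℤ) (z : ℤ) (s s' : ℕ × ℕ) : Module.End ℂ L :=
  W (fun r => q ^ (p r + z) * qz q (r s)) (Pi.single s' 1 - Pi.single s 1)

theorem T_comm {q : ℂ} (hq : q ≠ 0) {p p' : V →+ ℤ} {z z' : ℤ} {s t s' t' : ℕ × ℕ}
    (h : p (Pi.single t' 1 - Pi.single s' 1) = p' (Pi.single t 1 - Pi.single s 1))
    (h1 : (Pi.single t' 1 - Pi.single s' 1 : V) s = 0)
    (h2 : (Pi.single t 1 - Pi.single s 1 : V) s' = 0) :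
    Commute (T q p z s t) (T q p' z' s' t') := by
  refine W_comm fun r => ?_
  rw [map_add, map_add, Pi.add_apply, Pi.add_apply, h1, h2, h, add_zero, add_zero]
  simp only [zpow_add₀ hq]
  ring

theorem T_cross {q : ℂ} {p₁ p₁' p₂ p₂' : V →+ ℤ} {z₁ z₁' z₂ z₂' : ℤ}
    {s₁ t₁ s₁' t₁' s₂ t₂ s₂' t₂' : ℕ × ℕ}
    (hd : (Pi.single t₁ 1 - Pi.single s₁ 1 : V) + (Pi.single t₁' 1 - Pi.single s₁' 1) =
      (Pi.single t₂ 1 - Pi.single s₂ 1) + (Pi.single t₂' 1 - Pi.single s₂' 1))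
    (h : ∀ r : V,
      q ^ (p₁ r + p₁ (Pi.single t₁' 1 - Pi.single s₁' 1) + z₁) *
        qz q (r s₁ + (Pi.single t₁' 1 - Pi.single s₁' 1 : V) s₁) *
        (q ^ (p₁' r + z₁') * qz q (r s₁')) -
      q ^ (p₁' r + p₁' (Pi.single t₁ 1 - Pi.single s₁ 1) + z₁') *
        qz q (r s₁' + (Pi.single t₁ 1 - Pi.single s₁ 1 : V) s₁') *
        (q ^ (p₁ r + z₁) * qz q (r s₁)) +
      (q ^ (p₂ r + p₂ (Pi.single t₂' 1 - Pi.single s₂' 1) + z₂) *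
        qz q (r s₂ + (Pi.single t₂' 1 - Pi.single s₂' 1 : V) s₂) *
        (q ^ (p₂' r + z₂') * qz q (r s₂')) -
      q ^ (p₂' r + p₂' (Pi.single t₂ 1 - Pi.single s₂ 1) + z₂') *
        qz q (r s₂' + (Pi.single t₂ 1 - Pi.single s₂ 1 : V) s₂') *
        (q ^ (p₂ r + z₂) * qz q (r s₂))) = 0) :
    T q p₁ z₁ s₁ t₁ * T q p₁' z₁' s₁' t₁' - T q p₁' z₁' s₁' t₁' * T q p₁ z₁ s₁ t₁ +
    (T q p₂ z₂ s₂ t₂ * T q p₂' z₂' s₂' t₂' - T q p₂' z₂' s₂' t₂' * T q p₂ z₂ s₂ t₂) = 0 := by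
  unfold T
  simp only [W_mul]
  rw [add_comm (Pi.single t₁' 1 - Pi.single s₁' 1 : V), add_comm (Pi.single t₂' 1 - Pi.single s₂' 1 : V),
    hd, W_sub, W_sub, W_add, ← W_zero]
  refine W_congr rfl fun r => ?_
  simp only [map_add, Pi.add_apply]
  exact h r

theorem comm_sum {A : Type*} [Ring A] {m n i j : ℕ} (hi : 1 ≤ i) (hi' : i + 1 ≤ n)
    (hj : 1 ≤ j) (hj' : j + 1 ≤ m) (a b : ℕ → A)
    (h : ∀ k l, 1 ≤ k → k ≤ m → 1 ≤ l → l ≤ n → ¬ ((k = j ∨ k = j + 1) ∧ (l = i ∨ l = i + 1)) →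
      Commute (a k) (b l))
    (h' : Commute (a j + a (j + 1)) (b i + b (i + 1))) :
    Commute (∑ k ∈ Finset.Icc 1 m, a k) (∑ l ∈ Finset.Icc 1 n, b l) := by
  have split : ∀ (f : ℕ → A) (N j : ℕ), 1 ≤ j → j + 1 ≤ N → ∑ k ∈ Finset.Icc 1 N, f k =
      (f j + f (j + 1)) + ∑ k ∈ Finset.Icc 1 N \ {j, j + 1}, f k := by
    intro f N j h1 h2
    rw [add_comm, ← Finset.sum_pair (f := f) (a := j) (b := j + 1) (by omega)]
    refine (Finset.sum_sdiff ?_).symm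
    intro x hx
    simp only [Finset.mem_insert, Finset.mem_singleton] at hx
    rw [Finset.mem_Icc]; omega
  rw [split a m j hj hj', split b n i hi hi']
  refine Commute.add_left (Commute.add_right h' ?_) ?_
  · refine Commute.sum_right _ _ _ fun l hl => ?_
    simp only [Finset.mem_sdiff, Finset.mem_Icc, Finset.mem_insert, Finset.mem_singleton] at hl
    exact (h _ _ hj (by omega) hl.1.1 hl.1.2 (fun hh => hl.2 hh.2)).add_left
      (h _ _ (by omega) (by omega) hl.1.1 hl.1.2 (fun hh => hl.2 hh.2))
  · refine Commute.sum_left _ _ _ fun k hk => ?_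
    simp only [Finset.mem_sdiff, Finset.mem_Icc, Finset.mem_insert, Finset.mem_singleton] at hk
    refine Commute.add_right ((h _ _ hk.1.1 hk.1.2 (by omega) (by omega) (fun hh => hk.2 hh.1)).add_right
      (h _ _ hk.1.1 hk.1.2 (by omega) (by omega) (fun hh => hk.2 hh.1))) ?_
    refine Commute.sum_right _ _ _ fun l hl => ?_
    simp only [Finset.mem_sdiff, Finset.mem_Icc, Finset.mem_insert, Finset.mem_singleton] at hl
    exact h _ _ hk.1.1 hk.1.2 hl.1.1 hl.1.2 (fun hh => hk.2 hh.1)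

theorem comm_two {A : Type*} [Ring A] {a₁ a₂ b₁ b₂ : A} (h12 : Commute a₁ b₂) (h21 : Commute a₂ b₁)
    (h : a₁ * b₁ - b₁ * a₁ + (a₂ * b₂ - b₂ * a₂) = 0) : Commute (a₁ + a₂) (b₁ + b₂) := by
  unfold Commute SemiconjBy at *
  rw [← sub_eq_zero]
  simp only [add_mul, mul_add, h12, h21]
  rw [← h]; abel

/-! term forms -/
theorem rowE_T {q : ℂ} (hq : q ≠ 0) (m i : ℕ) : rowE q m i =
    -(∑ k ∈ Finset.Icc 1 m, T q (sgR k m i) (-2) (k, i) (k, i + 1)) := by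
  rw [rowE, neg_inj]
  refine Finset.sum_congr rfl fun k hk => ?_
  have hk := Finset.mem_Icc.1 hk
  simp only [GG' hq, oprod_W hq, mul_assoc, XD]
  rw [W_mul]
  refine W_congr (zero_add _) fun r => ?_
  congr 2
  rw [← sgR_apply, map_add, map_sub, sgR_single, sgR_single]
  simp [hk]

theorem rowF_T {q : ℂ} (hq : q ≠ 0) (m i : ℕ) : rowF q m i =
    -(∑ k ∈ Finset.Icc 1 m, T q (-sgR 1 k i) 0 (k, i + 1) (k, i)) := by
  rw [rowF, neg_inj]
  refine Finset.sum_congr rfl fun k hk => ?_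
  have hk := Finset.mem_Icc.1 hk
  simp only [G'G hq, oprod_W hq, XD]
  rw [W_mul]
  refine W_congr (add_zero _) fun r => ?_
  rw [mul_comm, add_zero]
  congr 2
  rw [AddMonoidHom.neg_apply, sgR_apply, ← Finset.sum_neg_distrib, add_zero]
  simp

theorem colE_T {q : ℂ} (hq : q ≠ 0) (n j : ℕ) : colE q n j =
    ∑ l ∈ Finset.Icc 1 n, T q (sgC (l + 1) n j) 0 (j + 1, l) (j, l) := by
  unfold colE
  refine Finset.sum_congr rfl fun k hk => ?_
  have hk := Finset.mem_Icc.1 hk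
  simp only [GG' hq, oprod_W hq, XD]
  rw [W_mul]
  refine W_congr (add_zero _) fun r => ?_
  rw [mul_comm, add_zero]
  congr 2
  rw [sgC_apply, add_zero]

theorem colF_T {q : ℂ} (hq : q ≠ 0) (n j : ℕ) : colF q n j =
    ∑ l ∈ Finset.Icc 1 n, T q (-sgC 1 (l - 1) j) 0 (j, l) (j + 1, l) := by
  unfold colF
  refine Finset.sum_congr rfl fun k hk => ?_
  have hk := Finset.mem_Icc.1 hk
  simp only [G'G hq, oprod_W hq, mul_assoc, XD]
  rw [W_mul]
  refine W_congr (zero_add _) fun r => ?_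
  congr 2
  rw [add_zero, AddMonoidHom.neg_apply, ← neg_eq_iff_eq_neg, ← Finset.sum_neg_distrib]
  simp only [neg_sub]
  rw [← sgC_apply, map_add, map_sub, sgC_single, sgC_single, if_neg (by omega), if_neg (by omega)]
  simp

end St17
namespace St17

theorem T_comm' {q : ℂ} (hq : q ≠ 0) {p p' : V →+ ℤ} {z z' : ℤ} {s t t' : ℕ × ℕ}
    (h : p (Pi.single t' 1 - Pi.single s 1) = p' (Pi.single t 1 - Pi.single s 1))
    (h1 : (Pi.single t' 1 - Pi.single s 1 : V) s = (Pi.single t 1 - Pi.single s 1 : V) s) :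
    Commute (T q p z s t) (T q p' z' s t') := by
  refine W_comm fun r => ?_
  rw [map_add, map_add, Pi.add_apply, Pi.add_apply, h1, h]
  simp only [zpow_add₀ hq]
  ring

theorem rEcE {q : ℂ} (hq : q ≠ 0) (hq2 : q - q⁻¹ ≠ 0) {m n i j : ℕ} (hi : 1 ≤ i) (hi' : i + 1 ≤ n)
    (hj : 1 ≤ j) (hj' : j + 1 ≤ m) : Commute (rowE q m i) (colE q n j) := by
  have hq3 : q ^ 2 - 1 ≠ 0 := by
    intro h; apply hq2; field_simp; rw [h, mul_zero]
  rw [rowE_T hq, colE_T hq]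
  refine Commute.neg_left (comm_sum hi hi' hj hj' _ _ ?_ ?_)
  · intro k l h1 h2 h3 h4 h5
    refine T_comm hq ?_ ?_ ?_
    · simp only [map_sub, AddMonoidHom.neg_apply, sgR_single, sgC_single]
      grind
    · simp only [Pi.sub_apply, Pi.single_apply, Prod.mk.injEq]
      grind
    · simp only [Pi.sub_apply, Pi.single_apply, Prod.mk.injEq]
      grind
  · refine comm_two (T_comm hq ?_ ?_ ?_) (T_comm' hq ?_ ?_) (T_cross (by abel) fun r => ?_)
    · simp only [map_sub, AddMonoidHom.neg_apply, sgR_single, sgC_single]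
      grind
    · simp only [Pi.sub_apply, Pi.single_apply, Prod.mk.injEq]
      grind
    · simp only [Pi.sub_apply, Pi.single_apply, Prod.mk.injEq]
      grind
    · simp only [map_sub, AddMonoidHom.neg_apply, sgR_single, sgC_single]
      grind
    · simp only [Pi.sub_apply, Pi.single_apply, Prod.mk.injEq]
      grind
    rw [sgR_bot i (show j ≤ m by omega)]
    rw [sgC_bot j (show i + 1 ≤ n by omega)]
    simp only [map_sub, AddMonoidHom.neg_apply, sgR_single, sgC_single, Pi.sub_apply,
      Pi.single_apply, Prod.mk.injEq]
    simp [hi, hj, hi', hj', show j ≤ m by omega, show i ≤ n by omega]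
    simp only [qz, zpow_add₀ hq, zpow_sub₀ hq, neg_add, neg_sub, zpow_neg, zpow_one, inv_inv]
    have h1 : q ^ r (j, i) ≠ 0 := zpow_ne_zero _ hq
    have h2 : q ^ r (j, i + 1) ≠ 0 := zpow_ne_zero _ hq
    have h3 : q ^ r (j + 1, i) ≠ 0 := zpow_ne_zero _ hq
    have h4 : q ^ r (j + 1, i + 1) ≠ 0 := zpow_ne_zero _ hq
    have h5 : q ^ sgR (j + 1) m i r ≠ 0 := zpow_ne_zero _ hq
    have h6 : q ^ sgC (i + 1 + 1) n j r ≠ 0 := zpow_ne_zero _ hq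
    generalize q ^ r (j, i) = u1 at *
    generalize q ^ r (j, i + 1) = u2 at *
    generalize q ^ r (j + 1, i) = u3 at *
    generalize q ^ r (j + 1, i + 1) = u4 at *
    generalize q ^ sgR (j + 1) m i r = u5 at *
    generalize q ^ sgC (i + 1 + 1) n j r = u6 at *
    field_simp
    ring

theorem rEcF {q : ℂ} (hq : q ≠ 0) (hq2 : q - q⁻¹ ≠ 0) {m n i j : ℕ} (hi : 1 ≤ i) (hi' : i + 1 ≤ n)
    (hj : 1 ≤ j) (hj' : j + 1 ≤ m) : Commute (rowE q m i) (colF q n j) := by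
  have hq3 : q ^ 2 - 1 ≠ 0 := by
    intro h; apply hq2; field_simp; rw [h, mul_zero]
  rw [rowE_T hq, colF_T hq]
  refine Commute.neg_left (comm_sum hi hi' hj hj' _ _ ?_ ?_)
  · intro k l h1 h2 h3 h4 h5
    refine T_comm hq ?_ ?_ ?_
    · simp only [map_sub, AddMonoidHom.neg_apply, sgR_single, sgC_single]
      grind
    · simp only [Pi.sub_apply, Pi.single_apply, Prod.mk.injEq]
      grind
    · simp only [Pi.sub_apply, Pi.single_apply, Prod.mk.injEq]
      grind
  · rw [add_comm (T q _ _ (j, _) _)]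
    refine comm_two (T_comm hq ?_ ?_ ?_) (T_comm' hq ?_ ?_) (T_cross (by abel) fun r => ?_)
    · simp only [map_sub, AddMonoidHom.neg_apply, sgR_single, sgC_single]
      grind
    · simp only [Pi.sub_apply, Pi.single_apply, Prod.mk.injEq]
      grind
    · simp only [Pi.sub_apply, Pi.single_apply, Prod.mk.injEq]
      grind
    · simp only [map_sub, AddMonoidHom.neg_apply, sgR_single, sgC_single]
      grind
    · simp only [Pi.sub_apply, Pi.single_apply, Prod.mk.injEq]
      grind
    rw [sgR_bot i (show j ≤ m by omega)]
    obtain ⟨i, rfl⟩ : ∃ i', i = i' + 1 := ⟨i - 1, by omega⟩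
    simp only [Nat.add_sub_cancel]
    rw [AddMonoidHom.neg_apply (sgC 1 (i + 1) j), sgC_top j (show 1 ≤ i + 1 by omega)]
    simp only [map_sub, AddMonoidHom.neg_apply, sgR_single, sgC_single, Pi.sub_apply,
      Pi.single_apply, Prod.mk.injEq]
    simp [hi, hj, hi', hj', show j ≤ m by omega, show i ≤ n by omega]
    simp only [qz, zpow_add₀ hq, zpow_sub₀ hq, neg_add, neg_sub, zpow_neg, zpow_one, inv_inv]
    have h1 : q ^ r (j, i) ≠ 0 := zpow_ne_zero _ hq
    have h2 : q ^ r (j, i + 1) ≠ 0 := zpow_ne_zero _ hq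
    have h3 : q ^ r (j + 1, i) ≠ 0 := zpow_ne_zero _ hq
    have h4 : q ^ r (j + 1, i + 1) ≠ 0 := zpow_ne_zero _ hq
    have h5 : q ^ sgR (j + 1) m i r ≠ 0 := zpow_ne_zero _ hq
    have h6 : q ^ sgC 1 (i - 1) j r ≠ 0 := zpow_ne_zero _ hq
    generalize q ^ r (j, i) = u1 at *
    generalize q ^ r (j, i + 1) = u2 at *
    generalize q ^ r (j + 1, i) = u3 at *
    generalize q ^ r (j + 1, i + 1) = u4 at *
    generalize q ^ sgR (j + 1) m i r = u5 at *
    generalize q ^ sgC 1 (i - 1) j r = u6 at *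
    field_simp
    ring

theorem rFcE {q : ℂ} (hq : q ≠ 0) (hq2 : q - q⁻¹ ≠ 0) {m n i j : ℕ} (hi : 1 ≤ i) (hi' : i + 1 ≤ n)
    (hj : 1 ≤ j) (hj' : j + 1 ≤ m) : Commute (rowF q m i) (colE q n j) := by
  have hq3 : q ^ 2 - 1 ≠ 0 := by
    intro h; apply hq2; field_simp; rw [h, mul_zero]
  rw [rowF_T hq, colE_T hq]
  refine Commute.neg_left (comm_sum hi hi' hj hj' _ _ ?_ ?_)
  · intro k l h1 h2 h3 h4 h5
    refine T_comm hq ?_ ?_ ?_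
    · simp only [map_sub, AddMonoidHom.neg_apply, sgR_single, sgC_single]
      grind
    · simp only [Pi.sub_apply, Pi.single_apply, Prod.mk.injEq]
      grind
    · simp only [Pi.sub_apply, Pi.single_apply, Prod.mk.injEq]
      grind
  · rw [add_comm (T q _ _ (j, _) _)]
    refine comm_two (T_comm' hq ?_ ?_) (T_comm hq ?_ ?_ ?_) (T_cross (by abel) fun r => ?_)
    · simp only [map_sub, AddMonoidHom.neg_apply, sgR_single, sgC_single]
      grind
    · simp only [Pi.sub_apply, Pi.single_apply, Prod.mk.injEq]
      grind
    · simp only [map_sub, AddMonoidHom.neg_apply, sgR_single, sgC_single]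
      grind
    · simp only [Pi.sub_apply, Pi.single_apply, Prod.mk.injEq]
      grind
    · simp only [Pi.sub_apply, Pi.single_apply, Prod.mk.injEq]
      grind
    rw [AddMonoidHom.neg_apply (sgR 1 (j + 1) i), sgR_top i (show 1 ≤ j + 1 by omega)]
    rw [sgC_bot j (show i + 1 ≤ n by omega)]
    simp only [map_sub, AddMonoidHom.neg_apply, sgR_single, sgC_single, Pi.sub_apply,
      Pi.single_apply, Prod.mk.injEq]
    simp [hi, hj, hi', hj', show j ≤ m by omega, show i ≤ n by omega]
    simp only [qz, zpow_add₀ hq, zpow_sub₀ hq, neg_add, neg_sub, zpow_neg, zpow_one, inv_inv]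
    have h1 : q ^ r (j, i) ≠ 0 := zpow_ne_zero _ hq
    have h2 : q ^ r (j, i + 1) ≠ 0 := zpow_ne_zero _ hq
    have h3 : q ^ r (j + 1, i) ≠ 0 := zpow_ne_zero _ hq
    have h4 : q ^ r (j + 1, i + 1) ≠ 0 := zpow_ne_zero _ hq
    have h5 : q ^ sgR 1 j i r ≠ 0 := zpow_ne_zero _ hq
    have h6 : q ^ sgC (i + 1 + 1) n j r ≠ 0 := zpow_ne_zero _ hq
    generalize q ^ r (j, i) = u1 at *
    generalize q ^ r (j, i + 1) = u2 at *
    generalize q ^ r (j + 1, i) = u3 at *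
    generalize q ^ r (j + 1, i + 1) = u4 at *
    generalize q ^ sgR 1 j i r = u5 at *
    generalize q ^ sgC (i + 1 + 1) n j r = u6 at *
    field_simp
    ring

theorem rFcF {q : ℂ} (hq : q ≠ 0) (hq2 : q - q⁻¹ ≠ 0) {m n i j : ℕ} (hi : 1 ≤ i) (hi' : i + 1 ≤ n)
    (hj : 1 ≤ j) (hj' : j + 1 ≤ m) : Commute (rowF q m i) (colF q n j) := by
  have hq3 : q ^ 2 - 1 ≠ 0 := by
    intro h; apply hq2; field_simp; rw [h, mul_zero]
  rw [rowF_T hq, colF_T hq]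
  refine Commute.neg_left (comm_sum hi hi' hj hj' _ _ ?_ ?_)
  · intro k l h1 h2 h3 h4 h5
    refine T_comm hq ?_ ?_ ?_
    · simp only [map_sub, AddMonoidHom.neg_apply, sgR_single, sgC_single]
      grind
    · simp only [Pi.sub_apply, Pi.single_apply, Prod.mk.injEq]
      grind
    · simp only [Pi.sub_apply, Pi.single_apply, Prod.mk.injEq]
      grind
  · refine comm_two (T_comm' hq ?_ ?_) (T_comm hq ?_ ?_ ?_) (T_cross (by abel) fun r => ?_)
    · simp only [map_sub, AddMonoidHom.neg_apply, sgR_single, sgC_single]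
      grind
    · simp only [Pi.sub_apply, Pi.single_apply, Prod.mk.injEq]
      grind
    · simp only [map_sub, AddMonoidHom.neg_apply, sgR_single, sgC_single]
      grind
    · simp only [Pi.sub_apply, Pi.single_apply, Prod.mk.injEq]
      grind
    · simp only [Pi.sub_apply, Pi.single_apply, Prod.mk.injEq]
      grind
    rw [AddMonoidHom.neg_apply (sgR 1 (j + 1) i), sgR_top i (show 1 ≤ j + 1 by omega)]
    obtain ⟨i, rfl⟩ : ∃ i', i = i' + 1 := ⟨i - 1, by omega⟩
    simp only [Nat.add_sub_cancel]
    rw [AddMonoidHom.neg_apply (sgC 1 (i + 1) j), sgC_top j (show 1 ≤ i + 1 by omega)]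
    simp only [map_sub, AddMonoidHom.neg_apply, sgR_single, sgC_single, Pi.sub_apply,
      Pi.single_apply, Prod.mk.injEq]
    simp [hi, hj, hi', hj', show j ≤ m by omega, show i ≤ n by omega]
    simp only [qz, zpow_add₀ hq, zpow_sub₀ hq, neg_add, neg_sub, zpow_neg, zpow_one, inv_inv]
    have h1 : q ^ r (j, i) ≠ 0 := zpow_ne_zero _ hq
    have h2 : q ^ r (j, i + 1) ≠ 0 := zpow_ne_zero _ hq
    have h3 : q ^ r (j + 1, i) ≠ 0 := zpow_ne_zero _ hq
    have h4 : q ^ r (j + 1, i + 1) ≠ 0 := zpow_ne_zero _ hq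
    have h5 : q ^ sgR 1 j i r ≠ 0 := zpow_ne_zero _ hq
    have h6 : q ^ sgC 1 (i - 1) j r ≠ 0 := zpow_ne_zero _ hq
    generalize q ^ r (j, i) = u1 at *
    generalize q ^ r (j, i + 1) = u2 at *
    generalize q ^ r (j + 1, i) = u3 at *
    generalize q ^ r (j + 1, i + 1) = u4 at *
    generalize q ^ sgR 1 j i r = u5 at *
    generalize q ^ sgC 1 (i - 1) j r = u6 at *
    field_simp
    ring

end St17
namespace St17

/-- diagonal operator -/
def Kd (q : ℂ) (p : V →+ ℤ) : Module.End ℂ L := W (fun r => q ^ (p r)) 0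

theorem Kd_comm (q : ℂ) (p p' : V →+ ℤ) : Commute (Kd q p) (Kd q p') := W_comm0 _ _

theorem Kd_inv {q : ℂ} (hq : q ≠ 0) (p p' : V →+ ℤ) (h : p + p' = 0) : Kd q p * Kd q p' = 1 := by
  rw [Kd, Kd, W_mul, ← W_one]
  refine W_congr (add_zero _) fun r => ?_
  rw [add_zero, ← zpow_add₀ hq, ← AddMonoidHom.add_apply, h]
  simp

theorem Kd_T {q : ℂ} (hq : q ≠ 0) (p p' : V →+ ℤ) (z : ℤ) (s t : ℕ × ℕ) (c : ℤ)
    (h : p (Pi.single t 1 - Pi.single s 1) = c) :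
    Kd q p * T q p' z s t = (q ^ c) • (T q p' z s t * Kd q p) := by
  rw [Kd, T, W_mul, W_mul, W_smul]
  refine W_congr (add_comm _ _) fun r => ?_
  rw [map_add, h, add_zero, zpow_add₀ hq]
  ring

theorem Kd_sum {q : ℂ} (hq : q ≠ 0) (p : V →+ ℤ) (N : ℕ) (p' : ℕ → V →+ ℤ) (z : ℤ)
    (s t : ℕ → ℕ × ℕ) (c : ℤ)
    (h : ∀ k, 1 ≤ k → k ≤ N → p (Pi.single (t k) 1 - Pi.single (s k) 1) = c) :
    Kd q p * (∑ k ∈ Finset.Icc 1 N, T q (p' k) z (s k) (t k)) =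
      (q ^ c) • ((∑ k ∈ Finset.Icc 1 N, T q (p' k) z (s k) (t k)) * Kd q p) := by
  rw [Finset.mul_sum, Finset.sum_mul, Finset.smul_sum]
  refine Finset.sum_congr rfl fun k hk => ?_
  have hk := Finset.mem_Icc.1 hk
  exact Kd_T hq _ _ _ _ _ _ (h k hk.1 hk.2)

theorem Kd_sum_neg {q : ℂ} (hq : q ≠ 0) (p : V →+ ℤ) (N : ℕ) (p' : ℕ → V →+ ℤ) (z : ℤ)
    (s t : ℕ → ℕ × ℕ) (c : ℤ)
    (h : ∀ k, 1 ≤ k → k ≤ N → p (Pi.single (t k) 1 - Pi.single (s k) 1) = c) :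
    Kd q p * -(∑ k ∈ Finset.Icc 1 N, T q (p' k) z (s k) (t k)) =
      (q ^ c) • (-(∑ k ∈ Finset.Icc 1 N, T q (p' k) z (s k) (t k)) * Kd q p) := by
  rw [mul_neg, Kd_sum hq p N p' z s t c h, neg_mul, smul_neg]

/-- exponent functional of `k_n` -/
def phi (m n : ℕ) : V →+ ℤ where
  toFun r := ∑ t ∈ Finset.Icc 1 n, r (1, t) + ∑ s ∈ Finset.Icc 1 m, r (s, n)
  map_zero' := by simp
  map_add' r r' := by
    simp only [Pi.add_apply, Finset.sum_add_distrib]; ring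

theorem phi_single (m n x y : ℕ) : phi m n (Pi.single (x, y) 1) =
    (if x = 1 ∧ 1 ≤ y ∧ y ≤ n then 1 else 0) + (if y = n ∧ 1 ≤ x ∧ x ≤ m then 1 else 0) := by
  change ∑ t ∈ Finset.Icc 1 n, (Pi.single (x, y) 1 : V) (1, t) +
    ∑ s ∈ Finset.Icc 1 m, (Pi.single (x, y) 1 : V) (s, n) = _
  congr 1
  · by_cases h : x = 1 ∧ 1 ≤ y ∧ y ≤ n
    · rw [if_pos h, Finset.sum_eq_single y]
      · simp [h.1]
      · intro t _ ht; simp [ht]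
      · intro hx; exact absurd (Finset.mem_Icc.2 h.2) hx
    · rw [if_neg h]
      refine Finset.sum_eq_zero fun t ht => ?_
      rw [Pi.single_apply, if_neg]
      intro h'
      rw [Prod.mk.injEq] at h'
      rw [Finset.mem_Icc] at ht
      omega
  · by_cases h : y = n ∧ 1 ≤ x ∧ x ≤ m
    · rw [if_pos h, Finset.sum_eq_single x]
      · simp [h.1]
      · intro t _ ht; simp [ht]
      · intro hx; exact absurd (Finset.mem_Icc.2 h.2) hx
    · rw [if_neg h]
      refine Finset.sum_eq_zero fun t ht => ?_
      rw [Pi.single_apply, if_neg]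
      intro h'
      rw [Prod.mk.injEq] at h'
      rw [Finset.mem_Icc] at ht
      omega

/-- `k_n` -/
def Kn (q : ℂ) (m n : ℕ) : Module.End ℂ L :=
  oprod 1 n (fun t => Gl q⁻¹ (1, t)) * oprod 1 m (fun s => Gl q⁻¹ (s, n))
/-- `k_n` inverse -/
def Kn' (q : ℂ) (m n : ℕ) : Module.End ℂ L :=
  oprod 1 n (fun t => Gl q (1, t)) * oprod 1 m (fun s => Gl q (s, n))

theorem Gl_inv (q : ℂ) (s : ℕ × ℕ) : Gl q⁻¹ s = W (fun r => q ^ (-(r s))) 0 := by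
  rw [Gl]; exact W_congr rfl fun r => inv_zpow' _ _

theorem Kn_eq {q : ℂ} (hq : q ≠ 0) (m n : ℕ) : Kn q m n = Kd q (-phi m n) := by
  simp only [Kn, Gl_inv, oprod_W hq]
  rw [W_mul]
  refine W_congr (add_zero _) fun r => ?_
  rw [add_zero, ← zpow_add₀ hq, Finset.sum_neg_distrib, Finset.sum_neg_distrib, ← neg_add]
  rfl

theorem Kn'_eq {q : ℂ} (hq : q ≠ 0) (m n : ℕ) : Kn' q m n = Kd q (phi m n) := by
  simp only [Kn', Gl, oprod_W hq]
  rw [W_mul]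
  refine W_congr (add_zero _) fun r => ?_
  rw [add_zero, ← zpow_add₀ hq]
  rfl

theorem rowK_eq {q : ℂ} (hq : q ≠ 0) (m i : ℕ) : rowK q m i = Kd q (-sgR 1 m i) := by
  simp only [rowK, G'G hq, oprod_W hq]
  refine W_congr rfl fun r => ?_
  rw [AddMonoidHom.neg_apply, sgR_apply, ← Finset.sum_neg_distrib]
  simp only [neg_sub]

theorem colK_eq {q : ℂ} (hq : q ≠ 0) (n j : ℕ) : colK q n j = Kd q (sgC 1 n j) := by
  simp only [colK, GG' hq, oprod_W hq]
  rfl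

/-! mixed `K` relations -/
theorem KnrE {q : ℂ} (hq : q ≠ 0) {m n i : ℕ} (hi : 1 ≤ i) (hi' : i + 1 ≤ n) :
    Kn q m n * rowE q m i = (q ^ cartan n i) • (rowE q m i * Kn q m n) := by
  rw [Kn_eq hq, rowE_T hq]
  refine Kd_sum_neg hq _ _ _ _ _ _ _ fun k h1 h2 => ?_
  simp only [map_sub, AddMonoidHom.neg_apply, phi_single, cartan]
  grind

theorem KnrF {q : ℂ} (hq : q ≠ 0) {m n i : ℕ} (hi : 1 ≤ i) (hi' : i + 1 ≤ n) :
    Kn q m n * rowF q m i = (q ^ (-cartan n i)) • (rowF q m i * Kn q m n) := by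
  rw [Kn_eq hq, rowF_T hq]
  refine Kd_sum_neg hq _ _ _ _ _ _ _ fun k h1 h2 => ?_
  simp only [map_sub, AddMonoidHom.neg_apply, phi_single, cartan]
  grind

theorem KncE {q : ℂ} (hq : q ≠ 0) {m n j : ℕ} (hi : 1 ≤ j) (hi' : j + 1 ≤ m) :
    Kn q m n * colE q n j = (q ^ cartan n (n + j)) • (colE q n j * Kn q m n) := by
  rw [Kn_eq hq, colE_T hq]
  refine Kd_sum hq _ _ _ _ _ _ _ fun k h1 h2 => ?_
  simp only [map_sub, AddMonoidHom.neg_apply, phi_single, cartan]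
  grind

theorem KncF {q : ℂ} (hq : q ≠ 0) {m n j : ℕ} (hi : 1 ≤ j) (hi' : j + 1 ≤ m) :
    Kn q m n * colF q n j = (q ^ (-cartan n (n + j))) • (colF q n j * Kn q m n) := by
  rw [Kn_eq hq, colF_T hq]
  refine Kd_sum hq _ _ _ _ _ _ _ fun k h1 h2 => ?_
  simp only [map_sub, AddMonoidHom.neg_apply, phi_single, cartan]
  grind

theorem rKcE {q : ℂ} (hq : q ≠ 0) {m n i j : ℕ} (hi : 1 ≤ i) (hi' : i + 1 ≤ n)
    (hj : 1 ≤ j) (hj' : j + 1 ≤ m) :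
    rowK q m i * colE q n j = (q ^ cartan i (n + j)) • (colE q n j * rowK q m i) := by
  rw [rowK_eq hq, colE_T hq]
  refine Kd_sum hq _ _ _ _ _ _ _ fun k h1 h2 => ?_
  simp only [map_sub, AddMonoidHom.neg_apply, sgR_single, cartan]
  grind

theorem rKcF {q : ℂ} (hq : q ≠ 0) {m n i j : ℕ} (hi : 1 ≤ i) (hi' : i + 1 ≤ n)
    (hj : 1 ≤ j) (hj' : j + 1 ≤ m) :
    rowK q m i * colF q n j = (q ^ (-cartan i (n + j))) • (colF q n j * rowK q m i) := by
  rw [rowK_eq hq, colF_T hq]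
  refine Kd_sum hq _ _ _ _ _ _ _ fun k h1 h2 => ?_
  simp only [map_sub, AddMonoidHom.neg_apply, sgR_single, cartan]
  grind

theorem cKrE {q : ℂ} (hq : q ≠ 0) {m n i j : ℕ} (hi : 1 ≤ i) (hi' : i + 1 ≤ n)
    (hj : 1 ≤ j) (hj' : j + 1 ≤ m) :
    colK q n j * rowE q m i = (q ^ cartan (n + j) i) • (rowE q m i * colK q n j) := by
  rw [colK_eq hq, rowE_T hq]
  refine Kd_sum_neg hq _ _ _ _ _ _ _ fun k h1 h2 => ?_
  simp only [map_sub, sgC_single, cartan]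
  grind

theorem cKrF {q : ℂ} (hq : q ≠ 0) {m n i j : ℕ} (hi : 1 ≤ i) (hi' : i + 1 ≤ n)
    (hj : 1 ≤ j) (hj' : j + 1 ≤ m) :
    colK q n j * rowF q m i = (q ^ (-cartan (n + j) i)) • (rowF q m i * colK q n j) := by
  rw [colK_eq hq, rowF_T hq]
  refine Kd_sum_neg hq _ _ _ _ _ _ _ fun k h1 h2 => ?_
  simp only [map_sub, sgC_single, cartan]
  grind

end St17
namespace St17

section Gen
variable {A : Type*} [Ring A]

/-- row index -/
def isRow (n i : ℕ) : Prop := 1 ≤ i ∧ i + 1 ≤ n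
/-- column index -/
def isCol (n m i : ℕ) : Prop := n + 1 ≤ i ∧ i + 1 ≤ n + m

instance (n i : ℕ) : Decidable (isRow n i) := by unfold isRow; infer_instance
instance (n m i : ℕ) : Decidable (isCol n m i) := by unfold isCol; infer_instance

/-- the images of the generators, for arbitrary `X, ∂, γ, γ⁻¹` -/
def img (m n : ℕ) (X D G G' : ℕ → ℕ → A) : QGen → A
  | .e i => if isRow n i then
        -(∑ k ∈ Finset.Icc 1 m, oprod k m (fun t => G t i * G' t (i + 1)) * X k (i + 1) * D k i)
      else if isCol n m i then
        ∑ k ∈ Finset.Icc 1 n, X (i - n) k * D (i - n + 1) k *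
          oprod (k + 1) n (fun t => G (i - n) t * G' (i - n + 1) t)
      else 0
  | .f i => if isRow n i then
        -(∑ k ∈ Finset.Icc 1 m, X k i * D k (i + 1) * oprod 1 k (fun t => G' t i * G t (i + 1)))
      else if isCol n m i then
        ∑ k ∈ Finset.Icc 1 n, oprod 1 (k - 1) (fun t => G' (i - n) t * G (i - n + 1) t) *
          X (i - n + 1) k * D (i - n) k
      else 0
  | .k i => if isRow n i then oprod 1 m (fun t => G' t i * G t (i + 1))
      else if isCol n m i then oprod 1 n (fun t => G (i - n) t * G' (i - n + 1) t)
      else if i = n then oprod 1 n (fun t => G' 1 t) * oprod 1 m (fun s => G' s n)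
      else 0
  | .kinv i => if isRow n i then oprod 1 m (fun t => G t i * G' t (i + 1))
      else if isCol n m i then oprod 1 n (fun t => G' (i - n) t * G (i - n + 1) t)
      else if i = n then oprod 1 n (fun t => G 1 t) * oprod 1 m (fun s => G s n)
      else 0

end Gen

/-- images in the Laurent model -/
def imgL (q : ℂ) (m n : ℕ) : QGen → Module.End ℂ L :=
  img m n (fun a b => Xl (a, b)) (fun a b => Dl q (a, b)) (fun a b => Gl q (a, b))
    (fun a b => Gl q⁻¹ (a, b))

section
variable (q : ℂ) {m n i j : ℕ}

theorem not_row_col : ¬ isRow n (n + j) := by unfold isRow; omega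
theorem isCol_add (hj : 1 ≤ j) (hj' : j + 1 ≤ m) : isCol n m (n + j) := by unfold isCol; omega

theorem imgL_e_row (h : isRow n i) : imgL q m n (.e i) = rowE q m i := by
  simp only [imgL, img, if_pos h]; rfl
theorem imgL_f_row (h : isRow n i) : imgL q m n (.f i) = rowF q m i := by
  simp only [imgL, img, if_pos h]; rfl
theorem imgL_k_row (h : isRow n i) : imgL q m n (.k i) = rowK q m i := by
  simp only [imgL, img, if_pos h]; rfl
theorem imgL_kinv_row (h : isRow n i) : imgL q m n (.kinv i) = rowK' q m i := by
  simp only [imgL, img, if_pos h]; rfl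
theorem imgL_e_col (hj : 1 ≤ j) (hj' : j + 1 ≤ m) : imgL q m n (.e (n + j)) = colE q n j := by
  simp only [imgL, img, if_neg not_row_col, if_pos (isCol_add hj hj'), Nat.add_sub_cancel_left]; rfl
theorem imgL_f_col (hj : 1 ≤ j) (hj' : j + 1 ≤ m) : imgL q m n (.f (n + j)) = colF q n j := by
  simp only [imgL, img, if_neg not_row_col, if_pos (isCol_add hj hj'), Nat.add_sub_cancel_left]; rfl
theorem imgL_k_col (hj : 1 ≤ j) (hj' : j + 1 ≤ m) : imgL q m n (.k (n + j)) = colK q n j := by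
  simp only [imgL, img, if_neg not_row_col, if_pos (isCol_add hj hj'), Nat.add_sub_cancel_left]; rfl
theorem imgL_kinv_col (hj : 1 ≤ j) (hj' : j + 1 ≤ m) :
    imgL q m n (.kinv (n + j)) = colK' q n j := by
  simp only [imgL, img, if_neg not_row_col, if_pos (isCol_add hj hj'), Nat.add_sub_cancel_left]; rfl
theorem imgL_k_n : imgL q m n (.k n) = Kn q m n := by
  have h1 : ¬ isRow n n := by unfold isRow; omega
  have h2 : ¬ isCol n m n := by unfold isCol; omega
  simp only [imgL, img, if_neg h1, if_neg h2, if_pos]; rfl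
theorem imgL_kinv_n : imgL q m n (.kinv n) = Kn' q m n := by
  have h1 : ¬ isRow n n := by unfold isRow; omega
  have h2 : ¬ isCol n m n := by unfold isCol; omega
  simp only [imgL, img, if_neg h1, if_neg h2, if_pos]; rfl
end

theorem cartan_add (n a b : ℕ) : cartan (n + a) (n + b) = cartan a b := by
  unfold cartan
  grind

/-- case analysis on an index -/
theorem idx3 {n m i : ℕ} (h : kOK (n + m) i) :
    isRow n i ∨ i = n ∨ ∃ j, i = n + j ∧ 1 ≤ j ∧ j + 1 ≤ m := by
  unfold kOK at h
  unfold isRow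
  by_cases h1 : i + 1 ≤ n
  · left; omega
  · right
    by_cases h2 : i = n
    · left; exact h2
    · right; exact ⟨i - n, by omega, by omega, by omega⟩

theorem idx2 {n m i : ℕ} (h : kOK (n + m) i ∧ i ≠ n) :
    isRow n i ∨ ∃ j, i = n + j ∧ 1 ≤ j ∧ j + 1 ≤ m := by
  rcases idx3 h.1 with h1 | h1 | h1
  · exact Or.inl h1
  · exact absurd h1 h.2
  · exact Or.inr h1

section
variable {q : ℂ} {m n i j : ℕ}

theorem G_kk (hq : q ≠ 0) (hq2 : q - q⁻¹ ≠ 0) (h : kOK (n + m) i) : imgL q m n (.k i) * imgL q m n (.kinv i) = 1 := by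
  rcases idx3 h with h | rfl | ⟨j, rfl, hj, hj'⟩
  · rw [imgL_k_row q h, imgL_kinv_row q h]; exact (row_QR hq hq2 m).kk i
  · rw [imgL_k_n, imgL_kinv_n, Kn_eq hq, Kn'_eq hq]; exact Kd_inv hq _ _ (by simp)
  · rw [imgL_k_col q hj hj', imgL_kinv_col q hj hj']; exact (col_QR hq hq2 n).kk j

theorem G_k'k (hq : q ≠ 0) (hq2 : q - q⁻¹ ≠ 0) (h : kOK (n + m) i) : imgL q m n (.kinv i) * imgL q m n (.k i) = 1 := by
  rcases idx3 h with h | rfl | ⟨j, rfl, hj, hj'⟩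
  · rw [imgL_k_row q h, imgL_kinv_row q h]; exact (row_QR hq hq2 m).k'k i
  · rw [imgL_k_n, imgL_kinv_n, Kn_eq hq, Kn'_eq hq]; exact Kd_inv hq _ _ (by simp)
  · rw [imgL_k_col q hj hj', imgL_kinv_col q hj hj']; exact (col_QR hq hq2 n).k'k j

theorem G_diag (hq : q ≠ 0) (hq2 : q - q⁻¹ ≠ 0) (h : kOK (n + m) i) : ∃ p, imgL q m n (.k i) = Kd q p := by
  rcases idx3 h with h | rfl | ⟨j, rfl, hj, hj'⟩
  · rw [imgL_k_row q h]; exact ⟨_, rowK_eq hq _ _⟩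
  · rw [imgL_k_n]; exact ⟨_, Kn_eq hq _ _⟩
  · rw [imgL_k_col q hj hj']; exact ⟨_, colK_eq hq _ _⟩

theorem G_ke (hq : q ≠ 0) (hq2 : q - q⁻¹ ≠ 0) (h : kOK (n + m) i) (h' : kOK (n + m) j ∧ j ≠ n) :
    imgL q m n (.k i) * imgL q m n (.e j) =
      (q ^ cartan i j) • (imgL q m n (.e j) * imgL q m n (.k i)) := by
  rcases idx3 h with h | rfl | ⟨a, rfl, hj, hj'⟩ <;> rcases idx2 h' with h' | ⟨b, rfl, hb, hb'⟩
  · rw [imgL_k_row q h, imgL_e_row q h']; exact (row_QR hq hq2 m).ke i j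
  · rw [imgL_k_row q h, imgL_e_col q hb hb']; exact rKcE hq h.1 h.2 hb hb'
  · rw [imgL_k_n, imgL_e_row q h']; exact KnrE hq h'.1 h'.2
  · rw [imgL_k_n, imgL_e_col q hb hb']; exact KncE hq hb hb'
  · rw [imgL_k_col q hj hj', imgL_e_row q h']; exact cKrE hq h'.1 h'.2 hj hj'
  · rw [imgL_k_col q hj hj', imgL_e_col q hb hb', cartan_add]; exact (col_QR hq hq2 n).ke a b

theorem G_kf (hq : q ≠ 0) (hq2 : q - q⁻¹ ≠ 0) (h : kOK (n + m) i) (h' : kOK (n + m) j ∧ j ≠ n) :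
    imgL q m n (.k i) * imgL q m n (.f j) =
      (q ^ (-cartan i j)) • (imgL q m n (.f j) * imgL q m n (.k i)) := by
  rcases idx3 h with h | rfl | ⟨a, rfl, hj, hj'⟩ <;> rcases idx2 h' with h' | ⟨b, rfl, hb, hb'⟩
  · rw [imgL_k_row q h, imgL_f_row q h']; exact (row_QR hq hq2 m).kf i j
  · rw [imgL_k_row q h, imgL_f_col q hb hb']; exact rKcF hq h.1 h.2 hb hb'
  · rw [imgL_k_n, imgL_f_row q h']; exact KnrF hq h'.1 h'.2
  · rw [imgL_k_n, imgL_f_col q hb hb']; exact KncF hq hb hb'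
  · rw [imgL_k_col q hj hj', imgL_f_row q h']; exact cKrF hq h'.1 h'.2 hj hj'
  · rw [imgL_k_col q hj hj', imgL_f_col q hb hb', cartan_add]; exact (col_QR hq hq2 n).kf a b

theorem G_ef (hq : q ≠ 0) (hq2 : q - q⁻¹ ≠ 0) (h : kOK (n + m) i ∧ i ≠ n) (h' : kOK (n + m) j ∧ j ≠ n) :
    imgL q m n (.e i) * imgL q m n (.f j) - imgL q m n (.f j) * imgL q m n (.e i) =
      if i = j then (q - q⁻¹)⁻¹ • (imgL q m n (.k i) - imgL q m n (.kinv i)) else 0 := by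
  rcases idx2 h with h | ⟨a, rfl, hj, hj'⟩ <;> rcases idx2 h' with h' | ⟨b, rfl, hb, hb'⟩
  · rw [imgL_e_row q h, imgL_f_row q h', imgL_k_row q h, imgL_kinv_row q h]
    exact (row_QR hq hq2 m).ef i j
  · have : i ≠ n + b := by have := h.2; omega
    rw [imgL_e_row q h, imgL_f_col q hb hb', if_neg this, sub_eq_zero]
    exact rEcF hq hq2 h.1 h.2 hb hb'
  · have : n + a ≠ j := by have := h'.2; omega
    rw [imgL_e_col q hj hj', imgL_f_row q h', if_neg this, sub_eq_zero]
    exact (rFcE hq hq2 h'.1 h'.2 hj hj').symm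
  · rw [imgL_e_col q hj hj', imgL_f_col q hb hb', imgL_k_col q hj hj', imgL_kinv_col q hj hj']
    simp only [Nat.add_left_cancel_iff]
    exact (col_QR hq hq2 n).ef a b

theorem G_se (hq : q ≠ 0) (hq2 : q - q⁻¹ ≠ 0) (h : kOK (n + m) i ∧ i ≠ n) (h' : kOK (n + m) j ∧ j ≠ n)
    (hadj : i + 1 = j ∨ j + 1 = i) :
    imgL q m n (.e i) ^ 2 * imgL q m n (.e j) - (q + q⁻¹) •
      (imgL q m n (.e i) * imgL q m n (.e j) * imgL q m n (.e i)) +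
      imgL q m n (.e j) * imgL q m n (.e i) ^ 2 = 0 := by
  rcases idx2 h with h | ⟨a, rfl, hj, hj'⟩ <;> rcases idx2 h' with h' | ⟨b, rfl, hb, hb'⟩
  · rw [imgL_e_row q h, imgL_e_row q h']; exact (row_QR hq hq2 m).se i j hadj
  · have := h.2; omega
  · have := h'.2; omega
  · rw [imgL_e_col q hj hj', imgL_e_col q hb hb']
    exact (col_QR hq hq2 n).se a b (by omega)

theorem G_sf (hq : q ≠ 0) (hq2 : q - q⁻¹ ≠ 0) (h : kOK (n + m) i ∧ i ≠ n) (h' : kOK (n + m) j ∧ j ≠ n)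
    (hadj : i + 1 = j ∨ j + 1 = i) :
    imgL q m n (.f i) ^ 2 * imgL q m n (.f j) - (q + q⁻¹) •
      (imgL q m n (.f i) * imgL q m n (.f j) * imgL q m n (.f i)) +
      imgL q m n (.f j) * imgL q m n (.f i) ^ 2 = 0 := by
  rcases idx2 h with h | ⟨a, rfl, hj, hj'⟩ <;> rcases idx2 h' with h' | ⟨b, rfl, hb, hb'⟩
  · rw [imgL_f_row q h, imgL_f_row q h']; exact (row_QR hq hq2 m).sf i j hadj
  · have := h.2; omega
  · have := h'.2; omega
  · rw [imgL_f_col q hj hj', imgL_f_col q hb hb']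
    exact (col_QR hq hq2 n).sf a b (by omega)

theorem G_ee (hq : q ≠ 0) (hq2 : q - q⁻¹ ≠ 0) (h : kOK (n + m) i ∧ i ≠ n) (h' : kOK (n + m) j ∧ j ≠ n)
    (hfar : i + 1 < j ∨ j + 1 < i) :
    imgL q m n (.e i) * imgL q m n (.e j) = imgL q m n (.e j) * imgL q m n (.e i) := by
  rcases idx2 h with h | ⟨a, rfl, hj, hj'⟩ <;> rcases idx2 h' with h' | ⟨b, rfl, hb, hb'⟩
  · rw [imgL_e_row q h, imgL_e_row q h']; exact (row_QR hq hq2 m).ee i j hfar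
  · rw [imgL_e_row q h, imgL_e_col q hb hb']; exact rEcE hq hq2 h.1 h.2 hb hb'
  · rw [imgL_e_col q hj hj', imgL_e_row q h']; exact (rEcE hq hq2 h'.1 h'.2 hj hj').symm
  · rw [imgL_e_col q hj hj', imgL_e_col q hb hb']
    exact (col_QR hq hq2 n).ee a b (by omega)

theorem G_ff (hq : q ≠ 0) (hq2 : q - q⁻¹ ≠ 0) (h : kOK (n + m) i ∧ i ≠ n) (h' : kOK (n + m) j ∧ j ≠ n)
    (hfar : i + 1 < j ∨ j + 1 < i) :
    imgL q m n (.f i) * imgL q m n (.f j) = imgL q m n (.f j) * imgL q m n (.f i) := by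
  rcases idx2 h with h | ⟨a, rfl, hj, hj'⟩ <;> rcases idx2 h' with h' | ⟨b, rfl, hb, hb'⟩
  · rw [imgL_f_row q h, imgL_f_row q h']; exact (row_QR hq hq2 m).ff i j hfar
  · rw [imgL_f_row q h, imgL_f_col q hb hb']; exact rFcF hq hq2 h.1 h.2 hb hb'
  · rw [imgL_f_col q hj hj', imgL_f_row q h']; exact (rFcF hq hq2 h'.1 h'.2 hj hj').symm
  · rw [imgL_f_col q hj hj', imgL_f_col q hb hb']
    exact (col_QR hq hq2 n).ff a b (by omega)

end

theorem conj_of {A : Type*} [Ring A] [Algebra ℂ A] {k k' x : A} {c : ℂ} (h1 : k * k' = 1)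
    (h : k * x = c • (x * k)) : k * x * k' = c • x := by
  rw [h, smul_mul_assoc, mul_assoc, h1, mul_one]

theorem lift_rel {q : ℂ} (hq : q ≠ 0) (hq2 : q - q⁻¹ ≠ 0) {m n : ℕ} (hm : 1 ≤ m) (hn : 1 ≤ n)
    (x y : FA) (h : QRel q (n + m) (fun i => i ≠ n) (fun i => i ≠ n) x y) :
    FreeAlgebra.lift ℂ (imgL q m n) x = FreeAlgebra.lift ℂ (imgL q m n) y := by
  cases h with
  | e_junk i h =>
    have h1 : ¬ isRow n i := by unfold isRow; unfold kOK at h; omega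
    have h2 : ¬ isCol n m i := by unfold isCol; unfold kOK at h; omega
    simp [ge, imgL, img, h1, h2]
  | f_junk i h =>
    have h1 : ¬ isRow n i := by unfold isRow; unfold kOK at h; omega
    have h2 : ¬ isCol n m i := by unfold isCol; unfold kOK at h; omega
    simp [gf, imgL, img, h1, h2]
  | k_junk i h =>
    have h1 : ¬ isRow n i := by unfold isRow; unfold kOK at h; omega
    have h2 : ¬ isCol n m i := by unfold isCol; unfold kOK at h; omega
    have h3 : i ≠ n := by unfold kOK at h; omega
    simp [gk, imgL, img, h1, h2, h3]
  | kinv_junk i h =>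
    have h1 : ¬ isRow n i := by unfold isRow; unfold kOK at h; omega
    have h2 : ¬ isCol n m i := by unfold isCol; unfold kOK at h; omega
    have h3 : i ≠ n := by unfold kOK at h; omega
    simp [gkinv, imgL, img, h1, h2, h3]
  | k_kinv i h =>
    simp only [gk, gkinv, map_mul, FreeAlgebra.lift_ι_apply, map_one]; exact G_kk hq hq2 h
  | kinv_k i h =>
    simp only [gk, gkinv, map_mul, FreeAlgebra.lift_ι_apply, map_one]; exact G_k'k hq hq2 h
  | k_comm i j hi hj =>
    simp only [gk, map_mul, FreeAlgebra.lift_ι_apply]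
    obtain ⟨p, hp⟩ := G_diag hq hq2 hi
    obtain ⟨p', hp'⟩ := G_diag hq hq2 hj
    rw [hp, hp']; exact Kd_comm _ _ _
  | k_e i j hi hj =>
    simp only [gk, gkinv, ge, map_mul, map_smul, FreeAlgebra.lift_ι_apply]
    exact conj_of (G_kk hq hq2 hi) (G_ke hq hq2 hi hj)
  | k_f i j hi hj =>
    simp only [gk, gkinv, gf, map_mul, map_smul, FreeAlgebra.lift_ι_apply]
    exact conj_of (G_kk hq hq2 hi) (G_kf hq hq2 hi hj)
  | e_f i j hi hj =>
    have := G_ef hq hq2 hi hj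
    simp only [gk, gkinv, gf, ge, map_mul, map_sub, FreeAlgebra.lift_ι_apply]
    rw [this]
    split_ifs <;> simp
  | serre_e i j hi hj hadj =>
    simp only [ge, map_mul, map_smul, map_add, map_sub, map_pow, map_zero, FreeAlgebra.lift_ι_apply]
    exact G_se hq hq2 hi hj hadj
  | serre_f i j hi hj hadj =>
    simp only [gf, map_mul, map_smul, map_add, map_sub, map_pow, map_zero, FreeAlgebra.lift_ι_apply]
    exact G_sf hq hq2 hi hj hadj
  | e_e i j hi hj hfar =>
    simp only [ge, map_mul, FreeAlgebra.lift_ι_apply]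
    exact G_ee hq hq2 hi hj hfar
  | f_f i j hi hj hfar =>
    simp only [gf, map_mul, FreeAlgebra.lift_ι_apply]
    exact G_ff hq hq2 hi hj hfar

end St17
namespace St17

section Transfer
variable (m n : ℕ)

/-- extension of exponent vectors by zero -/
def emb (r : Fin m × Fin n →₀ ℕ) : V := fun s =>
  if h : (1 ≤ s.1 ∧ s.1 - 1 < m) ∧ (1 ≤ s.2 ∧ s.2 - 1 < n) then
    (r (⟨s.1 - 1, h.1.2⟩, ⟨s.2 - 1, h.2.2⟩) : ℤ) else 0

theorem emb_apply (r : Fin m × Fin n →₀ ℕ) {a b : ℕ} (ha : 1 ≤ a) (hb : 1 ≤ b)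
    (h : a - 1 < m ∧ b - 1 < n) : emb m n r (a, b) = (r (⟨a - 1, h.1⟩, ⟨b - 1, h.2⟩) : ℤ) := by
  rw [emb, dif_pos ⟨⟨ha, h.1⟩, ⟨hb, h.2⟩⟩]

theorem emb_add (r r' : Fin m × Fin n →₀ ℕ) : emb m n (r + r') = emb m n r + emb m n r' := by
  funext s
  simp only [emb, Pi.add_apply]
  split_ifs <;> simp

theorem emb_single {a b : ℕ} (ha : 1 ≤ a) (hb : 1 ≤ b)
    (h : a - 1 < m ∧ b - 1 < n) :
    emb m n (Finsupp.single (⟨a - 1, h.1⟩, ⟨b - 1, h.2⟩) 1) = Pi.single (a, b) 1 := by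
  funext s
  obtain ⟨x, y⟩ := s
  simp only [emb, Pi.single_apply, Finsupp.single_apply, Prod.mk.injEq, Fin.mk.injEq]
  split_ifs <;> first | rfl | omega

theorem emb_inj : Function.Injective (emb m n) := by
  intro r r' h
  ext ⟨x, y⟩
  have := congrFun h (x.1 + 1, y.1 + 1)
  rw [emb_apply m n r (by omega) (by omega) ⟨by simp, by simp⟩,
    emb_apply m n r' (by omega) (by omega) ⟨by simp, by simp⟩] at this
  simpa using this

/-- the embedding of polynomials in Laurent polynomials -/
def iota : Pmn m n →ₗ[ℂ] L := (basisMonomials (Fin m × Fin n) ℂ).constr ℂ (fun r => bv (emb m n r))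

theorem iota_mon (r : Fin m × Fin n →₀ ℕ) : iota m n (monomial r 1) = bv (emb m n r) := by
  have := (basisMonomials (Fin m × Fin n) ℂ).constr_basis ℂ (fun r => bv (emb m n r)) r
  rwa [coe_basisMonomials] at this

theorem iota_inj : Function.Injective (iota m n) := by
  let π : L →ₗ[ℂ] Pmn m n := bv.constr ℂ (fun v => monomial (Function.invFun (emb m n) v) 1)
  have h : π ∘ₗ iota m n = LinearMap.id := by
    refine (basisMonomials (Fin m × Fin n) ℂ).ext fun r => ?_
    rw [coe_basisMonomials]
    simp only [LinearMap.comp_apply, iota_mon, LinearMap.id_apply, π]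
    rw [bv.constr_basis, Function.leftInverse_invFun (emb_inj m n)]
  exact Function.LeftInverse.injective (g := π) fun x => by
    have := LinearMap.congr_fun h x
    simpa using this

/-- intertwining -/
def Inter (T : Module.End ℂ (Pmn m n)) (U : Module.End ℂ L) : Prop :=
  ∀ x, iota m n (T x) = U (iota m n x)

variable {m n}

theorem Inter.of_mon {T : Module.End ℂ (Pmn m n)} {U : Module.End ℂ L}
    (h : ∀ r, iota m n (T (monomial r 1)) = U (bv (emb m n r))) : Inter m n T U := by
  have : iota m n ∘ₗ T = U ∘ₗ iota m n := by
    refine (basisMonomials (Fin m × Fin n) ℂ).ext fun r => ?_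
    rw [coe_basisMonomials]
    simp only [LinearMap.comp_apply, iota_mon, h]
  exact fun x => LinearMap.congr_fun this x

theorem Inter.uniq {T T' : Module.End ℂ (Pmn m n)} {U : Module.End ℂ L}
    (h : Inter m n T U) (h' : Inter m n T' U) : T = T' :=
  LinearMap.ext fun x => iota_inj m n ((h x).trans (h' x).symm)

theorem Inter.one : Inter m n 1 1 := fun _ => rfl
theorem Inter.zero : Inter m n 0 0 := fun x => by simp
theorem Inter.add {T T' : Module.End ℂ (Pmn m n)} {U U' : Module.End ℂ L}
    (h : Inter m n T U) (h' : Inter m n T' U') : Inter m n (T + T') (U + U') := fun x => by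
  simp [h x, h' x]
theorem Inter.mul {T T' : Module.End ℂ (Pmn m n)} {U U' : Module.End ℂ L}
    (h : Inter m n T U) (h' : Inter m n T' U') : Inter m n (T * T') (U * U') := fun x => by
  simp only [Module.End.mul_apply]; rw [h, h']
theorem Inter.neg {T : Module.End ℂ (Pmn m n)} {U : Module.End ℂ L}
    (h : Inter m n T U) : Inter m n (-T) (-U) := fun x => by
  simp [h x]
theorem Inter.algebraMap (z : ℂ) : Inter m n (algebraMap ℂ _ z) (algebraMap ℂ _ z) := fun x => by
  simp [Module.algebraMap_end_apply]
theorem Inter.sum {T : ℕ → Module.End ℂ (Pmn m n)} {U : ℕ → Module.End ℂ L} {N : ℕ}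
    (h : ∀ k, 1 ≤ k → k ≤ N → Inter m n (T k) (U k)) :
    Inter m n (∑ k ∈ Finset.Icc 1 N, T k) (∑ k ∈ Finset.Icc 1 N, U k) := by
  intro x
  rw [LinearMap.sum_apply, LinearMap.sum_apply, map_sum]
  refine Finset.sum_congr rfl fun k hk => ?_
  have hk := Finset.mem_Icc.1 hk
  exact h k hk.1 hk.2 x
theorem Inter.oprod {T : ℕ → Module.End ℂ (Pmn m n)} {U : ℕ → Module.End ℂ L} {a b : ℕ}
    (h : ∀ k, a ≤ k → k ≤ b → Inter m n (T k) (U k)) :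
    Inter m n (oprod a b T) (oprod a b U) := by
  induction b with
  | zero =>
    rcases Nat.eq_zero_or_pos a with rfl | ha
    · simpa [_root_.oprod] using h 0 le_rfl le_rfl
    · rw [oprod_empty ha, oprod_empty ha]; exact Inter.one
  | succ b ih =>
    by_cases hb : a ≤ b + 1
    · rw [oprod_succ hb, oprod_succ hb]
      exact (ih fun k h1 h2 => h k h1 (by omega)).mul (h _ hb le_rfl)
    · rw [oprod_empty (by omega), oprod_empty (by omega)]; exact Inter.one

theorem Inter.X {a b : ℕ} (ha : 1 ≤ a) (ha' : a ≤ m) (hb : 1 ≤ b) (hb' : b ≤ n) :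
    Inter m n (Xop m n a b) (Xl (a, b)) := by
  have h : a - 1 < m ∧ b - 1 < n := by omega
  refine Inter.of_mon fun r => ?_
  rw [Xop, dif_pos h, LinearMap.mulLeft_apply, MvPolynomial.X, monomial_mul, one_mul,
    iota_mon, emb_add, emb_single m n ha hb h, Xl, W_bv, one_smul, add_comm]

theorem qnum_eq (q : ℂ) (k : ℕ) : qnum q k = qz q k := by
  simp [qnum, qz]

theorem Inter.D (q : ℂ) {a b : ℕ} (ha : 1 ≤ a) (ha' : a ≤ m) (hb : 1 ≤ b) (hb' : b ≤ n) :
    Inter m n (Pd q m n a b) (Dl q (a, b)) := by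
  have h : a - 1 < m ∧ b - 1 < n := by omega
  refine Inter.of_mon fun r => ?_
  have e : Pd q m n a b (monomial r 1) = qnum q (r (⟨a - 1, h.1⟩, ⟨b - 1, h.2⟩)) •
        monomial (r - Finsupp.single (⟨a - 1, h.1⟩, ⟨b - 1, h.2⟩) 1) (1 : ℂ) := by
    rw [Pd, dif_pos h]
    have := (basisMonomials (Fin m × Fin n) ℂ).constr_basis ℂ (fun r =>
      qnum q (r (⟨a - 1, h.1⟩, ⟨b - 1, h.2⟩)) •
        monomial (r - Finsupp.single (⟨a - 1, h.1⟩, ⟨b - 1, h.2⟩) 1) (1 : ℂ)) r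
    rwa [coe_basisMonomials] at this
  rw [e, map_smul, iota_mon, Dl, W_bv, emb_apply m n r ha hb h, qnum_eq]
  by_cases h0 : r (⟨a - 1, h.1⟩, ⟨b - 1, h.2⟩) = 0
  · simp [h0, qz]
  · congr 2
    have hle : Finsupp.single (⟨a - 1, h.1⟩, ⟨b - 1, h.2⟩) 1 ≤ r := by
      rw [Finsupp.single_le_iff]; omega
    rw [← emb_single m n ha hb h, ← sub_eq_add_neg, eq_sub_iff_add_eq, ← emb_add,
      tsub_add_cancel_of_le hle]

theorem Gam_mon (q : ℂ) (p : Fin m × Fin n) (r : Fin m × Fin n →₀ ℕ) :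
    aeval (R := ℂ) (fun p' : Fin m × Fin n => if p' = p then C q * X p' else X p') (monomial r 1) =
      q ^ (r p) • monomial r (1 : ℂ) := by
  induction r using Finsupp.induction_linear with
  | zero => simp
  | add f g hf hg =>
    have : monomial (f + g) (1 : ℂ) = monomial f 1 * monomial g 1 := by
      rw [monomial_mul, one_mul]
    rw [this, map_mul, hf, hg, Finsupp.add_apply, pow_add, smul_mul_smul_comm]
  | single p' k =>
    rw [← X_pow_eq_monomial, map_pow, aeval_X]
    by_cases hp : p' = p
    · subst hp
      rw [if_pos rfl, Finsupp.single_eq_same, mul_pow, ← C_pow, C_mul']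
    · rw [if_neg hp, Finsupp.single_eq_of_ne (Ne.symm hp), pow_zero, one_smul]

theorem Inter.G (q : ℂ) {a b : ℕ} (ha : 1 ≤ a) (ha' : a ≤ m) (hb : 1 ≤ b) (hb' : b ≤ n) :
    Inter m n (Gam q m n a b) (Gl q (a, b)) := by
  have h : a - 1 < m ∧ b - 1 < n := by omega
  refine Inter.of_mon fun r => ?_
  rw [Gam, dif_pos h, AlgHom.toLinearMap_apply, Gam_mon, map_smul, iota_mon, Gl, W_bv,
    emb_apply m n r ha hb h, add_zero, zpow_natCast]

/-- images in the polynomial model -/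
def imgP (q : ℂ) (m n : ℕ) : QGen → Module.End ℂ (Pmn m n) :=
  img m n (Xop m n) (Pd q m n) (Gam q m n) (Gam q⁻¹ m n)

theorem Inter.gen (q : ℂ) (hm : 1 ≤ m) (hn : 1 ≤ n) (g : QGen) :
    Inter m n (imgP q m n g) (imgL q m n g) := by
  cases g with
  | e i =>
    simp only [imgP, imgL, img]
    by_cases h1 : isRow n i
    · obtain ⟨h2, h3⟩ := h1
      rw [if_pos ⟨h2, h3⟩, if_pos ⟨h2, h3⟩]
      refine Inter.neg (Inter.sum fun k _ _ => Inter.mul (Inter.mul (Inter.oprod fun t _ _ =>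
        Inter.mul (Inter.G _ ?_ ?_ ?_ ?_) (Inter.G _ ?_ ?_ ?_ ?_)) (Inter.X ?_ ?_ ?_ ?_))
        (Inter.D _ ?_ ?_ ?_ ?_)) <;> omega
    rw [if_neg h1, if_neg h1]
    by_cases h1 : isCol n m i
    · obtain ⟨h2, h3⟩ := h1
      rw [if_pos ⟨h2, h3⟩, if_pos ⟨h2, h3⟩]
      refine (Inter.sum fun k _ _ => Inter.mul (Inter.mul (Inter.X ?_ ?_ ?_ ?_)
        (Inter.D _ ?_ ?_ ?_ ?_)) (Inter.oprod fun t _ _ =>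
        Inter.mul (Inter.G _ ?_ ?_ ?_ ?_) (Inter.G _ ?_ ?_ ?_ ?_))) <;> omega
    rw [if_neg h1, if_neg h1]
    exact Inter.zero
  | f i =>
    simp only [imgP, imgL, img]
    by_cases h1 : isRow n i
    · obtain ⟨h2, h3⟩ := h1
      rw [if_pos ⟨h2, h3⟩, if_pos ⟨h2, h3⟩]
      refine Inter.neg (Inter.sum fun k _ _ => Inter.mul (Inter.mul (Inter.X ?_ ?_ ?_ ?_)
        (Inter.D _ ?_ ?_ ?_ ?_)) (Inter.oprod fun t _ _ =>
        Inter.mul (Inter.G _ ?_ ?_ ?_ ?_) (Inter.G _ ?_ ?_ ?_ ?_))) <;> omega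
    rw [if_neg h1, if_neg h1]
    by_cases h1 : isCol n m i
    · obtain ⟨h2, h3⟩ := h1
      rw [if_pos ⟨h2, h3⟩, if_pos ⟨h2, h3⟩]
      refine (Inter.sum fun k _ _ => Inter.mul (Inter.mul (Inter.oprod fun t _ _ =>
        Inter.mul (Inter.G _ ?_ ?_ ?_ ?_) (Inter.G _ ?_ ?_ ?_ ?_)) (Inter.X ?_ ?_ ?_ ?_))
        (Inter.D _ ?_ ?_ ?_ ?_)) <;> omega
    rw [if_neg h1, if_neg h1]
    exact Inter.zero
  | k i =>
    simp only [imgP, imgL, img]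
    by_cases h1 : isRow n i
    · obtain ⟨h2, h3⟩ := h1
      rw [if_pos ⟨h2, h3⟩, if_pos ⟨h2, h3⟩]
      refine (Inter.oprod fun t _ _ =>
        Inter.mul (Inter.G _ ?_ ?_ ?_ ?_) (Inter.G _ ?_ ?_ ?_ ?_)) <;> omega
    rw [if_neg h1, if_neg h1]
    by_cases h1 : isCol n m i
    · obtain ⟨h2, h3⟩ := h1
      rw [if_pos ⟨h2, h3⟩, if_pos ⟨h2, h3⟩]
      refine (Inter.oprod fun t _ _ =>
        Inter.mul (Inter.G _ ?_ ?_ ?_ ?_) (Inter.G _ ?_ ?_ ?_ ?_)) <;> omega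
    rw [if_neg h1, if_neg h1]
    by_cases h1 : i = n
    · rw [if_pos h1, if_pos h1]
      refine Inter.mul (Inter.oprod fun t _ _ => Inter.G _ ?_ ?_ ?_ ?_)
        (Inter.oprod fun t _ _ => Inter.G _ ?_ ?_ ?_ ?_) <;> omega
    rw [if_neg h1, if_neg h1]
    exact Inter.zero
  | kinv i =>
    simp only [imgP, imgL, img]
    by_cases h1 : isRow n i
    · obtain ⟨h2, h3⟩ := h1
      rw [if_pos ⟨h2, h3⟩, if_pos ⟨h2, h3⟩]
      refine (Inter.oprod fun t _ _ =>
        Inter.mul (Inter.G _ ?_ ?_ ?_ ?_) (Inter.G _ ?_ ?_ ?_ ?_)) <;> omega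
    rw [if_neg h1, if_neg h1]
    by_cases h1 : isCol n m i
    · obtain ⟨h2, h3⟩ := h1
      rw [if_pos ⟨h2, h3⟩, if_pos ⟨h2, h3⟩]
      refine (Inter.oprod fun t _ _ =>
        Inter.mul (Inter.G _ ?_ ?_ ?_ ?_) (Inter.G _ ?_ ?_ ?_ ?_)) <;> omega
    rw [if_neg h1, if_neg h1]
    by_cases h1 : i = n
    · rw [if_pos h1, if_pos h1]
      refine Inter.mul (Inter.oprod fun t _ _ => Inter.G _ ?_ ?_ ?_ ?_)
        (Inter.oprod fun t _ _ => Inter.G _ ?_ ?_ ?_ ?_) <;> omega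
    rw [if_neg h1, if_neg h1]
    exact Inter.zero

theorem Inter.lift (q : ℂ) (hm : 1 ≤ m) (hn : 1 ≤ n) (x : FA) :
    Inter m n (FreeAlgebra.lift ℂ (imgP q m n) x) (FreeAlgebra.lift ℂ (imgL q m n) x) := by
  induction x using FreeAlgebra.induction with
  | grade0 z => rw [AlgHom.commutes, AlgHom.commutes]; exact Inter.algebraMap z
  | grade1 g => rw [FreeAlgebra.lift_ι_apply, FreeAlgebra.lift_ι_apply]; exact Inter.gen q hm hn g
  | mul a b ha hb => rw [map_mul, map_mul]; exact ha.mul hb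
  | add a b ha hb => rw [map_add, map_add]; exact ha.add hb

/-- the representation -/
theorem exists_rho {q : ℂ} (hq : q ≠ 0) (hq2 : q - q⁻¹ ≠ 0) (hm : 1 ≤ m) (hn : 1 ≤ n) :
    ∃ ρ : UqL q n m →ₐ[ℂ] Module.End ℂ (Pmn m n), ∀ g,
      ρ (RingQuot.mkAlgHom ℂ (QRel q (n + m) (fun i => i ≠ n) (fun i => i ≠ n))
        (FreeAlgebra.ι ℂ g)) = imgP q m n g := by
  refine ⟨RingQuot.liftAlgHom ℂ ⟨FreeAlgebra.lift ℂ (imgP q m n), fun x y h => ?_⟩, fun g => ?_⟩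
  · have h1 := Inter.lift q hm hn x
    rw [lift_rel hq hq2 hm hn x y h] at h1
    exact h1.uniq (Inter.lift q hm hn y)
  · rw [RingQuot.liftAlgHom_mkAlgHom_apply, FreeAlgebra.lift_ι_apply]

end Transfer

end St17
namespace St17

theorem mkP {q : ℂ} {m n : ℕ} (ρ ρ' : UqL q n m →ₐ[ℂ] Module.End ℂ (Pmn m n))
    (he : ∀ i, kOK (n + m) i → i ≠ n → ρ (lE q n m i) = ρ' (lE q n m i))
    (hf : ∀ i, kOK (n + m) i → i ≠ n → ρ (lF q n m i) = ρ' (lF q n m i))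
    (hk : ∀ i, kOK (n + m) i → ρ (lK q n m i) = ρ' (lK q n m i))
    (hk' : ∀ i, kOK (n + m) i → ρ (lKinv q n m i) = ρ' (lKinv q n m i)) : ρ = ρ' := by
  refine RingQuot.ringQuot_ext' _ _ _ (FreeAlgebra.hom_ext (funext fun g => ?_))
  cases g with
  | e i =>
    by_cases h : kOK (n + m) i ∧ i ≠ n
    · exact he i h.1 h.2
    · have h0 := RingQuot.mkAlgHom_rel ℂ (QRel.e_junk (q := q) (N := n + m)
        (eok := fun i => i ≠ n) (fok := fun i => i ≠ n) i h)
      change ρ (RingQuot.mkAlgHom ℂ _ (ge i)) = ρ' (RingQuot.mkAlgHom ℂ _ (ge i))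
      rw [h0]; simp
  | f i =>
    by_cases h : kOK (n + m) i ∧ i ≠ n
    · exact hf i h.1 h.2
    · have h0 := RingQuot.mkAlgHom_rel ℂ (QRel.f_junk (q := q) (N := n + m)
        (eok := fun i => i ≠ n) (fok := fun i => i ≠ n) i h)
      change ρ (RingQuot.mkAlgHom ℂ _ (gf i)) = ρ' (RingQuot.mkAlgHom ℂ _ (gf i))
      rw [h0]; simp
  | k i =>
    by_cases h : kOK (n + m) i
    · exact hk i h
    · have h0 := RingQuot.mkAlgHom_rel ℂ (QRel.k_junk (q := q) (N := n + m)
        (eok := fun i => i ≠ n) (fok := fun i => i ≠ n) i h)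
      change ρ (RingQuot.mkAlgHom ℂ _ (gk i)) = ρ' (RingQuot.mkAlgHom ℂ _ (gk i))
      rw [h0]; simp
  | kinv i =>
    by_cases h : kOK (n + m) i
    · exact hk' i h
    · have h0 := RingQuot.mkAlgHom_rel ℂ (QRel.kinv_junk (q := q) (N := n + m)
        (eok := fun i => i ≠ n) (fok := fun i => i ≠ n) i h)
      change ρ (RingQuot.mkAlgHom ℂ _ (gkinv i)) = ρ' (RingQuot.mkAlgHom ℂ _ (gkinv i))
      rw [h0]; simp

theorem main (q : ℂ) (hq0 : q ≠ 0) (hq1 : q ≠ 1) (hqm1 : q ≠ -1)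
    (m n : ℕ) (hm : 1 ≤ m) (hn : 1 ≤ n) :
    ∃! ρ : UqL q n m →ₐ[ℂ] Module.End ℂ (Pmn m n),
      (∀ i, 1 ≤ i → i ≤ n - 1 →
        ρ (lE q n m i) = -(∑ k ∈ Finset.Icc 1 m,
          oprod k m (fun t => Gam q m n t i * Gam q⁻¹ m n t (i + 1)) *
            Xop m n k (i + 1) * Pd q m n k i)) ∧
      (∀ i, 1 ≤ i → i ≤ n - 1 →
        ρ (lF q n m i) = -(∑ k ∈ Finset.Icc 1 m,
          Xop m n k i * Pd q m n k (i + 1) *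
            oprod 1 k (fun t => Gam q⁻¹ m n t i * Gam q m n t (i + 1)))) ∧
      (∀ i, 1 ≤ i → i ≤ n - 1 →
        ρ (lK q n m i) = oprod 1 m (fun t => Gam q⁻¹ m n t i * Gam q m n t (i + 1))) ∧
      (ρ (lK q n m n) =
        oprod 1 n (fun t => Gam q⁻¹ m n 1 t) * oprod 1 m (fun s => Gam q⁻¹ m n s n)) ∧
      (∀ i, 1 ≤ i → i ≤ m - 1 →
        ρ (lE q n m (n + i)) = ∑ k ∈ Finset.Icc 1 n,
          Xop m n i k * Pd q m n (i + 1) k *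
            oprod (k + 1) n (fun t => Gam q m n i t * Gam q⁻¹ m n (i + 1) t)) ∧
      (∀ i, 1 ≤ i → i ≤ m - 1 →
        ρ (lF q n m (n + i)) = ∑ k ∈ Finset.Icc 1 n,
          oprod 1 (k - 1) (fun t => Gam q⁻¹ m n i t * Gam q m n (i + 1) t) *
            Xop m n (i + 1) k * Pd q m n i k) ∧
      (∀ i, 1 ≤ i → i ≤ m - 1 →
        ρ (lK q n m (n + i)) = oprod 1 n (fun t => Gam q m n i t * Gam q⁻¹ m n (i + 1) t))
      ∧
      (∀ j, 1 ≤ j → j ≤ n + m - 1 →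
        ρ (lKinv q n m j) * ρ (lK q n m j) = 1 ∧
        ρ (lK q n m j) * ρ (lKinv q n m j) = 1) := by
  have hq2 : q - q⁻¹ ≠ 0 := by
    intro h
    have h2 : (q - 1) * (q + 1) = 0 := by
      have : q * (q - q⁻¹) = 0 := by rw [h, mul_zero]
      rw [mul_sub, mul_inv_cancel₀ hq0] at this
      linear_combination this
    rcases mul_eq_zero.1 h2 with h3 | h3
    · exact hq1 (sub_eq_zero.1 h3)
    · exact hqm1 (eq_neg_of_add_eq_zero_left h3)
  obtain ⟨ρ, hρ⟩ := exists_rho hq0 hq2 hm hn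
  have hE : ∀ i, ρ (lE q n m i) = imgP q m n (.e i) := fun i => hρ _
  have hF : ∀ i, ρ (lF q n m i) = imgP q m n (.f i) := fun i => hρ _
  have hK : ∀ i, ρ (lK q n m i) = imgP q m n (.k i) := fun i => hρ _
  have row : ∀ i, 1 ≤ i → i ≤ n - 1 → isRow n i := fun i h1 h2 => ⟨h1, by omega⟩
  have col : ∀ i, 1 ≤ i → i ≤ m - 1 → isCol n m (n + i) := fun i h1 h2 =>
    ⟨by omega, by omega⟩
  have hnn1 : ¬ isRow n n := by unfold isRow; omega
  have hnn2 : ¬ isCol n m n := by unfold isCol; omega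
  refine ⟨ρ, ⟨?_, ?_, ?_, ?_, ?_, ?_, ?_, ?_⟩, ?_⟩
  · intro i h1 h2
    rw [hE]; simp only [imgP, img, if_pos (row i h1 h2)]
  · intro i h1 h2
    rw [hF]; simp only [imgP, img, if_pos (row i h1 h2)]
  · intro i h1 h2
    rw [hK]; simp only [imgP, img, if_pos (row i h1 h2)]
  · rw [hK]; simp only [imgP, img, if_neg hnn1, if_neg hnn2, if_pos]
  · intro i h1 h2
    rw [hE]
    simp only [imgP, img, if_neg not_row_col, if_pos (col i h1 h2), Nat.add_sub_cancel_left]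
  · intro i h1 h2
    rw [hF]
    simp only [imgP, img, if_neg not_row_col, if_pos (col i h1 h2), Nat.add_sub_cancel_left]
  · intro i h1 h2
    rw [hK]
    simp only [imgP, img, if_neg not_row_col, if_pos (col i h1 h2), Nat.add_sub_cancel_left]
  · intro j h1 h2
    have r1 := RingQuot.mkAlgHom_rel ℂ (QRel.kinv_k (q := q) (N := n + m)
        (eok := fun i => i ≠ n) (fok := fun i => i ≠ n) j ⟨h1, h2⟩)
    have r2 := RingQuot.mkAlgHom_rel ℂ (QRel.k_kinv (q := q) (N := n + m)
        (eok := fun i => i ≠ n) (fok := fun i => i ≠ n) j ⟨h1, h2⟩)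
    rw [map_mul, map_one] at r1 r2
    rw [← map_mul, ← map_mul, lK, lKinv, r1, r2, map_one]
    exact ⟨rfl, rfl⟩
  · rintro σ ⟨s1, s2, s3, s4, s5, s6, s7, s8⟩
    have hk : ∀ i, kOK (n + m) i → σ (lK q n m i) = ρ (lK q n m i) := by
      intro i hi
      rcases idx3 hi with h | rfl | ⟨j, rfl, hj, hj'⟩
      · rw [s3 i h.1 (by have := h.2; omega), hK]; simp only [imgP, img, if_pos h]
      · rw [s4, hK]; simp only [imgP, img, if_neg hnn1, if_neg hnn2, if_pos]
      · rw [s7 j hj (by omega), hK]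
        simp only [imgP, img, if_neg not_row_col, if_pos (col j hj (by omega)),
          Nat.add_sub_cancel_left]
    refine mkP σ ρ ?_ ?_ hk ?_
    · intro i hi hin
      rcases idx2 ⟨hi, hin⟩ with h | ⟨j, rfl, hj, hj'⟩
      · rw [s1 i h.1 (by have := h.2; omega), hE]; simp only [imgP, img, if_pos h]
      · rw [s5 j hj (by omega), hE]
        simp only [imgP, img, if_neg not_row_col, if_pos (col j hj (by omega)),
          Nat.add_sub_cancel_left]
    · intro i hi hin
      rcases idx2 ⟨hi, hin⟩ with h | ⟨j, rfl, hj, hj'⟩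
      · rw [s2 i h.1 (by have := h.2; omega), hF]; simp only [imgP, img, if_pos h]
      · rw [s6 j hj (by omega), hF]
        simp only [imgP, img, if_neg not_row_col, if_pos (col j hj (by omega)),
          Nat.add_sub_cancel_left]
    · intro i hi
      have a1 := (s8 i hi.1 hi.2).1
      have r2 := RingQuot.mkAlgHom_rel ℂ (QRel.k_kinv (q := q) (N := n + m)
        (eok := fun i => i ≠ n) (fok := fun i => i ≠ n) i hi)
      rw [map_mul, map_one] at r2
      have a2 : ρ (lK q n m i) * ρ (lKinv q n m i) = 1 := by
        rw [← map_mul, lK, lKinv, r2, map_one]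
      rw [hk i hi] at a1
      exact left_inv_eq_right_inv a1 a2

end St17
/-- existence and uniqueness of the `ℂ`-algebra homomorphism
`ρ : U_q(𝔩) → End_ℂ(ℂ[x])` given by the explicit quantum differential operators,
with `ρ(k_j⁻¹) = ρ(k_j)⁻¹` throughout. -/
theorem stmt17 (q : ℂ) (hq0 : q ≠ 0) (hq1 : q ≠ 1) (hqm1 : q ≠ -1)
    (m n : ℕ) (hm : 1 ≤ m) (hn : 1 ≤ n) :
    ∃! ρ : UqL q n m →ₐ[ℂ] Module.End ℂ (Pmn m n),
      (∀ i, 1 ≤ i → i ≤ n - 1 →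
        ρ (lE q n m i) = -(∑ k ∈ Finset.Icc 1 m,
          oprod k m (fun t => Gam q m n t i * Gam q⁻¹ m n t (i + 1)) *
            Xop m n k (i + 1) * Pd q m n k i)) ∧
      (∀ i, 1 ≤ i → i ≤ n - 1 →
        ρ (lF q n m i) = -(∑ k ∈ Finset.Icc 1 m,
          Xop m n k i * Pd q m n k (i + 1) *
            oprod 1 k (fun t => Gam q⁻¹ m n t i * Gam q m n t (i + 1)))) ∧
      (∀ i, 1 ≤ i → i ≤ n - 1 →
        ρ (lK q n m i) = oprod 1 m (fun t => Gam q⁻¹ m n t i * Gam q m n t (i + 1))) ∧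
      (ρ (lK q n m n) =
        oprod 1 n (fun t => Gam q⁻¹ m n 1 t) * oprod 1 m (fun s => Gam q⁻¹ m n s n)) ∧
      (∀ i, 1 ≤ i → i ≤ m - 1 →
        ρ (lE q n m (n + i)) = ∑ k ∈ Finset.Icc 1 n,
          Xop m n i k * Pd q m n (i + 1) k *
            oprod (k + 1) n (fun t => Gam q m n i t * Gam q⁻¹ m n (i + 1) t)) ∧
      (∀ i, 1 ≤ i → i ≤ m - 1 →
        ρ (lF q n m (n + i)) = ∑ k ∈ Finset.Icc 1 n,
          oprod 1 (k - 1) (fun t => Gam q⁻¹ m n i t * Gam q m n (i + 1) t) *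
            Xop m n (i + 1) k * Pd q m n i k) ∧
      (∀ i, 1 ≤ i → i ≤ m - 1 →
        ρ (lK q n m (n + i)) = oprod 1 n (fun t => Gam q m n i t * Gam q⁻¹ m n (i + 1) t))
      ∧
      (∀ j, 1 ≤ j → j ≤ n + m - 1 →
        ρ (lKinv q n m j) * ρ (lK q n m j) = 1 ∧
        ρ (lK q n m j) * ρ (lKinv q n m j) = 1) := by
  exact St17.main q hq0 hq1 hqm1 m n hm hn
end
end

section
/- Let ρ : U_q(𝔩) → End_ℂ(ℂ[x]) be the ℂ-algebra homomorphism determined by the formulas ρ(e_i) = − Σ_{k=1}^m (∏_{t=k}^m γ_{t,i}γ_{t,i+1}^{-1}) X_{k,i+1}∂_{k,i}, ρ(f_i) = − Σ_{k=1}^m X_{k,i}∂_{k,i+1} ∏_{t=1}^k γ_{t,i}^{-1}γ_{t,i+1}, ρ(k_i) = ∏_{t=1}^m γ_{t,i}^{-1}γ_{t,i+1} (1 ≤ i ≤ n−1), ρ(k_n) = ∏_{t=1}^n γ_{1,t}^{-1} ∏_{s=1}^m γ_{s,n}^{-1}, ρ(e_{n+i}) = Σ_{k=1}^n X_{i,k}∂_{i+1,k}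 ∏_{t=k+1}^n γ_{i,t}γ_{i+1,t}^{-1}, ρ(f_{n+i}) = Σ_{k=1}^n (∏_{t=1}^{k−1} γ_{i,t}^{-1}γ_{i+1,t}) X_{i+1,k}∂_{i,k}, ρ(k_{n+i}) = ∏_{t=1}^n γ_{i,t}γ_{i+1,t}^{-1} (1 ≤ i ≤ m−1). Then for all 1 ≤ i < j ≤ n, with s = j − i, one has ρ(E_{j,i}) = − Σ_{1 ≤ k_1 ≤ … ≤ k_s ≤ m} (q^{-1} − q)^{τ(k_1,…,k_s) − 1} · X_{k_1,i} · θ_{k_1,…,k_s} · ∂_{k_s,j} · ∏_{a=1}^s ∏_{t=1}^{k_a} γ_{t,i+a}γ_{t,i+a−1}^{-1}, where τ(k_1,…,k_s) is the number of distinct values among k_1,…,k_s and θ_{k_1,…,k_s} = β_{k_1}β_{k_2}⋯β_{k_{s−1}} (the empty product, i.e. the identity, when s = 1) with β_{k_t} = ∂_{k_t,i+t} X_{k_{t+1},i+t} if k_t ≠ k_{t+1} and β_{k_t} = γ_{k_t,i+t}^{-1} if k_t = k_{t+1}. -/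
noncomputable section

open MvPolynomial
open scoped TensorProduct

/-- Auxiliary: `EdnAux q f j g = E_{j,j-1-g}`, the lowering root vectors indexed by the
gap `g`, built from the generators `f` by `E_{i+1,i} = f_i` and
`E_{j,i} = E_{j,i+1}f_i − q⁻¹·f_i E_{j,i+1}`. -/
def EdnAux {U : Type*} [Ring U] [Algebra ℂ U] (q : ℂ) (f : ℕ → U) (j : ℕ) : ℕ → U
  | 0 => f (j - 1)
  | g + 1 => EdnAux q f j g * f (j - g - 2) - q⁻¹ • (f (j - g - 2) * EdnAux q f j g)

/-- The lowering root vector `E_{j,i}` (intended for `i < j`). -/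
def Edn {U : Type*} [Ring U] [Algebra ℂ U] (q : ℂ) (f : ℕ → U) (j i : ℕ) : U :=
  EdnAux q f j (j - i - 1)

/-- `K_{i,j} = k_i k_{i+1} ⋯ k_{j-1}`. -/
def Kprod {U : Type*} [Ring U] [Algebra ℂ U] (k : ℕ → U) (i j : ℕ) : U :=
  ((List.range' i (j - i)).map k).prod


section Help
variable {m n : ℕ}

theorem Xop_mono (m n a b : ℕ) (h : a - 1 < m ∧ b - 1 < n) (r : (Fin m × Fin n) →₀ ℕ) (v : ℂ) :
    Xop m n a b (monomial r v) =
      monomial (Finsupp.single (⟨a - 1, h.1⟩, ⟨b - 1, h.2⟩) 1 + r) v := by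
  rw [Xop, dif_pos h, LinearMap.mulLeft_apply, X, monomial_mul, one_mul]

theorem Gam_mono (c : ℂ) (m n a b : ℕ) (h : a - 1 < m ∧ b - 1 < n)
    (r : (Fin m × Fin n) →₀ ℕ) (v : ℂ) :
    Gam c m n a b (monomial r v) =
      monomial r (c ^ (r (⟨a - 1, h.1⟩, ⟨b - 1, h.2⟩)) * v) := by
  rw [Gam, dif_pos h, AlgHom.toLinearMap_apply, aeval_monomial, monomial_eq, C_mul,
    Finsupp.prod_fintype _ _ (fun _ => pow_zero _), Finsupp.prod_fintype _ _ (fun _ => pow_zero _)]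
  have : ∀ p : Fin m × Fin n, (if p = ((⟨a - 1, h.1⟩ : Fin m), (⟨b - 1, h.2⟩ : Fin n))
      then C c * X p else (X p : Pmn m n)) ^ r p =
      (if p = ((⟨a - 1, h.1⟩ : Fin m), (⟨b - 1, h.2⟩ : Fin n)) then C c ^ r p else 1)
        * X p ^ r p := by
    intro p
    split_ifs <;> simp [mul_pow]
  simp only [this, Finset.prod_mul_distrib, Finset.prod_ite_eq', Finset.mem_univ, if_true]
  rw [algebraMap_eq, C_pow]
  ring

theorem Pd_mono (q : ℂ) (m n a b : ℕ) (h : a - 1 < m ∧ b - 1 < n)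
    (r : (Fin m × Fin n) →₀ ℕ) (v : ℂ) :
    Pd q m n a b (monomial r v) =
      monomial (r - Finsupp.single (⟨a - 1, h.1⟩, ⟨b - 1, h.2⟩) 1)
        (qnum q (r (⟨a - 1, h.1⟩, ⟨b - 1, h.2⟩)) * v) := by
  have hv : monomial r v = v • (basisMonomials (Fin m × Fin n) ℂ r) := by
    simp [coe_basisMonomials, smul_monomial]
  rw [Pd, dif_pos h, hv, map_smul, Module.Basis.constr_basis, smul_smul, smul_monomial]
  simp [mul_comm]

theorem op_ext (f g : Module.End ℂ (Pmn m n))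
    (h : ∀ r, f (monomial r 1) = g (monomial r 1)) : f = g := by
  apply (basisMonomials (Fin m × Fin n) ℂ).ext
  intro r
  simpa using h r

theorem pair_ne {a b a' b' : ℕ} (h : a - 1 < m ∧ b - 1 < n) (h' : a' - 1 < m ∧ b' - 1 < n)
    (hne : a - 1 ≠ a' - 1 ∨ b - 1 ≠ b' - 1) :
    ((⟨a - 1, h.1⟩ : Fin m), (⟨b - 1, h.2⟩ : Fin n)) ≠ (⟨a' - 1, h'.1⟩, ⟨b' - 1, h'.2⟩) := by
  intro e
  simp only [Prod.mk.injEq, Fin.mk.injEq] at e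
  omega

theorem Gam_Gam (c d : ℂ) (a b a' b' : ℕ) : Commute (Gam c m n a b) (Gam d m n a' b') := by
  by_cases h : a - 1 < m ∧ b - 1 < n
  swap
  · rw [Gam, dif_neg h]; exact Commute.one_left _
  by_cases h' : a' - 1 < m ∧ b' - 1 < n
  swap
  · rw [Gam, Gam, dif_neg h']; exact Commute.one_right _
  apply op_ext
  intro r
  simp only [Module.End.mul_apply, Gam_mono _ _ _ _ _ h, Gam_mono _ _ _ _ _ h']
  ring_nf

theorem Xop_Xop (a b a' b' : ℕ) : Commute (Xop m n a b) (Xop m n a' b') := by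
  by_cases h : a - 1 < m ∧ b - 1 < n
  swap
  · rw [Xop, dif_neg h]; exact Commute.zero_left _
  by_cases h' : a' - 1 < m ∧ b' - 1 < n
  swap
  · rw [Xop, Xop, dif_neg h']; exact Commute.zero_right _
  apply op_ext
  intro r
  simp only [Module.End.mul_apply, Xop_mono _ _ _ _ h, Xop_mono _ _ _ _ h']
  rw [add_left_comm]

theorem Gam_Xop (c : ℂ) (a b a' b' : ℕ) (hne : a - 1 ≠ a' - 1 ∨ b - 1 ≠ b' - 1) :
    Commute (Gam c m n a b) (Xop m n a' b') := by
  by_cases h : a - 1 < m ∧ b - 1 < n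
  swap
  · rw [Gam, dif_neg h]; exact Commute.one_left _
  by_cases h' : a' - 1 < m ∧ b' - 1 < n
  swap
  · rw [Xop, dif_neg h']; exact Commute.zero_right _
  apply op_ext
  intro r
  simp only [Module.End.mul_apply, Gam_mono _ _ _ _ _ h, Xop_mono _ _ _ _ h']
  simp [Finsupp.single_apply, (pair_ne h h' hne).symm]

theorem Gam_Xop_self (c : ℂ) (a b : ℕ) :
    Gam c m n a b * Xop m n a b = c • (Xop m n a b * Gam c m n a b) := by
  by_cases h : a - 1 < m ∧ b - 1 < n
  swap
  · rw [Xop, dif_neg h]; simp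
  apply op_ext
  intro r
  simp only [Module.End.mul_apply, LinearMap.smul_apply, Gam_mono _ _ _ _ _ h, Xop_mono _ _ _ _ h]
  simp [smul_monomial, pow_add]

theorem Gam_Pd (c q : ℂ) (a b a' b' : ℕ) (hne : a - 1 ≠ a' - 1 ∨ b - 1 ≠ b' - 1) :
    Commute (Gam c m n a b) (Pd q m n a' b') := by
  by_cases h : a - 1 < m ∧ b - 1 < n
  swap
  · rw [Gam, dif_neg h]; exact Commute.one_left _
  by_cases h' : a' - 1 < m ∧ b' - 1 < n
  swap
  · rw [Pd, dif_neg h']; exact Commute.zero_right _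
  apply op_ext
  intro r
  simp only [Module.End.mul_apply, Gam_mono _ _ _ _ _ h, Pd_mono _ _ _ _ _ h']
  simp [Finsupp.single_apply, (pair_ne h h' hne).symm, mul_comm]

theorem qnum_zero (q : ℂ) : qnum q 0 = 0 := by simp [qnum]

theorem Gam_Pd_self (c q : ℂ) (hc : c ≠ 0) (a b : ℕ) :
    Gam c⁻¹ m n a b * Pd q m n a b = c • (Pd q m n a b * Gam c⁻¹ m n a b) := by
  by_cases h : a - 1 < m ∧ b - 1 < n
  swap
  · rw [Pd, dif_neg h]; simp
  apply op_ext
  intro r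
  simp only [Module.End.mul_apply, LinearMap.smul_apply, Gam_mono _ _ _ _ _ h, Pd_mono _ _ _ _ _ h]
  rw [smul_monomial]
  congr 1
  simp only [Finsupp.tsub_apply, Finsupp.single_eq_same, smul_eq_mul]
  rcases hk : r (⟨a - 1, h.1⟩, ⟨b - 1, h.2⟩) with _ | k
  · simp [qnum_zero]
  · rw [pow_succ, Nat.add_sub_cancel]
    field_simp

theorem Xop_Pd (q : ℂ) (a b a' b' : ℕ) (hne : a - 1 ≠ a' - 1 ∨ b - 1 ≠ b' - 1) :
    Commute (Xop m n a b) (Pd q m n a' b') := by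
  by_cases h : a - 1 < m ∧ b - 1 < n
  swap
  · rw [Xop, dif_neg h]; exact Commute.zero_left _
  by_cases h' : a' - 1 < m ∧ b' - 1 < n
  swap
  · rw [Pd, dif_neg h']; exact Commute.zero_right _
  apply op_ext
  intro r
  have hn := pair_ne h h' hne
  simp only [Module.End.mul_apply, Xop_mono _ _ _ _ h, Pd_mono _ _ _ _ _ h']
  congr 1
  · congr 1
    ext p
    by_cases hp : p = (⟨a' - 1, h'.1⟩, ⟨b' - 1, h'.2⟩)
    · subst hp
      simp [Finsupp.single_apply, hn]
    · simp [Finsupp.single_apply, Ne.symm hp]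
  · simp [Finsupp.single_apply, hn]

theorem Pd_Pd (q : ℂ) (a b a' b' : ℕ) (hne : a - 1 ≠ a' - 1 ∨ b - 1 ≠ b' - 1) :
    Commute (Pd q m n a b) (Pd q m n a' b') := by
  by_cases h : a - 1 < m ∧ b - 1 < n
  swap
  · rw [Pd, dif_neg h]; exact Commute.zero_left _
  by_cases h' : a' - 1 < m ∧ b' - 1 < n
  swap
  · rw [Pd, Pd, dif_neg h']; exact Commute.zero_right _
  apply op_ext
  intro r
  have hn := pair_ne h h' hne
  simp only [Module.End.mul_apply, Pd_mono _ _ _ _ _ h, Pd_mono _ _ _ _ _ h']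
  rw [tsub_right_comm]
  congr 1
  simp [Finsupp.single_apply, hn, hn.symm, mul_comm]

theorem q_sub_ne (q : ℂ) (hq0 : q ≠ 0) (hq1 : q ≠ 1) (hqm1 : q ≠ -1) : q - q⁻¹ ≠ 0 := by
  intro h
  have h2 : (q - 1) * (q + 1) = 0 := by
    field_simp at h
    linear_combination h
  rcases mul_eq_zero.1 h2 with h | h
  · exact hq1 (sub_eq_zero.1 h)
  · exact hqm1 (eq_neg_of_add_eq_zero_left h)

theorem X_Pd_self (q : ℂ) (hq0 : q ≠ 0) (hq : q - q⁻¹ ≠ 0) (a b : ℕ)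
    (h : a - 1 < m ∧ b - 1 < n) :
    q • (Xop m n a b * Pd q m n a b) - Pd q m n a b * Xop m n a b = - Gam q⁻¹ m n a b := by
  apply op_ext
  intro r
  simp only [Module.End.mul_apply, LinearMap.smul_apply, LinearMap.sub_apply, LinearMap.neg_apply,
    Gam_mono _ _ _ _ _ h, Pd_mono _ _ _ _ _ h, Xop_mono _ _ _ _ h]
  rw [add_tsub_cancel_left]
  rcases hk : r (⟨a - 1, h.1⟩, ⟨b - 1, h.2⟩) with _ | k
  · have : qnum q 1 = 1 := by simp [qnum, div_self hq]
    simp [qnum_zero, hk, this]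
  · have hle : Finsupp.single (⟨a - 1, h.1⟩, ⟨b - 1, h.2⟩) 1 ≤ r := by
      rw [Finsupp.single_le_iff]; omega
    rw [add_tsub_cancel_of_le hle, smul_monomial, ← map_sub, ← map_neg]
    congr 1
    simp only [Finsupp.add_apply, Finsupp.single_eq_same, smul_eq_mul, hk, qnum, mul_one]
    rw [mul_div_assoc', ← sub_div, div_eq_iff hq]
    have : q * q⁻¹ = 1 := mul_inv_cancel₀ hq0
    have e : 1 + (k + 1) = (k + 1) + 1 := by ring
    rw [e, pow_succ q (k+1), pow_succ q⁻¹ (k+1)]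
    ring

end Help

section Help2
variable {m n : ℕ}

def Gp (q : ℂ) (m n k b : ℕ) : Module.End ℂ (Pmn m n) :=
  ((List.range k).map (fun t => Gam q m n (t + 1) (b + 1) * Gam q⁻¹ m n (t + 1) b)).prod

def Th (q : ℂ) (m n i g : ℕ) (κ : ℕ → ℕ) : Module.End ℂ (Pmn m n) :=
  ((List.range g).map (fun t =>
    if κ t = κ (t + 1) then Gam q⁻¹ m n (κ t) (i + t + 1)
    else Pd q m n (κ t) (i + t + 1) * Xop m n (κ (t + 1)) (i + t + 1))).prod

def Hh (q : ℂ) (m n i s : ℕ) (κ : ℕ → ℕ) : Module.End ℂ (Pmn m n) :=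
  ((List.range s).map (fun a => Gp q m n (κ a) (i + a))).prod

def Tm (q : ℂ) (m n i g : ℕ) (κ : ℕ → ℕ) : Module.End ℂ (Pmn m n) :=
  Xop m n (κ 0) i * Th q m n i g κ * Pd q m n (κ g) (i + g + 1) * Hh q m n i (g + 1) κ

theorem Gp_succ (q : ℂ) (k b : ℕ) : Gp q m n (k + 1) b =
    Gp q m n k b * (Gam q m n (k + 1) (b + 1) * Gam q⁻¹ m n (k + 1) b) := by
  simp [Gp, List.range_succ]

theorem Hh_succ (q : ℂ) (i s : ℕ) (κ : ℕ → ℕ) : Hh q m n i (s + 1) κ =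
    Gp q m n (κ 0) i * Hh q m n (i + 1) s (fun t => κ (t + 1)) := by
  rw [Hh, List.range_succ_eq_map, List.map_cons, List.prod_cons, List.map_map, Hh]
  congr 3
  funext t
  simp only [Function.comp]
  congr 1
  omega

theorem Th_succ (q : ℂ) (i s : ℕ) (κ : ℕ → ℕ) : Th q m n i (s + 1) κ =
    (if κ 0 = κ 1 then Gam q⁻¹ m n (κ 0) (i + 1)
      else Pd q m n (κ 0) (i + 1) * Xop m n (κ 1) (i + 1)) *
      Th q m n (i + 1) s (fun t => κ (t + 1)) := by
  rw [Th, List.range_succ_eq_map, List.map_cons, List.prod_cons, List.map_map, Th]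
  congr 3
  funext t
  have e : i + (t + 1) + 1 = i + 1 + t + 1 := by omega
  simp only [Function.comp, Nat.succ_eq_add_one, e]

theorem comm_Gp (q : ℂ) (Z : Module.End ℂ (Pmn m n)) (k b : ℕ)
    (h1 : ∀ c a, Commute Z (Gam c m n a (b + 1))) (h2 : ∀ c a, Commute Z (Gam c m n a b)) :
    Commute Z (Gp q m n k b) := by
  apply Commute.list_prod_right
  intro x hx
  obtain ⟨t, -, rfl⟩ := List.mem_map.1 hx
  exact (h1 _ _).mul_right (h2 _ _)

theorem comm_Hh (q : ℂ) (Z : Module.End ℂ (Pmn m n)) (i s : ℕ) (κ : ℕ → ℕ)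
    (h1 : ∀ c a b, i ≤ b → Commute Z (Gam c m n a b)) :
    Commute Z (Hh q m n i s κ) := by
  apply Commute.list_prod_right
  intro x hx
  obtain ⟨t, -, rfl⟩ := List.mem_map.1 hx
  exact comm_Gp _ _ _ _ (fun c a => h1 _ _ _ (by omega)) (fun c a => h1 _ _ _ (by omega))

theorem comm_R (q : ℂ) (Z : Module.End ℂ (Pmn m n)) (i g a' : ℕ) (κ : ℕ → ℕ)
    (h1 : ∀ c a b, i + 1 ≤ b → Commute Z (Gam c m n a b))
    (h2 : ∀ a b, i + 1 ≤ b → Commute Z (Pd q m n a b))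
    (h3 : ∀ a b, i + 1 ≤ b → Commute Z (Xop m n a b)) :
    Commute Z (Th q m n i g κ * Pd q m n a' (i + g + 1)) := by
  apply Commute.mul_right _ (h2 _ _ (by omega))
  apply Commute.list_prod_right
  intro x hx
  obtain ⟨t, -, rfl⟩ := List.mem_map.1 hx
  split_ifs
  · exact h1 _ _ _ (by omega)
  · exact (h2 _ _ (by omega)).mul_right (h3 _ _ (by omega))

theorem Gp_Pd (q : ℂ) (hq : q ≠ 0) (k c b : ℕ) (hc : 1 ≤ c) (hb : 1 ≤ b) :
    Gp q m n k b * Pd q m n c b =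
      (if c ≤ k then q else 1) • (Pd q m n c b * Gp q m n k b) := by
  induction k with
  | zero => simp [Gp, show c ≠ 0 by omega]
  | succ k ih =>
    rw [Gp_succ]
    have e1 : Gam q m n (k + 1) (b + 1) * Pd q m n c b = Pd q m n c b * Gam q m n (k + 1) (b + 1) :=
      Gam_Pd _ _ _ _ _ _ (Or.inr (by omega))
    by_cases hk : c = k + 1
    · subst hk
      rw [if_neg (by omega), one_smul] at ih
      rw [if_pos le_rfl, mul_assoc, mul_assoc, Gam_Pd_self q q hq, mul_smul_comm, mul_smul_comm,
        ← mul_assoc (Gam q m n _ _), e1, mul_assoc, ← mul_assoc, ih, mul_assoc]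
    · have e2 : Gam q⁻¹ m n (k + 1) b * Pd q m n c b = Pd q m n c b * Gam q⁻¹ m n (k + 1) b :=
        Gam_Pd _ _ _ _ _ _ (Or.inl (by omega))
      have : (c ≤ k + 1) ↔ c ≤ k := by omega
      simp only [this]
      rw [mul_assoc, mul_assoc, e2, ← mul_assoc (Gam q m n _ _), e1, mul_assoc, ← mul_assoc, ih,
        smul_mul_assoc, mul_assoc]

theorem Gp_X (q : ℂ) (k c b : ℕ) (hc : 1 ≤ c) (hb : 1 ≤ b) :
    Gp q m n k b * Xop m n c (b + 1) =
      (if c ≤ k then q else 1) • (Xop m n c (b + 1) * Gp q m n k b) := by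
  induction k with
  | zero => simp [Gp, show c ≠ 0 by omega]
  | succ k ih =>
    rw [Gp_succ]
    have e1 : Gam q⁻¹ m n (k + 1) b * Xop m n c (b + 1) =
        Xop m n c (b + 1) * Gam q⁻¹ m n (k + 1) b :=
      Gam_Xop _ _ _ _ _ (Or.inr (by omega))
    by_cases hk : c = k + 1
    · subst hk
      rw [if_neg (by omega), one_smul] at ih
      rw [if_pos le_rfl, mul_assoc, mul_assoc, e1, ← mul_assoc (Gam q m n _ _), Gam_Xop_self,
        smul_mul_assoc, mul_smul_comm, mul_assoc, ← mul_assoc, ih, mul_assoc]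
    · have e2 : Gam q m n (k + 1) (b + 1) * Xop m n c (b + 1) =
          Xop m n c (b + 1) * Gam q m n (k + 1) (b + 1) :=
        Gam_Xop _ _ _ _ _ (Or.inl (by omega))
      have : (c ≤ k + 1) ↔ c ≤ k := by omega
      simp only [this]
      rw [mul_assoc, mul_assoc, e1, ← mul_assoc (Gam q m n _ _), e2, mul_assoc, ← mul_assoc, ih,
        smul_mul_assoc, mul_assoc]

theorem abs_comm {A : Type*} [Ring A] [Algebra ℂ A] (p al be : ℂ) (X0 D G Y G' R H : A)
    (xY : Commute X0 Y) (xR : Commute X0 R) (xG' : Commute X0 G') (xH : Commute X0 H)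
    (dH : Commute D H) (dR : Commute D R) (gH : Commute G H) (gG : Commute G G')
    (gR : Commute G R) (e1 : G' * D = al • (D * G')) (e2 : G * Y = be • (Y * G)) :
    Y * R * (G' * H) * (X0 * D * G) - p • (X0 * D * G * (Y * R * (G' * H))) =
      X0 * (al • (Y * D) - (p * be) • (D * Y)) * (R * (G * (G' * H))) := by
  have TA : Y * R * (G' * H) * (X0 * D * G) = al • (X0 * (Y * D) * (R * (G * (G' * H)))) := by
    have c1 : Commute X0 (Y * R * (G' * H)) :=
      (xY.mul_right xR).mul_right (xG'.mul_right xH)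
    have c2 : Commute G (G' * H) := gG.mul_right gH
    calc Y * R * (G' * H) * (X0 * D * G) = (Y * R * (G' * H) * X0) * (D * G) := by
          simp only [mul_assoc]
      _ = X0 * (Y * R * (G' * H)) * (D * G) := by rw [c1.eq]
      _ = X0 * Y * R * G' * (H * D) * G := by simp only [mul_assoc]
      _ = X0 * Y * R * (G' * D) * (H * G) := by rw [← dH.eq]; simp only [mul_assoc]
      _ = al • (X0 * Y * (R * D) * ((G' * H) * G)) := by
          rw [e1]; simp only [mul_assoc, mul_smul_comm, smul_mul_assoc]
      _ = _ := by rw [← c2.eq, ← dR.eq]; simp only [mul_assoc]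
  have AT : X0 * D * G * (Y * R * (G' * H)) = be • (X0 * (D * Y) * (R * (G * (G' * H)))) := by
    calc X0 * D * G * (Y * R * (G' * H)) = X0 * D * (G * Y) * R * (G' * H) := by
          simp only [mul_assoc]
      _ = be • (X0 * D * Y * (G * R) * (G' * H)) := by
          rw [e2]; simp only [mul_assoc, mul_smul_comm, smul_mul_assoc]
      _ = _ := by rw [gR.eq]; simp only [mul_assoc]
  rw [TA, AT, smul_smul, mul_sub, sub_mul]
  simp only [mul_smul_comm, smul_mul_assoc]

theorem abs_sum {A : Type*} [Ring A] [Algebra ℂ A] {ι κ : Type*} [Fintype ι] [Fintype κ] (p : ℂ)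
    (u : κ → A) (v : ι → A) (w : ι → κ → A)
    (h : ∀ c k, u k * v c - p • (v c * u k) = - w c k) :
    (-∑ k, u k) * (-∑ c, v c) - p • ((-∑ c, v c) * (-∑ k, u k)) = -∑ c, ∑ k, w c k := by
  rw [neg_mul_neg, neg_mul_neg, Finset.sum_mul_sum, Finset.sum_mul_sum, Finset.sum_comm,
    Finset.smul_sum, ← Finset.sum_sub_distrib, ← Finset.sum_neg_distrib]
  apply Finset.sum_congr rfl
  intro c _
  rw [Finset.smul_sum, ← Finset.sum_sub_distrib, ← Finset.sum_neg_distrib]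
  exact Finset.sum_congr rfl (fun k _ => h c k)

theorem abs_neg_smul {A : Type*} [Ring A] [Algebra ℂ A] (a x b : ℂ) (T : A) (h : a * x = -b) :
    a • x • T = -(b • T) := by
  rw [smul_smul, h, neg_smul]

/-- prepend -/
def kcons (c : ℕ) (κ : ℕ → ℕ) : ℕ → ℕ
  | 0 => c
  | t + 1 => κ t

theorem step (q : ℂ) (hq0 : q ≠ 0) (hq : q - q⁻¹ ≠ 0) (i g c : ℕ) (κ : ℕ → ℕ) (hi : 1 ≤ i)
    (hin : i + 1 ≤ n) (hc : 1 ≤ c) (hcm : c ≤ m) (hk : 1 ≤ κ 0) :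
    Tm q m n (i + 1) g κ * (Xop m n c i * Pd q m n c (i + 1) * Gp q m n c i) -
      q⁻¹ • ((Xop m n c i * Pd q m n c (i + 1) * Gp q m n c i) * Tm q m n (i + 1) g κ) =
    (if c < κ 0 then -(q⁻¹ - q) else if c = κ 0 then -1 else 0) •
      Tm q m n i (g + 1) (kcons c κ) := by
  have eT : Tm q m n (i + 1) g κ = Xop m n (κ 0) (i + 1) *
      (Th q m n (i + 1) g κ * Pd q m n (κ g) (i + 1 + g + 1)) *
      (Gp q m n (κ 0) (i + 1) * Hh q m n (i + 1 + 1) g (fun t => κ (t + 1))) := by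
    rw [Tm, Hh_succ]; simp only [mul_assoc]
  rw [eT, abs_comm q⁻¹ (if c ≤ κ 0 then q else 1) (if κ 0 ≤ c then q else 1)]
  · have eT2 : Tm q m n i (g + 1) (kcons c κ) = Xop m n c i *
      (if c = κ 0 then Gam q⁻¹ m n c (i + 1)
      else Pd q m n c (i + 1) * Xop m n (κ 0) (i + 1)) *
      ((Th q m n (i + 1) g κ * Pd q m n (κ g) (i + 1 + g + 1)) * (Gp q m n c i *
      (Gp q m n (κ 0) (i + 1) * Hh q m n (i + 1 + 1) g (fun t => κ (t + 1))))) := by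
      rw [Tm, Hh_succ, Hh_succ, Th_succ]
      have e : i + (g + 1) + 1 = i + 1 + g + 1 := by omega
      have k1 : kcons c κ 1 = κ 0 := rfl
      have k0 : kcons c κ 0 = c := rfl
      have k2 : kcons c κ (g + 1) = κ g := rfl
      have k3 : (fun t => kcons c κ (t + 1)) = κ := rfl
      have k4 : (fun t => kcons c κ (t + 1 + 1)) = (fun t => κ (t + 1)) := rfl
      simp only [k0, k1, k2, k3, k4, mul_assoc, e]
    suffices core : (if c ≤ κ 0 then q else 1) • (Xop m n (κ 0) (i + 1) * Pd q m n c (i + 1)) -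
        (q⁻¹ * (if κ 0 ≤ c then q else 1)) • (Pd q m n c (i + 1) * Xop m n (κ 0) (i + 1)) =
        (if c < κ 0 then -(q⁻¹ - q) else if c = κ 0 then -1 else 0) •
        (if c = κ 0 then Gam q⁻¹ m n c (i + 1)
          else Pd q m n c (i + 1) * Xop m n (κ 0) (i + 1)) by
      rw [eT2, core]
      simp only [smul_mul_assoc, mul_smul_comm]
    clear eT eT2
    rcases lt_trichotomy c (κ 0) with h | h | h
    · rw [if_pos h.le, if_neg (by omega), if_pos h, if_neg (by omega),
        (Xop_Pd q (κ 0) (i+1) c (i+1) (Or.inl (by omega))).eq, mul_one, neg_sub]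
      exact (sub_smul _ _ _).symm
    · rw [← h]
      rw [if_pos le_rfl, if_neg (by omega), if_pos rfl, if_pos rfl, inv_mul_cancel₀ hq0,
        one_smul, X_Pd_self q hq0 hq _ _ (by omega)]
      exact (neg_one_smul ℂ _).symm
    · rw [if_neg (by omega), if_pos h.le, if_neg (by omega), if_neg (by omega),
        (Xop_Pd q (κ 0) (i+1) c (i+1) (Or.inl (by omega))).eq, inv_mul_cancel₀ hq0, zero_smul,
        sub_self]
  · exact Xop_Xop _ _ _ _
  · exact comm_R _ _ _ _ _ _ (fun c a b h => (Gam_Xop _ _ _ _ _ (Or.inr (by omega))).symm)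
      (fun a b h => Xop_Pd _ _ _ _ _ (Or.inr (by omega))) (fun a b h => Xop_Xop _ _ _ _)
  · exact comm_Gp _ _ _ _ (fun c a => (Gam_Xop _ _ _ _ _ (Or.inr (by omega))).symm)
      (fun c a => (Gam_Xop _ _ _ _ _ (Or.inr (by omega))).symm)
  · exact comm_Hh _ _ _ _ _ (fun c a b h => (Gam_Xop _ _ _ _ _ (Or.inr (by omega))).symm)
  · exact comm_Hh _ _ _ _ _ (fun c a b h => (Gam_Pd _ _ _ _ _ _ (Or.inr (by omega))).symm)
  · exact comm_R _ _ _ _ _ _ (fun c a b h => (Gam_Pd _ _ _ _ _ _ (Or.inr (by omega))).symm)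
      (fun a b h => Pd_Pd _ _ _ _ _ (Or.inr (by omega)))
      (fun a b h => (Xop_Pd _ _ _ _ _ (Or.inr (by omega))).symm)
  · exact comm_Hh _ _ _ _ _ (fun c a b h =>
      (comm_Gp _ _ _ _ (fun _ _ => Gam_Gam _ _ _ _ _ _) (fun _ _ => Gam_Gam _ _ _ _ _ _)).symm)
  · exact comm_Gp _ _ _ _ (fun c a =>
      (comm_Gp _ _ _ _ (fun _ _ => Gam_Gam _ _ _ _ _ _) (fun _ _ => Gam_Gam _ _ _ _ _ _)).symm)
      (fun c a =>
      (comm_Gp _ _ _ _ (fun _ _ => Gam_Gam _ _ _ _ _ _) (fun _ _ => Gam_Gam _ _ _ _ _ _)).symm)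
  · exact comm_R _ _ _ _ _ _ (fun c a b h =>
      (comm_Gp _ _ _ _ (fun _ _ => Gam_Gam _ _ _ _ _ _) (fun _ _ => Gam_Gam _ _ _ _ _ _)).symm)
      (fun a b h => (comm_Gp _ _ _ _
        (fun _ _ => (Gam_Pd _ _ _ _ _ _ (Or.inr (by omega))).symm)
        (fun _ _ => (Gam_Pd _ _ _ _ _ _ (Or.inr (by omega))).symm)).symm)
      (fun a b h => (comm_Gp _ _ _ _
        (fun _ _ => (Gam_Xop _ _ _ _ _ (Or.inr (by omega))).symm)
        (fun _ _ => (Gam_Xop _ _ _ _ _ (Or.inr (by omega))).symm)).symm)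
  · exact Gp_Pd q hq0 _ _ _ hc (by omega)
  · exact Gp_X q _ _ _ hk hi

def kext {s : ℕ} (k : Fin s → Fin m) : ℕ → ℕ :=
  fun t => if h : t < s then (k ⟨t, h⟩ : ℕ) + 1 else 1

theorem kext_cons {s : ℕ} (c : Fin m) (k : Fin s → Fin m) :
    kext (Fin.cons c k : Fin (s + 1) → Fin m) = kcons (c + 1) (kext k) := by
  funext t
  cases t with
  | zero => simp [kext, kcons]
  | succ t =>
    simp only [kext, kcons]
    by_cases h : t < s
    · rw [dif_pos h, dif_pos (by omega)]
      congr 2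
    · rw [dif_neg h, dif_neg (by omega)]

open scoped Classical in
theorem mainF (q : ℂ) (hq0 : q ≠ 0) (hq : q - q⁻¹ ≠ 0) (F : ℕ → Module.End ℂ (Pmn m n))
    (hF : ∀ i, 1 ≤ i → i ≤ n - 1 → F i = -∑ c : Fin m,
      Xop m n (c + 1) i * Pd q m n (c + 1) (i + 1) * Gp q m n (c + 1) i) (g : ℕ) :
    ∀ i j : ℕ, 1 ≤ i → j = i + g + 1 → j ≤ n →
      EdnAux q F j g = -∑ k ∈ Finset.univ.filter (fun k : Fin (g + 1) → Fin m => Monotone k),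
        ((q⁻¹ - q) ^ ((Finset.image k Finset.univ).card - 1)) • Tm q m n i g (kext k) := by
  induction g with
  | zero =>
    intro i j hi hj hjn
    subst hj
    rw [EdnAux, Nat.add_sub_cancel, Nat.add_zero, hF i hi (by omega)]
    congr 1
    rw [Finset.filter_true_of_mem (fun k _ a b _ => le_of_eq (congrArg k (Subsingleton.elim (α := Fin 1) a b)))]
    symm
    apply Fintype.sum_equiv (Equiv.funUnique (Fin 1) (Fin m))
    intro k
    have : (Finset.image k Finset.univ).card = 1 := by simp
    rw [this]
    simp [Tm, Th, Hh, kext]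
  | succ g ih =>
    intro i j hi hj hjn
    rw [EdnAux, ih (i + 1) j (by omega) (by omega) hjn, show j - g - 2 = i by omega,
      hF i hi (by omega)]
    have eR : (∑ k ∈ Finset.univ.filter (fun k : Fin (g + 1 + 1) → Fin m => Monotone k),
        ((q⁻¹ - q) ^ ((Finset.image k Finset.univ).card - 1)) • Tm q m n i (g + 1) (kext k)) =
        ∑ c : Fin m, ∑ k : Fin (g + 1) → Fin m,
        if Monotone (Fin.consEquiv (fun _ => Fin m) (c, k)) then
        ((q⁻¹ - q) ^ ((Finset.image (Fin.consEquiv (fun _ => Fin m) (c, k))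
          Finset.univ).card - 1)) •
            Tm q m n i (g + 1) (kext (Fin.consEquiv (fun _ => Fin m) (c, k))) else 0 := by
      rw [Finset.sum_filter, ← (Fin.consEquiv (fun _ => Fin m)).sum_comp,
        Fintype.sum_prod_type]
    rw [eR, Finset.sum_filter]
    refine abs_sum q⁻¹ _ _ _ ?_
    intro c k
    have hmono : Monotone (Fin.consEquiv (fun _ => Fin m) (c, k) : Fin (g + 2) → Fin m) ↔
        c ≤ k 0 ∧ Monotone k := monotone_vecCons
    simp only [hmono]
    by_cases hk : Monotone k
    swap
    · simp [hk]
    have hk0 : kext k 0 = k 0 + 1 := by simp [kext]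
    have st := step (m := m) (n := n) q hq0 hq i g (c + 1) (kext k) hi (by omega) (by omega)
      (by omega) (by omega)
    have im : Finset.image (Fin.consEquiv (fun _ => Fin m) (c, k) : Fin (g + 2) → Fin m)
        Finset.univ = insert c (Finset.image k Finset.univ) := by
      ext x
      simp [Fin.consEquiv, Fin.exists_fin_succ, eq_comm]
    have hpos : 0 < (Finset.image k Finset.univ).card :=
      Finset.card_pos.2 ⟨k 0, Finset.mem_image_of_mem _ (Finset.mem_univ _)⟩
    have ec : kext (Fin.consEquiv (fun _ => Fin m) (c, k) : Fin (g + 2) → Fin m) =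
      kcons (c + 1) (kext k) := kext_cons c k
    simp only [hk, and_true, if_true]
    rw [smul_mul_assoc, mul_smul_comm, smul_comm q⁻¹]
    refine (smul_sub _ _ _).symm.trans ((congrArg _ st).trans ?_)
    rw [im, ec, hk0]
    rcases lt_trichotomy c (k 0) with h | h | h
    · have hnot : c ∉ Finset.image k Finset.univ := by
        intro hx
        obtain ⟨t, -, ht⟩ := Finset.mem_image.1 hx
        have := hk (Fin.zero_le t)
        rw [ht] at this
        exact absurd h (not_lt.2 this)
      have h' : (c : ℕ) + 1 < k 0 + 1 := by have := Fin.lt_def.1 h; omega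
      rw [if_pos h', if_pos h.le, Finset.card_insert_of_notMem hnot]
      refine abs_neg_smul (A := Module.End ℂ (Pmn m n)) _ _ _ (Tm q m n i (g + 1) (kcons _ (kext k))) ?_
      rw [mul_neg, ← pow_succ]
      congr 2
      omega
    · subst h
      rw [if_neg (lt_irrefl _), if_pos rfl, if_pos le_rfl, Finset.insert_eq_of_mem (by simp)]
      refine abs_neg_smul (A := Module.End ℂ (Pmn m n)) _ _ _ (Tm q m n i (g + 1) (kcons _ (kext k))) ?_
      rw [mul_neg_one]
    · have h' : ¬ ((c : ℕ) + 1 < k 0 + 1) := by have := Fin.lt_def.1 h; omega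
      have h'' : ¬ ((c : ℕ) + 1 = k 0 + 1) := by have := Fin.lt_def.1 h; omega
      rw [if_neg h', if_neg h'', if_neg (not_le.2 h)]
      simp

theorem EdnAux_map {U V : Type*} [Ring U] [Algebra ℂ U] [Ring V] [Algebra ℂ V] (q : ℂ)
    (ρ : U →ₐ[ℂ] V) (f : ℕ → U) (j g : ℕ) :
    ρ (EdnAux q f j g) = EdnAux q (fun a => ρ (f a)) j g := by
  induction g with
  | zero => rfl
  | succ g ih => simp [EdnAux, ih]

theorem oprod_Gp (q : ℂ) (k i : ℕ) :
    oprod 1 k (fun t => Gam q⁻¹ m n t i * Gam q m n t (i + 1)) = Gp q m n k i := by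
  rw [oprod, Gp, List.range'_eq_map_range, List.map_map, Nat.add_sub_cancel]
  congr 2
  funext t
  simp only [Function.comp, add_comm 1 t]
  exact Gam_Gam _ _ _ _ _ _

end Help2

open scoped Classical in
/-- the explicit formula, by quantum differential operators, for the
action `ρ(E_{j,i})` of the lowering root vectors `E_{j,i}` (`1 ≤ i < j ≤ n`) of the
first block of the Levi subalgebra, where `ρ : U_q(𝔩) → End_ℂ(ℂ[x])` is the
homomorphism determined by the formulas of Theorem 3.  The sum runs over the
nondecreasing `s`-tuples `1 ≤ k_1 ≤ … ≤ k_s ≤ m` (`s = j - i`), encoded as monotone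
functions `k : Fin s → Fin m` (with `k_a = k (a-1) + 1`); `τ` is the number of
distinct values, and `θ` is the ordered product `β_{k_1}⋯β_{k_{s-1}}`. -/
theorem stmt18 (q : ℂ) (hq0 : q ≠ 0) (hq1 : q ≠ 1) (hqm1 : q ≠ -1)
    (m n : ℕ) (hm : 1 ≤ m) (hn : 1 ≤ n)
    (ρ : UqL q n m →ₐ[ℂ] Module.End ℂ (Pmn m n))
    (hρ1 : ∀ i, 1 ≤ i → i ≤ n - 1 →
      ρ (lE q n m i) = -(∑ k ∈ Finset.Icc 1 m,
        oprod k m (fun t => Gam q m n t i * Gam q⁻¹ m n t (i + 1)) *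
          Xop m n k (i + 1) * Pd q m n k i))
    (hρ2 : ∀ i, 1 ≤ i → i ≤ n - 1 →
      ρ (lF q n m i) = -(∑ k ∈ Finset.Icc 1 m,
        Xop m n k i * Pd q m n k (i + 1) *
          oprod 1 k (fun t => Gam q⁻¹ m n t i * Gam q m n t (i + 1))))
    (hρ3 : ∀ i, 1 ≤ i → i ≤ n - 1 →
      ρ (lK q n m i) = oprod 1 m (fun t => Gam q⁻¹ m n t i * Gam q m n t (i + 1)))
    (hρ4 : ρ (lK q n m n) =
      oprod 1 n (fun t => Gam q⁻¹ m n 1 t) * oprod 1 m (fun s => Gam q⁻¹ m n s n))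
    (hρ5 : ∀ i, 1 ≤ i → i ≤ m - 1 →
      ρ (lE q n m (n + i)) = ∑ k ∈ Finset.Icc 1 n,
        Xop m n i k * Pd q m n (i + 1) k *
          oprod (k + 1) n (fun t => Gam q m n i t * Gam q⁻¹ m n (i + 1) t))
    (hρ6 : ∀ i, 1 ≤ i → i ≤ m - 1 →
      ρ (lF q n m (n + i)) = ∑ k ∈ Finset.Icc 1 n,
        oprod 1 (k - 1) (fun t => Gam q⁻¹ m n i t * Gam q m n (i + 1) t) *
          Xop m n (i + 1) k * Pd q m n i k)
    (hρ7 : ∀ i, 1 ≤ i → i ≤ m - 1 →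
      ρ (lK q n m (n + i)) = oprod 1 n (fun t => Gam q m n i t * Gam q⁻¹ m n (i + 1) t))
    :
    ∀ i j : ℕ, 1 ≤ i → i < j → j ≤ n →
      ρ (Edn q (fun a => lF q n m a) j i) =
        -(∑ k ∈ Finset.univ.filter (fun k : Fin (j - i) → Fin m => Monotone k),
          (let kk : ℕ → ℕ := fun t => if h : t < j - i then (k ⟨t, h⟩ : ℕ) + 1 else 1
           ((q⁻¹ - q) ^ ((Finset.image k Finset.univ).card - 1)) •
             (Xop m n (kk 0) i *
              ((List.range (j - i - 1)).map (fun t =>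
                if kk t = kk (t + 1) then Gam q⁻¹ m n (kk t) (i + t + 1)
                else Pd q m n (kk t) (i + t + 1) * Xop m n (kk (t + 1)) (i + t + 1))).prod *
              Pd q m n (kk (j - i - 1)) j *
              ((List.range (j - i)).map (fun a =>
                ((List.range (kk a)).map (fun t =>
                  Gam q m n (t + 1) (i + a + 1) * Gam q⁻¹ m n (t + 1) (i + a))).prod)).prod))) := by
  intro i j hi hij hjn
  have hq := q_sub_ne q hq0 hq1 hqm1
  have hF : ∀ i, 1 ≤ i → i ≤ n - 1 → ρ (lF q n m i) = -∑ c : Fin m,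
      Xop m n (c + 1) i * Pd q m n (c + 1) (i + 1) * Gp q m n (c + 1) i := by
    intro i h1 h2
    rw [hρ2 i h1 h2]
    simp only [oprod_Gp]
    rw [Fin.sum_univ_eq_sum_range (fun c => Xop m n (c + 1) i * Pd q m n (c + 1) (i + 1) *
      Gp q m n (c + 1) i) m, Finset.range_eq_Ico, Finset.sum_Ico_add' (fun c => Xop m n c i *
      Pd q m n c (i + 1) * Gp q m n c i)]
    rfl
  generalize hs : j - i = s
  obtain ⟨g, rfl⟩ : ∃ g, s = g + 1 := ⟨s - 1, by omega⟩
  have hj : j = i + g + 1 := by omega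
  have key := mainF q hq0 hq (fun a => ρ (lF q n m a)) hF g i j hi hj hjn
  rw [Edn, EdnAux_map, hs, Nat.add_sub_cancel, key]
  subst hj
  rfl
end
end
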